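/- arXiv:2001.07094 — 6 statements merged into one kernel-verified Lean document; each statement's English description precedes it below -/
import Mathlib

section
/- Let I be a finite type, V a type with subsets V′, V″ ⊆ V satisfying V = V′ ∪ V″, and for each pair i, j ∈ I a subset V_{i,j} ⊆ V. Let ∼ be the equivalence relation on I generated by: i ∼ j whenever V_{i,j} ≠ ∅. Assume: (H) if V_{i,j} ≠ ∅ then V_{i,j} ∩ V′ ≠ ∅; (i) A : V → ℤ/2ℤ has finite support and ∑_{v∈V} A(v) = 0; (ii) for each v ∈ V, every a ∈ 𝒞^v satisfies ∑_{i∈I} a(i) = A(v); (iii) if v ∈ V′ and v ∈ V_{i,j}, then 𝒞^v is stable under a ↦ a + δ_i + δ_j. Then for every family a = (a^v)_{v∈V} with a^v ∈ 𝒞^v for all v and a^v = 0 for all but finitely many v, and for all i, j ∈ I with i ≠ j and i ∼ j, there exists a family b = (b^v)_{v∈V} with b^v ∈ 𝒞^v for all v and b^v = 0 for all but finitely many v, such that for every k ∈ I: ∑_{v∈V} b^v(k) = ∑_{v∈V} a^v(k) + δ_i(k) + δ_j(k) in ℤ/2ℤ. -/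
/-- The function `I → ℤ/2ℤ` equal to `1` at `k` and `0` elsewhere. -/
def deltaFn {I : Type*} [DecidableEq I] (k : I) : I → ZMod 2 :=
  fun l => if l = k then 1 else 0

/-- Adding `d` to the member of a finitely supported family at `v` adds `d` to the sum. -/
theorem finsum_add_single_apply {I V M : Type*} [DecidableEq V] [AddCommMonoid M]
    (a : V → I → M) (ha : {v | a v ≠ 0}.Finite) (v : V) (d : I → M) (k : I) :
    ∑ᶠ w, (a + Pi.single v d : V → I → M) w k = (∑ᶠ w, a w k) + d k := by
  have hsingle : ∀ w, w ≠ v → (Pi.single v d : V → I → M) w k = 0 := by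
    intro w hw
    simp [Pi.single_eq_of_ne hw]
  have ha' : (Function.support fun w => a w k).Finite := by
    refine ha.subset fun w hw h => hw ?_
    simp [h]
  have hd : (Function.support fun w => (Pi.single v d : V → I → M) w k).Finite := by
    refine (Set.finite_singleton v).subset fun w hw => ?_
    by_contra h
    exact hw (hsingle w h)
  simp only [Pi.add_apply]
  rw [finsum_add_distrib ha' hd, finsum_eq_single _ v hsingle, Pi.single_eq_same]

/-- If `C v` is stable under adding `δ_i + δ_j` for some `v`, then a finitely supported family of
members of `C` can be modified so that its sum changes by `δ_i + δ_j`. -/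
theorem exists_family_finsum_add_deltaFn {I V : Type*} [DecidableEq I]
    (C : V → Set (I → ZMod 2)) (v : V) (i j : I)
    (hC : ∀ x ∈ C v, x + deltaFn i + deltaFn j ∈ C v)
    (a : V → I → ZMod 2) (ha_mem : ∀ w, a w ∈ C w) (ha_fin : {w | a w ≠ 0}.Finite) :
    ∃ b : V → I → ZMod 2, (∀ w, b w ∈ C w) ∧ {w | b w ≠ 0}.Finite ∧
      ∀ k, ∑ᶠ w, b w k = (∑ᶠ w, a w k) + deltaFn i k + deltaFn j k := by
  classical
  refine ⟨a + Pi.single v (deltaFn i + deltaFn j), fun w => ?_, ?_, fun k => ?_⟩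
  · by_cases h : w = v
    · subst h
      simpa [add_assoc] using hC _ (ha_mem w)
    · simpa [Pi.single_eq_of_ne h] using ha_mem w
  · refine (ha_fin.insert v).subset fun w hw => ?_
    by_cases h : w = v
    · exact Or.inl h
    · exact Or.inr (by simpa [Pi.single_eq_of_ne h] using hw)
  · rw [finsum_add_single_apply a ha_fin, Pi.add_apply, add_assoc]

theorem stmt_1 {I : Type*} [Fintype I] [DecidableEq I]
    {V : Type*} (V' V'' : Set V) (hV : V' ∪ V'' = Set.univ)
    (Vij : I → I → Set V)
    (C : V → Set (I → ZMod 2))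
    (A : V → ZMod 2)
    (hH : ∀ i j, (Vij i j).Nonempty → (Vij i j ∩ V').Nonempty)
    (hA_fin : (Function.support A).Finite)
    (hA_sum : ∑ᶠ v, A v = 0)
    (hC_sum : ∀ v, ∀ a ∈ C v, ∑ i, a i = A v)
    (hC_stable : ∀ v ∈ V', ∀ i j, v ∈ Vij i j →
      ∀ a ∈ C v, a + deltaFn i + deltaFn j ∈ C v)
    (a : V → (I → ZMod 2)) (ha_mem : ∀ v, a v ∈ C v)
    (ha_fin : {v | a v ≠ 0}.Finite)
    (i j : I) (hij : i ≠ j)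
    (hequiv : Relation.EqvGen (fun i j : I => (Vij i j).Nonempty) i j) :
    ∃ b : V → (I → ZMod 2), (∀ v, b v ∈ C v) ∧ {v | b v ≠ 0}.Finite ∧
      ∀ k, ∑ᶠ v, b v k = (∑ᶠ v, a v k) + deltaFn i k + deltaFn j k := by
  clear hij
  induction hequiv generalizing a with
  | rel i j h =>
    obtain ⟨v, hv, hv'⟩ := hH i j h
    exact exists_family_finsum_add_deltaFn C v i j (hC_stable v hv' i j hv) a ha_mem ha_fin
  | refl i =>
    exact ⟨a, ha_mem, ha_fin, fun k => by rw [add_assoc, CharTwo.add_self_eq_zero, add_zero]⟩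
  | symm i j _ ih =>
    obtain ⟨b, hb_mem, hb_fin, hb⟩ := ih a ha_mem ha_fin
    exact ⟨b, hb_mem, hb_fin, fun k => by rw [hb, add_right_comm]⟩
  | trans i j l _ _ ih₁ ih₂ =>
    obtain ⟨b, hb_mem, hb_fin, hb⟩ := ih₁ a ha_mem ha_fin
    obtain ⟨c, hc_mem, hc_fin, hc⟩ := ih₂ b hb_mem hb_fin
    refine ⟨c, hc_mem, hc_fin, fun k => ?_⟩
    rw [hc, hb, add_assoc _ (deltaFn j k) (deltaFn j k), CharTwo.add_self_eq_zero, add_zero]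
end

section
/- Let I be a finite type, V a type with subsets V′, V″ ⊆ V satisfying V = V′ ∪ V″, and for each pair i, j ∈ I a subset V_{i,j} ⊆ V. Let ∼ be the equivalence relation on I generated by: i ∼ j whenever V_{i,j} ≠ ∅. Assume: (H) if V_{i,j} ≠ ∅ then V_{i,j} ∩ V′ ≠ ∅; (i) A : V → ℤ/2ℤ has finite support and ∑_{v∈V} A(v) = 0; (ii) for each v ∈ V, every a ∈ 𝒞^v satisfies ∑_{i∈I} a(i) = A(v); (iii) if v ∈ V′ and v ∈ V_{i,j}, then 𝒞^v is stable under a ↦ a + δ_i + δ_j. Let a = (a^v)_{v∈V} be a family with a^v ∈ 𝒞^v for all v and a^v = 0 for all but finitely many v, and suppose that for every c : I → ℤ/2ℤ which is constant on ∼-equivalence classes one has ∑_{v∈V} ∑_{i∈I} c(i)·a^v(i) = 0. Then there exists a family b = (b^v)_{v∈V} with b^v ∈ 𝒞^v for all v and b^v = 0 for all but finitely many v such that ∑_{v∈V} b^v(i) = 0 for every i ∈ I. -/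
theorem deltaFn_add_self {I : Type*} [DecidableEq I] (k : I) : deltaFn k + deltaFn k = 0 :=
  funext fun _ => CharTwo.add_self_eq_zero _

theorem sum_mul_deltaFn {I : Type*} [Fintype I] [DecidableEq I] (c : I → ZMod 2) (k : I) :
    ∑ l, c l * deltaFn k l = c k := by
  simp [deltaFn]

/-- If `P` is stable under adding `δ_i + δ_j` for related `i, j`, and holds at some `s` orthogonal
to every function that is constant on classes, then `P` holds at `0`. -/
theorem zero_of_stable_add_deltaFn {I : Type*} [Fintype I] [DecidableEq I] {r : I → I → Prop}
    (hr : Equivalence r) {P : (I → ZMod 2) → Prop}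
    (hP : ∀ i j, r i j → ∀ s, P s → P (s + deltaFn i + deltaFn j))
    (s : I → ZMod 2) (hs : P s)
    (hc : ∀ c : I → ZMod 2, (∀ i j, r i j → c i = c j) → ∑ i, c i * s i = 0) : P 0 := by
  classical
  induction hn : (Finset.univ.filter fun i => s i ≠ 0).card using Nat.strong_induction_on
    generalizing s with
  | _ n ih =>
  by_cases h0 : s = 0
  · exact h0 ▸ hs
  obtain ⟨i, hi⟩ := Function.ne_iff.mp h0
  have eq_one : ∀ x : ZMod 2, x ≠ 0 → x = 1 := by decide
  obtain ⟨j, hji, hij, hj⟩ : ∃ j, j ≠ i ∧ r i j ∧ s j ≠ 0 := by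
    by_contra! hcon
    have hsum := hc (fun j => if r i j then 1 else 0) fun k l hkl => by
      have : r i k ↔ r i l := ⟨fun h => hr.trans h hkl, fun h => hr.trans h (hr.symm hkl)⟩
      simp only [this]
    rw [Finset.sum_eq_single i] at hsum
    · simp only [hr.refl i, if_true, one_mul] at hsum
      exact hi hsum
    · intro j _ hji
      by_cases hij : r i j
      · simp [hcon j hji hij]
      · simp [hij]
    · simp
  refine ih _ ?_ (s + deltaFn i + deltaFn j) (hP i j hij s hs) ?_ rfl
  · rw [← hn]
    refine Finset.card_lt_card (Finset.ssubset_iff_of_subset ?_ |>.mpr ⟨i, ?_, ?_⟩)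
    · intro k hk
      simp only [Finset.mem_filter, Finset.mem_univ, true_and] at hk ⊢
      rintro hk0
      by_cases hki : k = i
      · exact hi (hki ▸ hk0)
      by_cases hkj : k = j
      · exact hj (hkj ▸ hk0)
      simp [deltaFn, hki, hkj, hk0] at hk
    · simpa using hi
    · have hzero : (s + deltaFn i + deltaFn j) i = 0 := by
        simp only [Pi.add_apply, deltaFn, eq_one _ hi, hji.symm, if_true, if_false]
        decide
      simpa using hzero
  · intro c hcc
    simp only [Pi.add_apply, mul_add, Finset.sum_add_distrib, sum_mul_deltaFn, hc c hcc,
      hcc i j hij, zero_add]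
    exact CharTwo.add_self_eq_zero _

/-- `s` is the total of a finitely supported family with members in the sets `C v`. -/
def IsFamilyTotal {I V : Type*} (C : V → Set (I → ZMod 2)) (s : I → ZMod 2) : Prop :=
  ∃ b : V → (I → ZMod 2), (∀ v, b v ∈ C v) ∧ {v | b v ≠ 0}.Finite ∧ ∑ᶠ v, b v = s

theorem finsum_family_apply {I V : Type*} {b : V → (I → ZMod 2)} (hb : {v | b v ≠ 0}.Finite)
    (i : I) : (∑ᶠ v, b v) i = ∑ᶠ v, b v i :=
  (Pi.evalAddMonoidHom (fun _ : I => ZMod 2) i).map_finsum hb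

theorem IsFamilyTotal.add {I V : Type*} {C : V → Set (I → ZMod 2)} {s d : I → ZMod 2}
    (hs : IsFamilyTotal C s) {w : V} (hw : ∀ a ∈ C w, a + d ∈ C w) : IsFamilyTotal C (s + d) := by
  classical
  obtain ⟨b, hbC, hbfin, rfl⟩ := hs
  have hsingle : (Function.support (Pi.single w d : V → I → ZMod 2)).Finite :=
    (Set.finite_singleton w).subset Pi.support_single_subset
  refine ⟨b + (Pi.single w d : V → I → ZMod 2), fun v => ?_,
    (hbfin.union hsingle).subset (Function.support_add b (Pi.single w d)), ?_⟩
  · obtain rfl | hv := eq_or_ne v w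
    · simpa using hw _ (hbC v)
    · simpa [hv] using hbC v
  · have hsum : ∑ᶠ v, (Pi.single w d : V → I → ZMod 2) v = d := by
      rw [finsum_eq_single _ w fun v hv => by simp [hv], Pi.single_eq_same]
    simp only [Pi.add_apply]
    rw [finsum_add_distrib hbfin hsingle, hsum]

theorem stmt_2 {I : Type*} [Fintype I] [DecidableEq I]
    {V : Type*} (V' V'' : Set V) (hV : V' ∪ V'' = Set.univ)
    (Vij : I → I → Set V)
    (C : V → Set (I → ZMod 2))
    (A : V → ZMod 2)
    (hH : ∀ i j, (Vij i j).Nonempty → (Vij i j ∩ V').Nonempty)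
    (hA_fin : (Function.support A).Finite)
    (hA_sum : ∑ᶠ v, A v = 0)
    (hC_sum : ∀ v, ∀ a ∈ C v, ∑ i, a i = A v)
    (hC_stable : ∀ v ∈ V', ∀ i j, v ∈ Vij i j →
      ∀ a ∈ C v, a + deltaFn i + deltaFn j ∈ C v)
    (a : V → (I → ZMod 2)) (ha_mem : ∀ v, a v ∈ C v)
    (ha_fin : {v | a v ≠ 0}.Finite)
    (ha_zero : ∀ c : I → ZMod 2,
      (∀ i j, Relation.EqvGen (fun i j : I => (Vij i j).Nonempty) i j → c i = c j) →
      ∑ᶠ v, ∑ i, c i * a v i = 0) :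
    ∃ b : V → (I → ZMod 2), (∀ v, b v ∈ C v) ∧ {v | b v ≠ 0}.Finite ∧
      ∀ i, ∑ᶠ v, b v i = 0 := by
  have hstable : ∀ i j, Relation.EqvGen (fun i j : I => (Vij i j).Nonempty) i j →
      ∀ s, IsFamilyTotal C s → IsFamilyTotal C (s + deltaFn i + deltaFn j) := by
    intro i j hij
    induction hij with
    | rel i j h =>
      intro s hs
      obtain ⟨w, hw, hwV⟩ := hH i j h
      rw [add_assoc]
      exact hs.add fun x hx => by simpa only [add_assoc] using hC_stable w hwV i j hw x hx
    | refl i =>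
      intro s hs
      rwa [add_assoc, deltaFn_add_self, add_zero]
    | symm i j _ ih =>
      intro s hs
      rw [add_right_comm]
      exact ih s hs
    | trans i j k _ _ ih₁ ih₂ =>
      intro s hs
      convert ih₂ _ (ih₁ s hs) using 1
      rw [add_assoc (s + deltaFn i), deltaFn_add_self, add_zero]
  obtain ⟨b, hbC, hbfin, hb⟩ := zero_of_stable_add_deltaFn (Relation.EqvGen.is_equivalence _)
    hstable (∑ᶠ v, a v) ⟨a, ha_mem, ha_fin, rfl⟩ fun c hc => by
      let φ : (I → ZMod 2) →+ ZMod 2 :=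
        (Fintype.linearCombination (ZMod 2) c).toAddMonoidHom
      have hφ : ∀ x, φ x = ∑ i, c i * x i := fun x => by
        simp [φ, Fintype.linearCombination_apply, mul_comm]
      rw [← hφ, φ.map_finsum ha_fin]
      simpa only [hφ] using ha_zero c hc
  exact ⟨b, hbC, hbfin, fun i => by rw [← finsum_family_apply hbfin, hb, Pi.zero_apply]⟩
end

section
/- Let I be a finite type, V a type with subsets V′, V″ ⊆ V satisfying V = V′ ∪ V″, and for each pair i, j ∈ I a subset V_{i,j} ⊆ V. Let ∼ be the equivalence relation on I generated by: i ∼ j whenever V_{i,j} ≠ ∅. Assume: (H) if V_{i,j} ≠ ∅ then V_{i,j} ∩ V′ ≠ ∅; (i) A : V → ℤ/2ℤ has finite support and ∑_{v∈V} A(v) = 0; (ii) for each v ∈ V, every a ∈ 𝒞^v satisfies ∑_{i∈I} a(i) = A(v); (iii) if v ∈ V′ and v ∈ V_{i,j}, then 𝒞^v is stable under a ↦ a + δ_i + δ_j; (iv) for each v ∈ V, any two elements of 𝒞^v are equivalent under the equivalence relation on functions I → ℤ/2ℤ generated by a ≈_v a + δ_i + δ_j for pairs i, j with v ∈ V_{i,j}.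 Then for any two families a = (a^v) and b = (b^v) with a^v, b^v ∈ 𝒞^v for all v, a^v = 0 and b^v = 0 for all but finitely many v, and for every c : I → ℤ/2ℤ which is constant on ∼-equivalence classes, ∑_{v∈V} ∑_{i∈I} c(i)·a^v(i) = ∑_{v∈V} ∑_{i∈I} c(i)·b^v(i). -/
/-- A `ZMod 2`-weighted sum is unchanged by flipping two coordinates of equal weight. -/
theorem sum_mul_add_deltaFn_add_deltaFn {I : Type*} [Fintype I] [DecidableEq I]
    (c x : I → ZMod 2) {i j : I} (h : c i = c j) :
    ∑ k, c k * (x + deltaFn i + deltaFn j) k = ∑ k, c k * x k := by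
  simp [deltaFn, mul_add, Finset.sum_add_distrib, h, add_assoc, CharTwo.add_self_eq_zero]

theorem stmt_3 {I : Type*} [Fintype I] [DecidableEq I]
    {V : Type*} (V' V'' : Set V) (hV : V' ∪ V'' = Set.univ)
    (Vij : I → I → Set V)
    (C : V → Set (I → ZMod 2))
    (A : V → ZMod 2)
    (hH : ∀ i j, (Vij i j).Nonempty → (Vij i j ∩ V').Nonempty)
    (hA_fin : (Function.support A).Finite)
    (hA_sum : ∑ᶠ v, A v = 0)
    (hC_sum : ∀ v, ∀ a ∈ C v, ∑ i, a i = A v)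
    (hC_stable : ∀ v ∈ V', ∀ i j, v ∈ Vij i j →
      ∀ a ∈ C v, a + deltaFn i + deltaFn j ∈ C v)
    (hC_equiv : ∀ v, ∀ a ∈ C v, ∀ b ∈ C v,
      Relation.EqvGen (fun x y : I → ZMod 2 =>
        ∃ i j, v ∈ Vij i j ∧ y = x + deltaFn i + deltaFn j) a b)
    (a b : V → (I → ZMod 2))
    (ha_mem : ∀ v, a v ∈ C v) (hb_mem : ∀ v, b v ∈ C v)
    (ha_fin : {v | a v ≠ 0}.Finite) (hb_fin : {v | b v ≠ 0}.Finite)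
    (c : I → ZMod 2)
    (hc : ∀ i j, Relation.EqvGen (fun i j : I => (Vij i j).Nonempty) i j → c i = c j) :
    ∑ᶠ v, ∑ i, c i * a v i = ∑ᶠ v, ∑ i, c i * b v i := by
  refine finsum_congr fun v => ?_
  have h := hC_equiv v (a v) (ha_mem v) (b v) (hb_mem v)
  generalize a v = x, b v = y at h ⊢
  induction h with
  | rel x y hxy =>
    obtain ⟨i, j, hv, rfl⟩ := hxy
    exact (sum_mul_add_deltaFn_add_deltaFn c x (hc i j (.rel _ _ ⟨v, hv⟩))).symm
  | refl => rfl
  | symm _ _ _ ih => exact ih.symm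
  | trans _ _ _ _ _ ih₁ ih₂ => exact ih₁.trans ih₂
end

section
/- Let f₁, …, f_r ∈ ℤ[X] be pairwise distinct monic irreducible polynomials, each symmetric of even degree, let n₁, …, n_r ≥ 1 be integers, set f = ∏ f_i^{n_i} and g = ∏ f_i, and write deg f = 2n. Assume that |f(1)|, |f(−1)| and (−1)ⁿ·f(1)·f(−1) are all squares of integers. Then for every prime number p there exist matrices B, T ∈ M_{2n}(ℤ_p) over the p-adic integers ℤ_p such that: B is symmetric, every diagonal entry of B is divisible by 2, det B is a unit of ℤ_p, Tᵀ·B·T = B, the characteristic polynomial of T is the image of f in ℤ_p[X], and g(T) = 0 (g evaluated at T in the matrix algebra vanishes). -/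
open Polynomial Matrix

theorem charpoly_leftMulMatrix_root {S : ℤ[X]} (hS : S.Monic) :
    (Algebra.leftMulMatrix (AdjoinRoot.powerBasis' hS).basis (AdjoinRoot.root S)).charpoly
      = S := by
  have hgen : (AdjoinRoot.powerBasis' hS).gen = AdjoinRoot.root S := rfl
  rw [← hgen, charpoly_leftMulMatrix, hgen]
  have hroot : aeval (AdjoinRoot.root S) S = 0 := by simp
  refine (minpoly.unique' ℤ _ hS hroot fun q hq => or_iff_not_imp_left.mpr fun hq0 hq' => ?_).symm
  rw [AdjoinRoot.aeval_eq, AdjoinRoot.mk_eq_zero] at hq'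
  exact hq0 (Polynomial.eq_zero_of_dvd_of_degree_lt hq' hq)

theorem exists_functional_dual {S : ℤ[X]} (hS : S.Monic) (hpos : 0 < S.natDegree) :
    ∃ c : AdjoinRoot S →ₗ[ℤ] ℤ,
      (∀ q : ℤ[X], q.natDegree < S.natDegree →
        c (AdjoinRoot.mk S q) = q.coeff (S.natDegree - 1)) ∧
      ∀ φ : AdjoinRoot S →ₗ[ℤ] ℤ, ∃ u, ∀ r, φ r = c (r * u) := by
  let c : AdjoinRoot S →ₗ[ℤ] ℤ :=
    (lcoeff ℤ (S.natDegree - 1)) ∘ₗ (AdjoinRoot.modByMonicHom hS)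
  have hc : ∀ q : ℤ[X], q.natDegree < S.natDegree →
      c (AdjoinRoot.mk S q) = q.coeff (S.natDegree - 1) := by
    intro q hq
    change (AdjoinRoot.modByMonicHom hS (AdjoinRoot.mk S q)).coeff _ = _
    rw [AdjoinRoot.modByMonicHom_mk, (modByMonic_eq_self_iff hS).mpr (degree_lt_degree hq)]
  refine ⟨c, hc, fun φ => ?_⟩
  have hcpow : ∀ k < S.natDegree,
      c (AdjoinRoot.root S ^ k) = if k = S.natDegree - 1 then 1 else 0 := by
    intro k hk
    rw [← AdjoinRoot.mk_X, ← map_pow, hc _ (by rwa [natDegree_X_pow]), coeff_X_pow]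
    simp only [eq_comm]
  let G : Matrix (Fin S.natDegree) (Fin S.natDegree) ℤ := Matrix.of fun i j =>
    c (AdjoinRoot.root S ^ (i : ℕ) * AdjoinRoot.root S ^ (S.natDegree - 1 - (j : ℕ)))
  have hG : G.det = 1 := by
    rw [Matrix.det_of_isLowerTriangular]
    · refine Finset.prod_eq_one fun i _ => ?_
      have hi := i.isLt
      simp only [G, Matrix.of_apply]
      rw [← pow_add, hcpow _ (by omega), if_pos (by omega)]
    · intro i j hij
      have hij' : (i : ℕ) < j := hij
      have hj := j.isLt
      simp only [G, Matrix.of_apply]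
      rw [← pow_add, hcpow _ (by omega), if_neg (by omega)]
  have hGG : G * G⁻¹ = 1 := Matrix.mul_nonsing_inv _ (by rw [hG]; exact isUnit_one)
  let b := (AdjoinRoot.powerBasis' hS).basis
  let w : Fin S.natDegree → ℤ := fun i => φ (AdjoinRoot.root S ^ (i : ℕ))
  let v := G⁻¹ *ᵥ w
  have hv : G *ᵥ v = w := by
    rw [Matrix.mulVec_mulVec, hGG, Matrix.one_mulVec]
  refine ⟨∑ j, v j • AdjoinRoot.root S ^ (S.natDegree - 1 - (j : ℕ)), fun r => ?_⟩
  have hlin : φ = c ∘ₗ LinearMap.mulRight ℤ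
      (∑ j, v j • AdjoinRoot.root S ^ (S.natDegree - 1 - (j : ℕ))) := by
    refine b.ext fun i => ?_
    have hbi : b i = AdjoinRoot.root S ^ (i : ℕ) := (AdjoinRoot.powerBasis' hS).basis_eq_pow i
    rw [hbi, LinearMap.comp_apply, LinearMap.mulRight_apply, Finset.mul_sum, map_sum]
    have : ∑ j, G i j * v j = w i := congrFun hv i
    simp only [mul_smul_comm, map_smul, smul_eq_mul]
    change w i = _
    rw [← this]
    exact Finset.sum_congr rfl fun j _ => mul_comm _ _
  exact LinearMap.congr_fun hlin r

/-- The involution of `ℤ[X]/(S)` inverting the root of a palindromic `S`, and a functional which is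
anti-invariant under it and generates the dual module. -/
theorem exists_involution_functional {S : ℤ[X]} (hS : S.Monic) (hrev : S.reverse = S) {n : ℕ}
    (hn : 0 < n) (hdeg : S.natDegree = 2 * n) :
    ∃ (σ : AdjoinRoot S →+* AdjoinRoot S) (ω : AdjoinRoot S →ₗ[ℤ] ℤ),
      (∀ r, σ (σ r) = r) ∧ AdjoinRoot.root S * σ (AdjoinRoot.root S) = 1 ∧
      (∀ r, ω (σ r) = -ω r) ∧ ∀ φ : AdjoinRoot S →ₗ[ℤ] ℤ, ∃ u, ∀ r, φ r = ω (r * u) := by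
  obtain ⟨c, hc, hperf⟩ := exists_functional_dual hS (by omega)
  set x := AdjoinRoot.root S with hxdef
  set y := AdjoinRoot.mk S (-S.divX) with hydef
  have h0 : S.coeff 0 = 1 := by
    rw [← hrev, coeff_zero_reverse, hS.leadingCoeff]
  have hxy : x * y = 1 := by
    have h1 := congrArg (AdjoinRoot.mk S) (divX_mul_X_add S)
    rw [AdjoinRoot.mk_self, map_add, map_mul, AdjoinRoot.mk_X, h0] at h1
    simp only [map_one] at h1
    rw [hydef, map_neg]
    linear_combination -h1
  let _ : Invertible x := ⟨y, by rw [mul_comm, hxy], hxy⟩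
  have hroot : S.eval₂ (algebraMap ℤ (AdjoinRoot S)) y = 0 := by
    have h1 := eval₂_reverse_mul_pow (algebraMap ℤ (AdjoinRoot S)) x S
    have h2 : S.eval₂ (algebraMap ℤ (AdjoinRoot S)) x = 0 := AdjoinRoot.eval₂_root S
    rw [hrev, h2] at h1
    have h3 : (⅟x : AdjoinRoot S) = y := rfl
    rw [h3] at h1
    have h4 := congrArg (· * y ^ S.natDegree) h1
    simpa only [mul_assoc, ← mul_pow, hxy, one_pow, mul_one, zero_mul] using h4
  let σ : AdjoinRoot S →+* AdjoinRoot S := AdjoinRoot.lift (algebraMap ℤ (AdjoinRoot S)) y hroot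
  have hσx : σ x = y := AdjoinRoot.lift_root hroot
  have hσy : σ y = x := by
    have h1 : y * σ y = 1 := by rw [← hσx, ← map_mul, hσx, hxy, map_one]
    calc σ y = (x * y) * σ y := by rw [hxy, one_mul]
      _ = x * (y * σ y) := by ring
      _ = x := by rw [h1, mul_one]
  have hσσ : ∀ r, σ (σ r) = r := by
    intro r
    have : σ.comp σ = RingHom.id _ := by
      refine Ideal.Quotient.ringHom_ext (Polynomial.ringHom_ext' (RingHom.ext_int _ _) ?_)
      change σ (σ x) = x
      rw [hσx, hσy]
    exact RingHom.congr_fun this r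
  have hcpow : ∀ k < 2 * n - 1, c (x ^ k) = 0 := by
    intro k hk
    rw [hxdef, ← AdjoinRoot.mk_X, ← map_pow, hc _ (by rw [natDegree_X_pow]; omega), coeff_X_pow,
      if_neg (by omega)]
  have hctop : c (x ^ (2 * n - 1)) = 1 := by
    rw [hxdef, ← AdjoinRoot.mk_X, ← map_pow, hc _ (by rw [natDegree_X_pow]; omega), coeff_X_pow,
      if_pos (by omega)]
  have hcy : c y = -1 := by
    rw [hydef, hc _ (by rw [natDegree_neg, natDegree_divX_eq_natDegree_tsub_one]; omega),
      coeff_neg, coeff_divX, Nat.sub_add_cancel (by omega), hS.coeff_natDegree]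
  have hpow : ∀ k, x ^ k * y ^ k = 1 := fun k => by rw [← mul_pow, hxy, one_pow]
  refine ⟨σ, c ∘ₗ LinearMap.mulLeft ℤ (x ^ (n - 1)), hσσ, by rw [hσx, hxy], ?_, ?_⟩
  · let b := (AdjoinRoot.powerBasis' hS).basis
    have hlin : c ∘ₗ LinearMap.mulLeft ℤ (x ^ (n - 1)) ∘ₗ σ.toAddMonoidHom.toIntLinearMap ∘ₗ
        LinearMap.mulLeft ℤ (y ^ (n - 1)) = -c := by
      refine b.ext fun i => ?_
      have hbi : b i = x ^ (i : ℕ) := (AdjoinRoot.powerBasis' hS).basis_eq_pow i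
      have hi : (i : ℕ) < 2 * n := hdeg ▸ i.isLt
      rw [hbi, LinearMap.neg_apply]
      change c (x ^ (n - 1) * σ (y ^ (n - 1) * x ^ (i : ℕ))) = _
      rw [map_mul σ, map_pow σ, map_pow σ, hσx, hσy, ← mul_assoc, ← pow_add]
      rcases Nat.lt_or_ge (i : ℕ) (2 * n - 1) with hlt | hge
      · have h1 : x ^ (n - 1 + (n - 1)) * y ^ (i : ℕ) = x ^ (2 * n - 2 - i) := by
          rw [show n - 1 + (n - 1) = (2 * n - 2 - i) + i by omega, pow_add, mul_assoc, hpow,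
            mul_one]
        rw [h1, hcpow _ (by omega), hcpow _ hlt, neg_zero]
      · have h1 : (i : ℕ) = 2 * n - 1 := by omega
        have h2 : x ^ (n - 1 + (n - 1)) * y ^ (i : ℕ) = y := by
          rw [show n - 1 + (n - 1) = 2 * n - 2 by omega,
            show (i : ℕ) = (2 * n - 2) + 1 by omega, pow_succ, ← mul_assoc, hpow, one_mul]
        rw [h2, hcy, h1, hctop]
    intro r
    have h1 := LinearMap.congr_fun hlin (x ^ (n - 1) * r)
    change c (x ^ (n - 1) * σ (y ^ (n - 1) * (x ^ (n - 1) * r))) = -c (x ^ (n - 1) * r) at h1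
    rwa [← mul_assoc (y ^ (n - 1)), mul_comm (y ^ (n - 1)), hpow, one_mul] at h1
  · intro φ
    obtain ⟨u, hu⟩ := hperf φ
    refine ⟨y ^ (n - 1) * u, fun r => ?_⟩
    rw [hu, LinearMap.comp_apply, LinearMap.mulLeft_apply]
    congr 1
    linear_combination -(r * u) * hpow (n - 1)

theorem X_sq_sub_one_dvd {G : ℤ[X]} (h₁ : G.eval 1 = 0) (h₂ : G.eval (-1) = 0) :
    X ^ 2 - 1 ∣ G := by
  obtain ⟨G₁, rfl⟩ : X - C 1 ∣ G := dvd_iff_isRoot.mpr h₁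
  have h₃ : G₁.eval (-1) = 0 := by
    simp only [eval_mul, eval_sub, eval_X, eval_C] at h₂
    omega
  obtain ⟨G₂, rfl⟩ : X - C (-1) ∣ G₁ := dvd_iff_isRoot.mpr h₃
  refine ⟨G₂, ?_⟩
  simp only [map_neg, map_one]
  ring

theorem X_sq_sub_one_monic : (X ^ 2 - 1 : ℤ[X]).Monic := monic_X_pow_sub_C (1 : ℤ) two_ne_zero

/-- A palindromic polynomial vanishing at `1` and `-1` vanishes there to second order. -/
theorem X_sq_sub_one_sq_dvd {G : ℤ[X]} {n : ℕ} (hn : 0 < n) (hdeg : G.natDegree ≤ 2 * n)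
    (hrefl : G.reflect (2 * n) = G) (h₁ : G.eval 1 = 0) (h₂ : G.eval (-1) = 0) :
    (X ^ 2 - 1) ^ 2 ∣ G := by
  obtain ⟨W, rfl⟩ := X_sq_sub_one_dvd h₁ h₂
  rw [pow_two (X ^ 2 - 1 : ℤ[X])]
  refine mul_dvd_mul_left _ ?_
  have hD : (X ^ 2 - 1 : ℤ[X]).natDegree = 2 := natDegree_X_pow_sub_C (r := (1 : ℤ))
  rcases eq_or_ne W 0 with rfl | hW
  · simp
  have hWdeg : W.natDegree ≤ 2 * n - 2 := by
    rw [X_sq_sub_one_monic.natDegree_mul' hW, hD] at hdeg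
    omega
  have hrD : (X ^ 2 - 1 : ℤ[X]).reflect 2 = -(X ^ 2 - 1) := by
    have h3 : (X ^ 2 - 1 : ℤ[X]) = X ^ 2 + C (-1) := by simp [sub_eq_add_neg]
    rw [h3, reflect_add, reflect_C, ← one_mul (X ^ 2 : ℤ[X]), ← C_1, reflect_C_mul_X_pow]
    simp [revAt_le]
  have hrW : W.reflect (2 * n - 2) = -W := by
    have h3 := reflect_mul (X ^ 2 - 1 : ℤ[X]) W hD.le hWdeg
    rw [show 2 + (2 * n - 2) = 2 * n by omega, hrefl, hrD] at h3
    refine mul_left_cancel₀ X_sq_sub_one_monic.ne_zero ?_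
    linear_combination h3
  refine X_sq_sub_one_dvd ?_ ?_
  · let _ : Invertible (1 : ℤ) := invertibleOne
    have h3 := eval₂_reflect_mul_pow (RingHom.id ℤ) 1 (2 * n - 2) W hWdeg
    rw [hrW] at h3
    simp only [invOf_one, one_pow, mul_one, eval₂_id, eval_neg] at h3
    omega
  · let _ : Invertible (-1 : ℤ) := ⟨-1, by norm_num, by norm_num⟩
    have h3 := eval₂_reflect_mul_pow (RingHom.id ℤ) (-1) (2 * n - 2) W hWdeg
    have h4 : ⅟(-1 : ℤ) = -1 := rfl
    rw [hrW, h4, (show Even (2 * n - 2) by grind).neg_one_pow] at h3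
    simp only [mul_one, eval₂_id, eval_neg] at h3
    omega

theorem palindromic_decomposition {S : ℤ[X]} (hrev : S.reverse = S) {n : ℕ} (hn : 0 < n)
    (hdeg : S.natDegree = 2 * n) {ε a b : ℤ} (h₁ : S.eval 1 = ε * (a + b) ^ 2)
    (h₂ : (-1) ^ n * S.eval (-1) = ε * (a - b) ^ 2) :
    ∃ V, S = C ε * (X ^ (n - 1) * ((C b + C a * X) * (C a + C b * X))) + (X ^ 2 - 1) ^ 2 * V := by
  obtain ⟨m, rfl⟩ : ∃ m, n = m + 1 := ⟨n - 1, by omega⟩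
  rw [Nat.add_sub_cancel]
  set q : ℤ[X] := X ^ m * ((C b + C a * X) * (C a + C b * X)) with hq
  have hl : ∀ u v : ℤ, (C u + C v * X).natDegree ≤ 1 := fun u v => by
    rw [add_comm]; exact natDegree_linear_le
  have hl' : ∀ u v : ℤ, (C u + C v * X).reflect 1 = C v + C u * X := fun u v => by
    rw [reflect_add, reflect_C]
    have h3 := reflect_C_mul_X_pow 1 1 (c := v)
    rw [pow_one, revAt_le le_rfl, Nat.sub_self, pow_zero, mul_one] at h3
    rw [h3, pow_one, add_comm]
  have hl2 : ((C b + C a * X) * (C a + C b * X)).natDegree ≤ 1 + 1 :=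
    natDegree_mul_le_of_le (hl _ _) (hl _ _)
  have hqdeg : q.natDegree ≤ 2 * m + 2 := by
    refine (natDegree_mul_le_of_le (natDegree_X_pow_le m) hl2).trans (by omega)
  have hqr : q.reflect (2 * (m + 1)) = q := by
    have hX : (X ^ m : ℤ[X]).reflect (2 * m) = X ^ m := by
      have h3 := reflect_C_mul_X_pow (2 * m) m (c := (1 : ℤ))
      rwa [C_1, one_mul, one_mul, revAt_le (by omega), show 2 * m - m = m by omega] at h3
    rw [show 2 * (m + 1) = 2 * m + (1 + 1) by ring, hq,
      reflect_mul _ _ ((natDegree_X_pow_le m).trans (by omega)) hl2, hX,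
      reflect_mul _ _ (hl _ _) (hl _ _), hl', hl', mul_comm (C a + C b * X)]
  have hG : (S + C (-ε) * q).reflect (2 * (m + 1)) = S + C (-ε) * q := by
    rw [reflect_add, reflect_C_mul, hqr, ← hdeg]
    congr 1
  obtain ⟨V, hV⟩ := X_sq_sub_one_sq_dvd (n := m + 1) (by omega)
    ((natDegree_add_le_of_degree_le hdeg.le ((natDegree_C_mul_le _ _).trans hqdeg))) hG
    (by simp [hq, h₁]; ring)
    (by
      have h3 : S.eval (-1) = (-1) ^ (m + 1) * (ε * (a - b) ^ 2) := by
        rw [← h₂, ← mul_assoc, ← mul_pow]; simp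
      simp [hq, h3]; ring)
  refine ⟨V, ?_⟩
  rw [← hV, map_neg]
  ring

theorem charpoly_eq_of_intertwining {ι : Type*} [Fintype ι] [DecidableEq ι]
    {P T U : Matrix ι ι ℤ} (hP : P.det ≠ 0) (h : P * T = U * P) :
    T.charpoly = U.charpoly := by
  have hC : (P.map C) * T.charmatrix = U.charmatrix * (P.map C) := by
    have h' : (P.map C) * (T.map C) = (U.map C) * (P.map C) := by
      rw [← Matrix.map_mul, ← Matrix.map_mul, h]
    simp only [Matrix.charmatrix, RingHom.mapMatrix_apply, mul_sub, sub_mul, h']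
    rw [(Matrix.scalar_commute (X : ℤ[X]) (fun r => Commute.all _ _) (P.map C)).eq]
  have hdet := congrArg Matrix.det hC
  rw [Matrix.det_mul, Matrix.det_mul, mul_comm] at hdet
  refine mul_right_cancel₀ ?_ hdet
  have : (P.map C).det = C P.det := by
    rw [RingHom.map_det, RingHom.mapMatrix_apply]
  rw [this]
  simpa using hP

theorem isUnit_det_toMatrix₂_of_surjective {ι N : Type*} [Fintype ι] [DecidableEq ι]
    [AddCommGroup N] (b : Module.Basis ι ℤ N) (β : N →ₗ[ℤ] N →ₗ[ℤ] ℤ)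
    (hβ : ∀ φ : N →ₗ[ℤ] ℤ, ∃ y, ∀ x, β x y = φ x) :
    IsUnit (LinearMap.toMatrix₂ b b β).det := by
  choose y hy using fun j => hβ (b.coord j)
  have hmul : LinearMap.toMatrix₂ b b β * Matrix.of (fun k j => b.repr (y j) k) = 1 := by
    ext i j
    rw [Matrix.mul_apply]
    have := hy j (b i)
    rw [← b.sum_repr (y j)] at this
    simp only [map_sum, map_smul, smul_eq_mul, Module.Basis.coord_apply, Module.Basis.repr_self] at this
    simp only [LinearMap.toMatrix₂_apply, Matrix.of_apply, Matrix.one_apply]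
    simp_rw [mul_comm (β _ _)]
    rw [this, Finsupp.single_apply]
  exact (Matrix.isUnit_iff_isUnit_det _).mp (IsUnit.of_mul_eq_one _ hmul)

theorem exists_even_unimodular_of_ideal {R ι : Type*} [CommRing R] [Fintype ι] [DecidableEq ι]
    (b : Module.Basis ι ℤ R) (σ : R →+* R) (ω : R →ₗ[ℤ] ℤ) (x δ h Z : R)
    (hσ : ∀ r, σ (σ r) = r) (hx : x * σ x = 1) (hω : ∀ r, ω (σ r) = -ω r)
    (hperf : ∀ φ : R →ₗ[ℤ] ℤ, ∃ u, ∀ r, φ r = ω (r * u))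
    (hδ : δ = x - σ x) (hreg : ∀ r, δ * r = 0 → r = 0) (hZ : h * σ h = δ ^ 2 * Z)
    (hcolon : ∀ u v, h * u = δ * v → ∃ r s, u = δ * r + σ h * s) :
    ∃ B T : Matrix ι ι ℤ, B.IsSymm ∧ (∀ i, 2 ∣ B i i) ∧ IsUnit B.det ∧ Tᵀ * B * T = B ∧
      T.charpoly = (Algebra.leftMulMatrix b x).charpoly := by
  have hcancel : ∀ r s, δ * r = δ * s → r = s := fun r s hrs =>
    sub_eq_zero.mp (hreg _ (by rw [mul_sub, hrs, sub_self]))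
  have hnondeg : ∀ w, (∀ r, ω (r * w) = 0) → w = 0 := by
    intro w hw
    refine b.ext_elem fun i => ?_
    obtain ⟨u, hu⟩ := hperf (b.coord i)
    have := hu w
    rw [mul_comm, hw] at this
    simpa using this
  have hσδ : σ δ = -δ := by rw [hδ, map_sub, hσ]; ring
  have hσZ : σ Z = Z := by
    have h1 := congrArg σ hZ
    simp only [map_mul, map_pow, hσ, hσδ] at h1
    refine hcancel _ _ (hcancel _ _ ?_)
    linear_combination hZ - h1
  have hωeven : ∀ c, σ c = c → ∃ m, ω (δ * c) = 2 * m := by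
    intro c hc
    refine ⟨ω (x * c), ?_⟩
    have h1 := hω (x * c)
    rw [map_mul, hc] at h1
    rw [hδ, sub_mul, map_sub, h1]
    ring
  let N : Submodule ℤ R := (Ideal.span {δ, h}).restrictScalars ℤ
  have hmem : ∀ z : R, z ∈ N ↔ ∃ r s, z = r * δ + s * h := by
    intro z
    simp only [N, Submodule.restrictScalars_mem, Ideal.mem_span_pair, eq_comm]
  have hdiv : ∀ y z : N, ∃ c, (y : R) * σ z = δ * c := by
    rintro ⟨y, hy⟩ ⟨z, hz⟩
    obtain ⟨r, s, rfl⟩ := (hmem y).mp hy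
    obtain ⟨r', s', rfl⟩ := (hmem z).mp hz
    refine ⟨-r * σ r' * δ + r * σ s' * σ h - s * σ r' * h + s * σ s' * δ * Z, ?_⟩
    simp only [map_add, map_mul, hσδ]
    linear_combination s * σ s' * hZ
  choose c hc using hdiv
  let β : N →ₗ[ℤ] N →ₗ[ℤ] ℤ := LinearMap.mk₂ ℤ (fun y z => ω (c y z))
    (fun y y' z => by
      rw [← map_add]
      congr 1
      refine hcancel _ _ ?_
      rw [mul_add, ← hc, ← hc, ← hc, Submodule.coe_add, add_mul])
    (fun a y z => by
      rw [← map_smul]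
      congr 1
      refine hcancel _ _ ?_
      rw [mul_smul_comm, ← hc, ← hc, Submodule.coe_smul, smul_mul_assoc])
    (fun y z z' => by
      rw [← map_add]
      congr 1
      refine hcancel _ _ ?_
      rw [mul_add, ← hc, ← hc, ← hc, Submodule.coe_add, map_add, mul_add])
    (fun a y z => by
      rw [← map_smul]
      congr 1
      refine hcancel _ _ ?_
      rw [mul_smul_comm, ← hc, ← hc, Submodule.coe_smul, map_zsmul, mul_smul_comm])
  have hβ : ∀ y z, β y z = ω (c y z) := fun y z => rfl
  have hβeq : ∀ (y z : N) (d : R), (y : R) * σ z = δ * d → β y z = ω d := by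
    intro y z d hd
    rw [hβ]
    congr 1
    exact hcancel _ _ (by rw [← hc, hd])
  have hsymm : ∀ y z, β y z = β z y := by
    intro y z
    have h1 : c z y = -σ (c y z) := by
      refine hcancel _ _ ?_
      have h2 := congrArg σ (hc y z)
      simp only [map_mul, hσ, hσδ] at h2
      rw [← hc]
      linear_combination h2
    rw [hβ, hβ, h1, map_neg, hω, neg_neg]
  have heven : ∀ y, 2 ∣ β y y := by
    rintro ⟨y, hy⟩
    obtain ⟨r, s, rfl⟩ := (hmem y).mp hy
    obtain ⟨m, hm⟩ := hωeven (s * σ s * Z - r * σ r) (by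
      simp only [map_sub, map_mul, hσ, hσZ]; ring)
    refine ⟨m + ω (r * σ s * σ h), ?_⟩
    rw [hβeq _ _ (δ * (s * σ s * Z - r * σ r) + (r * σ s * σ h - σ (r * σ s * σ h))) ?_]
    · rw [map_add, hm, map_sub, hω]; ring
    · simp only [map_add, map_mul, hσδ, hσ]
      linear_combination s * σ s * hZ
  have hsurj : ∀ φ : N →ₗ[ℤ] ℤ, ∃ y, ∀ z, β z y = φ z := by
    intro φ
    have hmemδ : ∀ r, r * δ ∈ N := fun r => (hmem _).mpr ⟨r, 0, by ring⟩
    have hmemh : ∀ r, r * h ∈ N := fun r => (hmem _).mpr ⟨0, r, by ring⟩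
    obtain ⟨u, hu⟩ := hperf (φ ∘ₗ ((LinearMap.mulRight ℤ δ).codRestrict N hmemδ))
    obtain ⟨v, hv⟩ := hperf (φ ∘ₗ ((LinearMap.mulRight ℤ h).codRestrict N hmemh))
    have hu' : ∀ r, φ ⟨r * δ, hmemδ r⟩ = ω (r * u) := hu
    have hv' : ∀ r, φ ⟨r * h, hmemh r⟩ = ω (r * v) := hv
    have huv : h * u = δ * v := by
      refine sub_eq_zero.mp (hnondeg _ fun r => ?_)
      have h1 := hu' (r * h)
      have h2 := hv' (r * δ)
      have h3 : (⟨r * h * δ, hmemδ (r * h)⟩ : N) = ⟨r * δ * h, hmemh (r * δ)⟩ :=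
        Subtype.ext (by ring)
      rw [h3, h2] at h1
      rw [mul_sub, map_sub, ← mul_assoc, ← mul_assoc, h1, sub_self]
    obtain ⟨r₀, s₀, hrs⟩ := hcolon u v huv
    have hσu : σ u ∈ N := (hmem _).mpr ⟨-σ r₀, σ s₀, by
      rw [hrs]; simp only [map_add, map_mul, hσδ, hσ]; ring⟩
    refine ⟨⟨σ u, hσu⟩, ?_⟩
    rintro ⟨z, hz⟩
    obtain ⟨r, s, rfl⟩ := (hmem z).mp hz
    rw [hβeq _ _ (r * u + s * v) (by simp only [hσ]; linear_combination s * huv), map_add,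
      ← hu', ← hv', ← map_add]
    rfl
  have hxN : ∀ z ∈ N, LinearMap.mulLeft ℤ x z ∈ N := fun z hz =>
    Ideal.mul_mem_left (Ideal.span {δ, h}) x hz
  let t : N →ₗ[ℤ] N := (LinearMap.mulLeft ℤ x).restrict hxN
  have hiso : β.compl₁₂ t t = β := by
    refine LinearMap.ext₂ fun y z => ?_
    rw [LinearMap.compl₁₂_apply]
    refine hβeq _ _ _ ?_
    rw [← hc]
    change x * (y : R) * σ (x * z) = _
    rw [map_mul]
    linear_combination (y : R) * σ z * hx
  have : Module.Free ℤ R := .of_basis b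
  have : Module.Finite ℤ R := .of_basis b
  obtain ⟨m, ⟨e₀⟩⟩ := Submodule.nonempty_basis_of_pid b N
  have : Module.Free ℤ N := .of_basis e₀
  have : Module.Finite ℤ N := .of_basis e₀
  have hcard : Fintype.card (Fin m) = Fintype.card ι := by
    rw [← Module.finrank_eq_card_basis e₀, ← Module.finrank_eq_card_basis b]
    refine le_antisymm (LinearMap.finrank_le_finrank_of_injective N.subtype_injective) ?_
    refine LinearMap.finrank_le_finrank_of_injective (f := (LinearMap.mulLeft ℤ δ).codRestrict N
      fun r => (hmem _).mpr ⟨r, 0, by simp [mul_comm]⟩) ?_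
    intro r s hrs
    exact hcancel r s (congrArg Subtype.val hrs)
  let e : Module.Basis ι ℤ N := e₀.reindex (Fintype.equivOfCardEq hcard)
  refine ⟨LinearMap.toMatrix₂ e e β, LinearMap.toMatrix e e t, ?_, ?_,
    isUnit_det_toMatrix₂_of_surjective e β hsurj, ?_, ?_⟩
  · ext i j
    simp only [Matrix.transpose_apply, LinearMap.toMatrix₂_apply]
    exact hsymm _ _
  · intro i
    rw [LinearMap.toMatrix₂_apply]
    exact heven _
  · rw [← LinearMap.toMatrix₂_compl₁₂, hiso]
  · refine charpoly_eq_of_intertwining (P := LinearMap.toMatrix e b N.subtype) ?_ ?_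
    · intro h0
      obtain ⟨v, hv, hv0⟩ := Matrix.exists_mulVec_eq_zero_iff.mpr h0
      refine hv ?_
      have h1 := LinearMap.toMatrix_mulVec_repr e b N.subtype (e.equivFun.symm v)
      have h2 : ⇑(e.repr (e.equivFun.symm v)) = v := by
        rw [← Module.Basis.equivFun_apply, LinearEquiv.apply_symm_apply]
      rw [h2, hv0] at h1
      have h3 : N.subtype (e.equivFun.symm v) = 0 :=
        b.ext_elem fun i => by rw [← h1]; simp
      have h4 : e.equivFun.symm v = 0 := N.subtype_injective (by rw [h3, map_zero])
      exact (LinearEquiv.map_eq_zero_iff _).mp h4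
    · rw [← LinearMap.toMatrix_comp, Algebra.leftMulMatrix_apply, ← LinearMap.toMatrix_comp]
      rfl

/-- There is an even unimodular `ℤ`-lattice with an isometry annihilated by `g` whose characteristic
polynomial is `S`. -/
def HasEvenUnimodularIsometry (S g : ℤ[X]) : Prop :=
  ∃ (ι : Type) (_ : Fintype ι) (_ : DecidableEq ι) (B T : Matrix ι ι ℤ),
    B.IsSymm ∧ (∀ i, 2 ∣ B i i) ∧ IsUnit B.det ∧ Tᵀ * B * T = B ∧ T.charpoly = S ∧ aeval T g = 0

theorem aeval_fromBlocks_diagonal {ι κ : Type*} [Fintype ι] [DecidableEq ι] [Fintype κ]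
    [DecidableEq κ] (A : Matrix ι ι ℤ) (D : Matrix κ κ ℤ) (g : ℤ[X]) :
    aeval (fromBlocks A 0 0 D) g = fromBlocks (aeval A g) 0 0 (aeval D g) := by
  induction g using Polynomial.induction_on with
  | C a =>
    simp only [aeval_C, Matrix.algebraMap_eq_diagonal, fromBlocks_diagonal]
    congr 1
    ext (i | i) <;> simp
  | add p q hp hq => simp [hp, hq, fromBlocks_add]
  | monomial n a h =>
    rw [pow_succ, ← mul_assoc, map_mul, h, aeval_X, fromBlocks_multiply,
      map_mul (aeval A) _ X, map_mul (aeval D) _ X, aeval_X, aeval_X]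
    simp

namespace HasEvenUnimodularIsometry

theorem one (g : ℤ[X]) : HasEvenUnimodularIsometry 1 g :=
  ⟨Empty, inferInstance, inferInstance, 0, 0, by ext i; exact i.elim, fun i => i.elim, by simp,
    by ext i; exact i.elim, by simp [Matrix.charpoly], by ext i; exact i.elim⟩

theorem mul {S₁ S₂ g : ℤ[X]} (h₁ : HasEvenUnimodularIsometry S₁ g)
    (h₂ : HasEvenUnimodularIsometry S₂ g) : HasEvenUnimodularIsometry (S₁ * S₂) g := by
  obtain ⟨ι, _, _, B, T, hB, hBe, hBu, hT, hTc, hTg⟩ := h₁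
  obtain ⟨κ, _, _, B', T', hB', hBe', hBu', hT', hTc', hTg'⟩ := h₂
  refine ⟨ι ⊕ κ, inferInstance, inferInstance, fromBlocks B 0 0 B', fromBlocks T 0 0 T',
    ?_, ?_, ?_, ?_, ?_, ?_⟩
  · rw [Matrix.IsSymm, fromBlocks_transpose, hB, hB', transpose_zero, transpose_zero]
  · rintro (i | i)
    · exact hBe i
    · exact hBe' i
  · rw [det_fromBlocks_zero₁₂]
    exact hBu.mul hBu'
  · simp [fromBlocks_transpose, fromBlocks_multiply, hT, hT']
  · rw [charpoly_fromBlocks_zero₁₂, hTc, hTc']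
  · rw [aeval_fromBlocks_diagonal, hTg, hTg', fromBlocks_zero]

theorem pow {S g : ℤ[X]} (h : HasEvenUnimodularIsometry S g) (k : ℕ) :
    HasEvenUnimodularIsometry (S ^ k) g := by
  induction k with
  | zero => simpa using one g
  | succ k ih => rw [pow_succ]; exact ih.mul h

theorem prod {κ : Type*} (s : Finset κ) {S : κ → ℤ[X]} {g : ℤ[X]}
    (h : ∀ i, HasEvenUnimodularIsometry (S i) g) :
    HasEvenUnimodularIsometry (∏ i ∈ s, S i) g := by
  classical
  induction s using Finset.induction_on with
  | empty => simpa using one g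
  | insert i s hi ih => rw [Finset.prod_insert hi]; exact (h i).mul ih

theorem of_dvd {S g g' : ℤ[X]} (h : HasEvenUnimodularIsometry S g) (hg : g ∣ g') :
    HasEvenUnimodularIsometry S g' := by
  obtain ⟨ι, _, _, B, T, hB, hBe, hBu, hT, hTc, hTg⟩ := h
  obtain ⟨q, rfl⟩ := hg
  exact ⟨ι, _, _, B, T, hB, hBe, hBu, hT, hTc, by rw [map_mul, hTg, zero_mul]⟩

/-- The hyperbolic construction: the square of a palindromic polynomial. -/
theorem sq {S : ℤ[X]} (hS : S.Monic) (hrev : S.reverse = S) {n : ℕ} (hn : 0 < n)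
    (hdeg : S.natDegree = 2 * n) : HasEvenUnimodularIsometry (S ^ 2) S := by
  obtain ⟨σ, ω, hσ, hx, -, hperf⟩ := exists_involution_functional hS hrev hn hdeg
  set x := AdjoinRoot.root S
  let b := (AdjoinRoot.powerBasis' hS).basis
  let β : AdjoinRoot S →ₗ[ℤ] AdjoinRoot S →ₗ[ℤ] ℤ :=
    ((LinearMap.mul ℤ (AdjoinRoot S)).compr₂ ω).compl₂ σ.toAddMonoidHom.toIntLinearMap
  have hβ : ∀ y z, β y z = ω (y * σ z) := fun y z => rfl
  set M := LinearMap.toMatrix₂ b b β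
  set A := Algebra.leftMulMatrix b x
  have hM : IsUnit M.det := isUnit_det_toMatrix₂_of_surjective b β fun φ => by
    obtain ⟨u, hu⟩ := hperf φ
    exact ⟨σ u, fun y => by rw [hβ, hσ, hu]⟩
  have hAM : Aᵀ * M * A = M := by
    have hiso : β.compl₁₂ (LinearMap.mulLeft ℤ x) (LinearMap.mulLeft ℤ x) = β := by
      refine LinearMap.ext₂ fun y z => ?_
      rw [LinearMap.compl₁₂_apply, hβ, hβ, LinearMap.mulLeft_apply, LinearMap.mulLeft_apply,
        map_mul σ]
      congr 1
      linear_combination y * σ z * hx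
    have h1 := LinearMap.toMatrix₂_compl₁₂ b b b b β (LinearMap.mulLeft ℤ x)
      (LinearMap.mulLeft ℤ x)
    rw [hiso] at h1
    exact h1.symm
  have hA : A.charpoly = S := charpoly_leftMulMatrix_root hS
  have hAS : aeval A S = 0 := by
    have h1 := aeval_self_charpoly A
    rwa [hA] at h1
  refine ⟨_ ⊕ _, inferInstance, inferInstance, fromBlocks 0 M Mᵀ 0, fromBlocks A 0 0 A,
    ?_, ?_, ?_, ?_, ?_, ?_⟩
  · rw [Matrix.IsSymm, fromBlocks_transpose, transpose_zero, transpose_transpose]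
  · rintro (i | i) <;> simp
  · have hM' : IsUnit Mᵀ.det := by rwa [det_transpose]
    have h1 : fromBlocks 0 M Mᵀ 0 * fromBlocks 0 Mᵀ⁻¹ M⁻¹ 0 = 1 := by
      simp [fromBlocks_multiply, Matrix.mul_nonsing_inv _ hM, Matrix.mul_nonsing_inv _ hM']
    exact (Matrix.isUnit_iff_isUnit_det _).mp (IsUnit.of_mul_eq_one _ h1)
  · have h1 : Aᵀ * Mᵀ * A = Mᵀ := by
      have h2 := congrArg Matrix.transpose hAM
      rwa [transpose_mul, transpose_mul, transpose_transpose, ← mul_assoc] at h2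
    simp [fromBlocks_transpose, fromBlocks_multiply, hAM, h1]
  · rw [charpoly_fromBlocks_zero₁₂, hA, pow_two]
  · rw [aeval_fromBlocks_diagonal, hAS, fromBlocks_zero]

/-- The gluing construction: the values at `1` and `-1` are squares up to a common sign. -/
theorem of_eval {S : ℤ[X]} (hS : S.Monic) (hrev : S.reverse = S) {n : ℕ} (hn : 0 < n)
    (hdeg : S.natDegree = 2 * n) {ε a b : ℤ} (hε : ε * ε = 1)
    (hplus : a + b ≠ 0) (hminus : a - b ≠ 0) (h₁ : S.eval 1 = ε * (a + b) ^ 2)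
    (h₂ : (-1) ^ n * S.eval (-1) = ε * (a - b) ^ 2) : HasEvenUnimodularIsometry S S := by
  obtain ⟨V, hV⟩ := palindromic_decomposition hrev hn hdeg h₁ h₂
  obtain ⟨σ, ω, hσ, hx, hω, hperf⟩ := exists_involution_functional hS hrev hn hdeg
  have hε0 : ε ≠ 0 := by rintro rfl; simp at hε
  have hS₁ : S.eval 1 ≠ 0 := by rw [h₁]; positivity
  have hS₂ : S.eval (-1) ≠ 0 := by
    intro h0
    rw [h0, mul_zero] at h₂
    have : ε * (a - b) ^ 2 ≠ 0 := by positivity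
    exact this h₂.symm
  set x := AdjoinRoot.root S with hxdef
  have hmkX : AdjoinRoot.mk S X = x := AdjoinRoot.mk_X
  set H : ℤ[X] := C a + C b * X with hH
  set K : ℤ[X] := C ε * X ^ (n - 1) * (C b + C a * X) with hK
  have hSHK : S = H * K + (X ^ 2 - 1) ^ 2 * V := by
    rw [hK]; linear_combination hV
  set h := AdjoinRoot.mk S H with hh
  set δ := x - σ x with hδ
  have hxδ : x * δ = x ^ 2 - 1 := by rw [hδ]; linear_combination -hx
  have hmkD : AdjoinRoot.mk S (X ^ 2 - 1) = x * δ := by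
    rw [hxδ, map_sub, map_pow, hmkX, map_one]
  have hmkint : ∀ m : ℤ, AdjoinRoot.mk S (C m) = (m : AdjoinRoot S) := fun m => by simp
  have hh' : h = a + b * x := by
    rw [hh, hH, map_add, map_mul, hmkX, hmkint, hmkint]
  have hσh : σ h = a + b * σ x := by
    rw [hh', map_add, map_mul, map_intCast, map_intCast]
  have hmkK : AdjoinRoot.mk S K = ε * x ^ n * σ h := by
    have hpow : x ^ n = x ^ (n - 1) * x := by rw [← pow_succ, Nat.sub_add_cancel hn]
    rw [hK, map_mul, map_mul, map_pow, map_add, map_mul, hmkX, hmkint, hmkint, hmkint, hσh, hpow]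
    linear_combination -(ε : AdjoinRoot S) * x ^ (n - 1) * b * hx
  have hεR : (ε : AdjoinRoot S) * ε = 1 := by exact_mod_cast congrArg (Int.cast) hε
  have hpow : x ^ n * σ x ^ n = 1 := by rw [← mul_pow, hx, one_pow]
  have hzero : h * (ε * x ^ n * σ h) + (x * δ) ^ 2 * AdjoinRoot.mk S V = 0 := by
    rw [← hmkK, ← hmkD, hh, ← map_mul, ← map_pow, ← map_mul, ← map_add, ← hSHK,
      AdjoinRoot.mk_self]
  have hreg : ∀ r, δ * r = 0 → r = 0 := by
    intro r hr
    obtain ⟨q, rfl⟩ := AdjoinRoot.mk_surjective r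
    have h3 : AdjoinRoot.mk S ((X ^ 2 - 1) * q) = 0 := by
      rw [map_mul, hmkD, mul_assoc, hr, mul_zero]
    obtain ⟨t, ht⟩ := AdjoinRoot.mk_eq_zero.mp h3
    have h4 := congrArg (eval 1) ht
    have h5 := congrArg (eval (-1)) ht
    simp [hS₁] at h4
    simp [hS₂] at h5
    obtain ⟨t', rfl⟩ := X_sq_sub_one_dvd h4 h5
    refine AdjoinRoot.mk_eq_zero.mpr ⟨t', ?_⟩
    refine mul_left_cancel₀ X_sq_sub_one_monic.ne_zero ?_
    rw [ht]; ring
  have hcolon : ∀ u v, h * u = δ * v → ∃ r s, u = δ * r + σ h * s := by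
    intro u v huv
    obtain ⟨q, rfl⟩ := AdjoinRoot.mk_surjective u
    obtain ⟨w, rfl⟩ := AdjoinRoot.mk_surjective v
    have h3 : AdjoinRoot.mk S (H * X * q - (X ^ 2 - 1) * w) = 0 := by
      rw [map_sub, map_mul, map_mul, map_mul, hmkD, hmkX, ← hh]
      linear_combination x * huv
    obtain ⟨t, ht⟩ := AdjoinRoot.mk_eq_zero.mp h3
    have h4 : H * (X * q - K * t) = (X ^ 2 - 1) * (w + (X ^ 2 - 1) * V * t) := by
      linear_combination ht + t * hSHK
    have hdvd : X ^ 2 - 1 ∣ X * q - K * t := by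
      have h5 := congrArg (eval 1) h4
      have h6 := congrArg (eval (-1)) h4
      have hH₁ : H.eval 1 = a + b := by simp [hH]
      have hH₂ : H.eval (-1) = a - b := by simp [hH, sub_eq_add_neg]
      rw [eval_mul, eval_mul, hH₁] at h5
      rw [eval_mul, eval_mul, hH₂] at h6
      refine X_sq_sub_one_dvd ?_ ?_
      · refine (mul_eq_zero.mp (h5.trans ?_)).resolve_left hplus
        simp
      · refine (mul_eq_zero.mp (h6.trans ?_)).resolve_left hminus
        simp
    obtain ⟨m, hm⟩ := hdvd
    have h7 := congrArg (AdjoinRoot.mk S) hm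
    rw [map_sub, map_mul _ X q, map_mul _ K t, map_mul _ _ m, hmkX, hmkD, hmkK] at h7
    refine ⟨AdjoinRoot.mk S m, σ x * (ε * x ^ n * AdjoinRoot.mk S t), ?_⟩
    linear_combination σ x * h7 - (AdjoinRoot.mk S q - δ * AdjoinRoot.mk S m) * hx
  obtain ⟨B, T, hB, hBe, hBu, hT, hTc⟩ := exists_even_unimodular_of_ideal
    (AdjoinRoot.powerBasis' hS).basis σ ω x δ h (-(ε * σ x ^ n * x ^ 2 * AdjoinRoot.mk S V))
    hσ hx hω hperf hδ hreg
    (by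
      linear_combination ε * σ x ^ n * hzero - h * σ h * (ε * ε) * hpow - h * σ h * hεR) hcolon
  replace hTc : T.charpoly = S := hTc.trans (charpoly_leftMulMatrix_root hS)
  refine ⟨_, inferInstance, inferInstance, B, T, hB, hBe, hBu, hT, hTc, ?_⟩
  have h1 := aeval_self_charpoly T
  rwa [hTc] at h1

end HasEvenUnimodularIsometry

theorem reverse_prod_pow {κ : Type*} (s : Finset κ) (f : κ → ℤ[X]) (k : κ → ℕ)
    (h : ∀ i, (f i).reverse = f i) : (∏ i ∈ s, f i ^ k i).reverse = ∏ i ∈ s, f i ^ k i := by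
  have hpow : ∀ (q : ℤ[X]) (_ : q.reverse = q) (m : ℕ), (q ^ m).reverse = q ^ m := by
    intro q hq m
    induction m with
    | zero => rw [pow_zero, ← C_1, reverse_C]
    | succ m ih => rw [pow_succ, reverse_mul_of_domain, ih, hq]
  classical
  induction s using Finset.induction_on with
  | empty => rw [Finset.prod_empty, ← C_1, reverse_C]
  | insert i s hi ih => rw [Finset.prod_insert hi, reverse_mul_of_domain, ih, hpow _ (h i)]

theorem eval_ne_zero_of_irreducible_of_even {q : ℤ[X]} (hirr : Irreducible q)
    (heven : Even q.natDegree) (c : ℤ) : q.eval c ≠ 0 := by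
  intro h0
  have h1 : X - C c ∣ q := dvd_iff_isRoot.mpr h0
  have h2 : q ∣ X - C c := (irreducible_X_sub_C c).dvd_symm hirr h1
  have h3 := natDegree_le_of_dvd h1 hirr.ne_zero
  have h4 := natDegree_le_of_dvd h2 (X_sub_C_ne_zero c)
  rw [natDegree_X_sub_C] at h3 h4
  obtain ⟨k, hk⟩ := heven
  omega

theorem exists_eq_sq_of_mul_sq {m t : ℤ} (ht : t ≠ 0) (h : ∃ a, |m * t ^ 2| = a ^ 2) :
    ∃ a, |m| = a ^ 2 := by
  obtain ⟨a, ha⟩ := h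
  rw [abs_mul, abs_of_nonneg (sq_nonneg t)] at ha
  obtain ⟨d, rfl⟩ : t ∣ a := (Int.pow_dvd_pow_iff two_ne_zero).mp ⟨|m|, by rw [← ha, mul_comm]⟩
  exact ⟨d, mul_right_cancel₀ (pow_ne_zero 2 ht) (by rw [ha]; ring)⟩

/-- The values at `1` and `-1` of a polynomial satisfying the square conditions, written with the
common sign and the two glue coefficients. -/
theorem exists_glue_parameters {S : ℤ[X]} {n : ℕ} (h₁ : ∃ a, |S.eval 1| = a ^ 2)
    (h₂ : ∃ a, |S.eval (-1)| = a ^ 2) (hpos : 0 < (-1) ^ n * S.eval 1 * S.eval (-1)) :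
    ∃ ε a b : ℤ, ε * ε = 1 ∧ a + b ≠ 0 ∧ a - b ≠ 0 ∧ S.eval 1 = ε * (a + b) ^ 2 ∧
      (-1) ^ n * S.eval (-1) = ε * (a - b) ^ 2 := by
  obtain ⟨A, hA⟩ := h₁
  obtain ⟨B, hB⟩ := h₂
  have hpar : (2 : ℤ) ∣ S.eval 1 - S.eval (-1) := by
    simpa using sub_dvd_eval_sub (1 : ℤ) (-1) S
  set s := S.eval 1
  set u := S.eval (-1)
  have hs : s ≠ 0 := by rintro h; simp [h] at hpos
  have hu : u ≠ 0 := by rintro h; simp [h] at hpos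
  have hA0 : A ≠ 0 := by rintro rfl; simp at hA; exact hs hA
  have hB0 : B ≠ 0 := by rintro rfl; simp at hB; exact hu hB
  have hAB : (2 : ℤ) ∣ A - B := by
    have h3 : (2 : ℤ) ∣ A ^ 2 - B ^ 2 := by
      rw [← hA, ← hB]
      rcases abs_choice s with h | h <;> rcases abs_choice u with h' | h' <;> rw [h, h'] <;> omega
    rw [← even_iff_two_dvd] at h3 ⊢
    simpa [Int.even_sub, Int.even_pow] using h3
  obtain ⟨b, hb⟩ := hAB
  have hB' : |(-1) ^ n * u| = B ^ 2 := by rw [abs_mul, abs_pow]; simpa using hB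
  set v := (-1) ^ n * u
  have hsv : 0 < s * v := by
    have : s * v = (-1) ^ n * s * u := by simp only [v]; ring
    rwa [this]
  have e1 : B + b + b = A := by omega
  have e2 : B + b - b = B := by omega
  rcases pos_and_pos_or_neg_and_neg_of_mul_pos hsv with ⟨h3, h4⟩ | ⟨h3, h4⟩
  · refine ⟨1, B + b, b, by norm_num, by rwa [e1], by rwa [e2], ?_, ?_⟩
    · rw [e1, ← hA, abs_of_pos h3, one_mul]
    · rw [e2, ← hB', abs_of_pos h4, one_mul]
  · refine ⟨-1, B + b, b, by norm_num, by rwa [e1], by rwa [e2], ?_, ?_⟩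
    · rw [e1, ← hA, abs_of_neg h3]; ring
    · rw [e2, ← hB', abs_of_neg h4]; ring

theorem hasEvenUnimodularIsometry_prod {r : ℕ} (f : Fin r → ℤ[X]) (nn : Fin r → ℕ)
    (hmonic : ∀ i, (f i).Monic) (hirr : ∀ i, Irreducible (f i))
    (hsymm : ∀ i, (f i).reverse = f i) (heven : ∀ i, Even (f i).natDegree)
    (n : ℕ) (hdeg : (∏ i, f i ^ nn i).natDegree = 2 * n)
    (hsq1 : ∃ a : ℤ, |(∏ i, f i ^ nn i).eval 1| = a ^ 2)
    (hsq2 : ∃ a : ℤ, |(∏ i, f i ^ nn i).eval (-1)| = a ^ 2)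
    (hsq3 : ∃ a : ℤ,
      (-1) ^ n * (∏ i, f i ^ nn i).eval 1 * (∏ i, f i ^ nn i).eval (-1) = a ^ 2) :
    HasEvenUnimodularIsometry (∏ i, f i ^ nn i) (∏ i, f i) := by
  set s := ∏ i, f i ^ (nn i % 2) with hs
  set t := ∏ i, f i ^ (nn i / 2) with ht
  have hst : ∏ i, f i ^ nn i = s * t ^ 2 := by
    rw [hs, ht, ← Finset.prod_pow, ← Finset.prod_mul_distrib]
    refine Finset.prod_congr rfl fun i _ => ?_
    rw [← pow_mul, ← pow_add, Nat.mod_add_div']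
  have hmon : ∀ k : Fin r → ℕ, (∏ i, f i ^ k i).Monic := fun k =>
    monic_prod_of_monic _ _ fun i _ => (hmonic i).pow _
  have hne : ∀ (k : Fin r → ℕ) (c : ℤ), (∏ i, f i ^ k i).eval c ≠ 0 := by
    intro k c
    rw [eval_prod]
    refine Finset.prod_ne_zero_iff.mpr fun i _ => ?_
    rw [eval_pow]
    exact pow_ne_zero _ (eval_ne_zero_of_irreducible_of_even (hirr i) (heven i) c)
  have hdegeven : ∀ k : Fin r → ℕ, Even (∏ i, f i ^ k i).natDegree := by
    intro k
    rw [natDegree_prod_of_monic _ _ fun i _ => (hmonic i).pow _]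
    refine Finset.even_sum _ fun i _ => ?_
    rw [(hmonic i).natDegree_pow]
    exact (heven i).mul_left _
  have htsq : HasEvenUnimodularIsometry (t ^ 2) (∏ i, f i) := by
    rw [ht, ← Finset.prod_pow]
    refine HasEvenUnimodularIsometry.prod _ fun i => ?_
    rw [← pow_mul, mul_comm, pow_mul]
    refine HasEvenUnimodularIsometry.pow ?_ _
    obtain ⟨d, hd⟩ := heven i
    have hpos : 0 < (f i).natDegree := by
      refine Nat.pos_of_ne_zero fun h0 => (hirr i).not_isUnit ?_
      rw [(hmonic i).natDegree_eq_zero.mp h0]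
      exact isUnit_one
    exact (HasEvenUnimodularIsometry.sq (hmonic i) (hsymm i) (n := d) (by omega)
      (by omega)).of_dvd (Finset.dvd_prod_of_mem f (Finset.mem_univ i))
  rw [hst] at hdeg hsq1 hsq2 hsq3 ⊢
  refine HasEvenUnimodularIsometry.mul ?_ htsq
  obtain ⟨d, hd⟩ := hdegeven fun i => nn i % 2
  obtain ⟨k, hk⟩ := hdegeven fun i => nn i / 2
  rw [← hs] at hd
  rw [← ht] at hk
  rcases Nat.eq_zero_or_pos d with rfl | hdpos
  · have h1 : s = 1 := (hmon _).natDegree_eq_zero.mp (by omega)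
    rw [h1]
    exact .one _
  simp only [eval_mul, eval_pow] at hsq1 hsq2 hsq3
  have hsm : s.Monic := hmon _
  have htm : t.Monic := hmon _
  have hn : n = d + 2 * k := by
    rw [hsm.natDegree_mul (htm.pow 2), htm.natDegree_pow] at hdeg
    omega
  have hpos : 0 < (-1) ^ d * s.eval 1 * s.eval (-1) := by
    obtain ⟨a, ha⟩ := hsq3
    rw [hn, pow_add, pow_mul (-1 : ℤ) 2 k, neg_one_sq, one_pow, mul_one] at ha
    have h2 : ((-1) ^ d * s.eval 1 * s.eval (-1)) * (t.eval 1 * t.eval (-1)) ^ 2 = a ^ 2 := by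
      rw [← ha]; ring
    have h3 : (t.eval 1 * t.eval (-1)) ^ 2 > 0 :=
      sq_pos_of_ne_zero (mul_ne_zero (hne _ _) (hne _ _))
    have h4 : (-1) ^ d * s.eval 1 * s.eval (-1) ≠ 0 :=
      mul_ne_zero (mul_ne_zero (by simp) (hne _ _)) (hne _ _)
    refine lt_of_le_of_ne (le_of_mul_le_mul_right ?_ h3) h4.symm
    rw [zero_mul, h2]
    exact sq_nonneg a
  obtain ⟨ε, a, b, hε, hplus, hminus, h1, h2⟩ := exists_glue_parameters (n := d)
    (exists_eq_sq_of_mul_sq (hne _ _) hsq1) (exists_eq_sq_of_mul_sq (hne _ _) hsq2) hpos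
  refine (HasEvenUnimodularIsometry.of_eval hsm (reverse_prod_pow _ f _ hsymm) hdpos
    (by rw [hd, two_mul]) hε hplus hminus h1 h2).of_dvd ?_
  refine Finset.prod_dvd_prod_of_dvd _ _ fun i _ => ?_
  calc f i ^ (nn i % 2) ∣ f i ^ 1 := pow_dvd_pow _ (by omega)
    _ = f i := pow_one _

theorem stmt_7 {r : ℕ} (f : Fin r → Polynomial ℤ) (nn : Fin r → ℕ)
    (hdist : Function.Injective f)
    (hmonic : ∀ i, (f i).Monic) (hirr : ∀ i, Irreducible (f i))
    (hsymm : ∀ i, (f i).reverse = f i) (heven : ∀ i, Even (f i).natDegree)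
    (hnn : ∀ i, 1 ≤ nn i)
    (n : ℕ) (hdeg : (∏ i, f i ^ nn i).natDegree = 2 * n)
    (hsq1 : ∃ a : ℤ, |(∏ i, f i ^ nn i).eval 1| = a ^ 2)
    (hsq2 : ∃ a : ℤ, |(∏ i, f i ^ nn i).eval (-1)| = a ^ 2)
    (hsq3 : ∃ a : ℤ,
      (-1) ^ n * (∏ i, f i ^ nn i).eval 1 * (∏ i, f i ^ nn i).eval (-1) = a ^ 2)
    (p : ℕ) [Fact p.Prime] :
    ∃ B T : Matrix (Fin (2 * n)) (Fin (2 * n)) ℤ_[p],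
      B.IsSymm ∧ (∀ i, (2 : ℤ_[p]) ∣ B i i) ∧ IsUnit B.det ∧
      Tᵀ * B * T = B ∧
      T.charpoly = (∏ i, f i ^ nn i).map (Int.castRingHom ℤ_[p]) ∧
      aeval T (∏ i, f i) = 0 := by
  obtain ⟨ι, _, _, B, T, hB, hBe, hBu, hT, hTc, hTg⟩ :=
    hasEvenUnimodularIsometry_prod f nn hmonic hirr hsymm heven n hdeg hsq1 hsq2 hsq3
  have hcard : Fintype.card ι = Fintype.card (Fin (2 * n)) := by
    rw [Fintype.card_fin, ← hdeg, ← hTc, charpoly_natDegree_eq_dim]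
  let e : ι ≃ Fin (2 * n) := Fintype.equivOfCardEq hcard
  let F : Matrix ι ι ℤ →+* Matrix (Fin (2 * n)) (Fin (2 * n)) ℤ_[p] :=
    ((Int.castRingHom ℤ_[p]).mapMatrix).comp (reindexAlgEquiv ℤ ℤ e : _ →+* _)
  have hF : ∀ M : Matrix ι ι ℤ, F M = (reindex e e M).map (Int.castRingHom ℤ_[p]) := fun _ => rfl
  have hFt : ∀ M : Matrix ι ι ℤ, F Mᵀ = (F M)ᵀ := fun _ => rfl
  refine ⟨F B, F T, ?_, fun i => ?_, ?_, ?_, ?_, ?_⟩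
  · rw [Matrix.IsSymm, ← hFt, hB]
  · simpa [hF] using map_dvd (Int.castRingHom ℤ_[p]) (hBe (e.symm i))
  · rw [hF, ← RingHom.mapMatrix_apply, ← RingHom.map_det, det_reindex_self]
    exact hBu.map _
  · rw [← hFt, ← map_mul, ← map_mul, hT]
  · rw [hF, charpoly_map, charpoly_reindex, hTc]
  · have h1 := aeval_algHom_apply F.toIntAlgHom T (∏ i, f i)
    rw [hTg, map_zero] at h1
    exact h1
end

section
/- Let p be a prime number with p ≡ 3 (mod 8), set N = 4(p−1), and let F = Φ_p²·Φ_{2p}² ∈ ℤ[X], where Φ_m is the m-th cyclotomic polynomial (so deg F = N). Then there exist matrices B, T ∈ M_N(ℤ) such that: B is symmetric, every diagonal entry of B is even, xᵀ·B·x > 0 for every nonzero x ∈ ℤ^N, det B = 1, Tᵀ·B·T = B, and the characteristic polynomial of T equals F. -/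
open Polynomial Matrix

/-- The companion matrix of `1 + X + ⋯ + X ^ n`. -/
def cyclicCompanion (n : ℕ) : Matrix (Fin n) (Fin n) ℤ :=
  Matrix.of fun i j => if (j : ℕ) + 1 = n then -1 else if (i : ℕ) = j + 1 then 1 else 0

/-- The Gram matrix of the dual of the root lattice `A_n`, scaled by `n + 1`. -/
def scaledDualGram (n : ℕ) : Matrix (Fin n) (Fin n) ℤ :=
  Matrix.of fun i j => if i = j then (n : ℤ) else -1

theorem minpoly_adjoinRoot_root {g : ℤ[X]} (hg : g.Monic) :
    minpoly ℤ (AdjoinRoot.root g) = g := by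
  refine (minpoly.unique' ℤ _ hg (by simp) fun q hq => ?_).symm
  rcases eq_or_ne q 0 with h | h
  · exact Or.inl h
  · right
    rw [AdjoinRoot.aeval_eq]
    exact AdjoinRoot.mk_ne_zero_of_degree_lt hg h hq

theorem coeff_cyclotomic_prime {p : ℕ} (hp : p.Prime) {i : ℕ} (hi : i < p) :
    (cyclotomic p ℤ).coeff i = 1 := by
  have : Fact p.Prime := ⟨hp⟩
  simp [cyclotomic_prime, coeff_X_pow, hi]

theorem charpoly_cyclicCompanion {n : ℕ} (hn : (n + 1).Prime) :
    (cyclicCompanion n).charpoly = cyclotomic (n + 1) ℤ := by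
  set pb := AdjoinRoot.powerBasis' (cyclotomic.monic (n + 1) ℤ)
  have hgen : minpoly ℤ pb.gen = cyclotomic (n + 1) ℤ :=
    minpoly_adjoinRoot_root (cyclotomic.monic (n + 1) ℤ)
  have hdim : pb.dim = n := by
    rw [← pb.natDegree_minpoly, hgen, natDegree_cyclotomic, Nat.totient_prime hn]; rfl
  have hM : cyclicCompanion n = Matrix.reindex (finCongr hdim) (finCongr hdim)
      (Algebra.leftMulMatrix pb.basis pb.gen) := by
    ext i j
    have hi : (cyclotomic (n + 1) ℤ).coeff i = 1 := coeff_cyclotomic_prime hn (by omega)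
    simp [cyclicCompanion, pb.leftMulMatrix, hgen, hdim, hi]
  rw [hM, Matrix.charpoly_reindex, charpoly_leftMulMatrix, hgen]

theorem cyclotomic_comp_neg_X {p : ℕ} (hp : p.Prime) (hodd : Odd p) :
    (cyclotomic p ℤ).comp (-X) = cyclotomic (2 * p) ℤ := by
  have : Fact p.Prime := ⟨hp⟩
  have h2 : ¬ 2 ∣ p := fun h => (Nat.not_even_iff_odd.2 hodd) (even_iff_two_dvd.2 h)
  have hexp := cyclotomic_expand_eq_cyclotomic_mul Nat.prime_two h2 ℤ
  have h1 := cyclotomic_prime_mul_X_sub_one ℤ p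
  have hneg := congrArg (fun f : ℤ[X] => f.comp (-X)) h1
  have hsq := congrArg (expand ℤ 2) h1
  simp only [mul_comp, sub_comp, X_comp, one_comp, pow_comp, hodd.neg_pow] at hneg
  simp only [map_mul, map_sub, expand_X, map_one, map_pow, hexp] at hsq
  have hX : (X ^ 2 - 1 : ℤ[X]) ≠ 0 := (monic_X_pow_sub_C (1 : ℤ) two_ne_zero).ne_zero
  have hc := cyclotomic_ne_zero p ℤ
  rw [mul_comm 2 p]
  refine mul_right_cancel₀ (mul_ne_zero hc hX) ?_
  linear_combination (-(X ^ p - 1) : ℤ[X]) * hneg - hsq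
    - ((cyclotomic p ℤ).comp (-X) * (-X - 1)) * h1

theorem charpoly_neg_of_even_card {ι : Type*} [Fintype ι] [DecidableEq ι]
    (hι : Even (Fintype.card ι)) (M : Matrix ι ι ℤ) :
    (-M).charpoly = M.charpoly.comp (-X) := by
  refine Polynomial.funext fun t => ?_
  rw [eval_comp, Matrix.eval_charpoly, Matrix.eval_charpoly, ← one_mul (det _), ← hι.neg_one_pow,
    ← Matrix.det_neg]
  congr 1
  simp only [map_neg, eval_neg, eval_X]
  abel

theorem charpoly_neg_cyclicCompanion {n : ℕ} (hn : (n + 1).Prime) (heven : Even n) :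
    (-cyclicCompanion n).charpoly = cyclotomic (2 * (n + 1)) ℤ := by
  rw [charpoly_neg_of_even_card (by simpa using heven), charpoly_cyclicCompanion hn,
    cyclotomic_comp_neg_X hn heven.add_one]

theorem det_one_sub_cyclicCompanion {n : ℕ} (hn : (n + 1).Prime) :
    (1 - cyclicCompanion n).det = n + 1 := by
  have : Fact (n + 1).Prime := ⟨hn⟩
  have h := Matrix.eval_charpoly (cyclicCompanion n) 1
  rw [charpoly_cyclicCompanion hn, eval_one_cyclotomic_prime, map_one] at h
  rw [← h]
  push_cast
  rfl

theorem transpose_cyclicCompanion_mul_apply {n : ℕ} (M : Matrix (Fin n) (Fin n) ℤ)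
    (j k : Fin n) :
    ((cyclicCompanion n)ᵀ * M) j k =
      if h : (j : ℕ) + 1 < n then M ⟨j + 1, h⟩ k else -∑ i, M i k := by
  simp only [mul_apply, transpose_apply, cyclicCompanion, of_apply]
  split_ifs with h h'
  · omega
  · simp
  · rw [Finset.sum_eq_single ⟨j + 1, by assumption⟩] <;> simp [Fin.ext_iff]
    tauto
  · omega

theorem mul_cyclicCompanion_apply {n : ℕ} (M : Matrix (Fin n) (Fin n) ℤ) (j k : Fin n) :
    (M * cyclicCompanion n) k j =
      if h : (j : ℕ) + 1 < n then M k ⟨j + 1, h⟩ else -∑ i, M k i := by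
  rw [← transpose_apply (M * _), transpose_mul, transpose_cyclicCompanion_mul_apply]
  rfl

theorem isSymm_scaledDualGram (n : ℕ) : (scaledDualGram n).IsSymm := by
  ext i j
  simp [scaledDualGram, eq_comm]

theorem sum_scaledDualGram (n : ℕ) (k : Fin n) : ∑ i, scaledDualGram n k i = 1 := by
  have h (i : Fin n) : scaledDualGram n k i = (if k = i then (n + 1 : ℤ) else 0) - 1 := by
    simp only [scaledDualGram, of_apply]; split_ifs <;> ring
  simp [h]

theorem scaledDualGram_mul_cyclicCompanion_apply {n : ℕ} (j k : Fin n) :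
    (scaledDualGram n * cyclicCompanion n) k j =
      if (k : ℕ) = j + 1 then (n : ℤ) else -1 := by
  rw [mul_cyclicCompanion_apply, sum_scaledDualGram]
  split_ifs with h h' h'
  · simp [scaledDualGram, Fin.ext_iff, h']
  · simp [scaledDualGram, Fin.ext_iff, h']
  · omega
  · rfl

theorem cyclicCompanion_isometry (n : ℕ) :
    (cyclicCompanion n)ᵀ * scaledDualGram n * cyclicCompanion n = scaledDualGram n := by
  ext i j
  rw [Matrix.mul_assoc, transpose_cyclicCompanion_mul_apply]
  simp only [scaledDualGram_mul_cyclicCompanion_apply]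
  by_cases h : (i : ℕ) + 1 < n
  · simp [scaledDualGram, Fin.ext_iff, h]
  · by_cases hj : (j : ℕ) + 1 < n
    · have hij : i ≠ j := fun hij => h (hij ▸ hj)
      have hk (k : Fin n) : (if (k : ℕ) = j + 1 then (n : ℤ) else -1) =
          (if k = ⟨j + 1, hj⟩ then (n + 1 : ℤ) else 0) - 1 := by
        simp only [Fin.ext_iff]; split_ifs <;> ring
      simp [hk, scaledDualGram, hij, h]
    · have hij : i = j := by ext; omega
      have hk (k : Fin n) : (k : ℕ) ≠ j + 1 := by omega
      simp [hk, scaledDualGram, hij, hj]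

theorem exists_smul_eq_scaledDualGram_mul_one_sub (n : ℕ) :
    ∃ S, scaledDualGram n * (1 - cyclicCompanion n) = (n + 1 : ℤ) • S := by
  refine ⟨Matrix.of fun k j => (if k = j then 1 else 0) - if (k : ℕ) = j + 1 then 1 else 0, ?_⟩
  ext k j
  rw [Matrix.mul_sub, Matrix.mul_one, Matrix.sub_apply, scaledDualGram_mul_cyclicCompanion_apply]
  simp only [scaledDualGram, of_apply, Matrix.smul_apply, smul_eq_mul]
  split_ifs <;> ring

theorem det_scaledDualGram {n : ℕ} (hn : 1 ≤ n) :
    (scaledDualGram n).det = (n + 1 : ℤ) ^ (n - 1) := by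
  let u : Matrix (Fin n) Unit ℤ := of fun _ _ => 1
  have hM : scaledDualGram n = Matrix.scalar (Fin n) (n + 1 : ℤ) - u * uᵀ := by
    ext i j
    rw [Matrix.sub_apply, Matrix.scalar_apply]
    by_cases h : i = j <;> simp [scaledDualGram, h, mul_apply, u]
  rw [hM, ← Matrix.eval_charpoly, charpoly_mul_comm_of_le _ _ (by simpa using hn)]
  simp [Matrix.charpoly, mul_apply, u]

theorem dotProduct_scaledDualGram_mulVec {n : ℕ} (x : Fin n → ℤ) :
    x ⬝ᵥ scaledDualGram n *ᵥ x = (n + 1) * ∑ i, x i ^ 2 - (∑ i, x i) ^ 2 := by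
  have h (i : Fin n) : (scaledDualGram n *ᵥ x) i = (n + 1) * x i - ∑ j, x j := by
    have hi (j : Fin n) : scaledDualGram n i j * x j =
        (if i = j then (n + 1 : ℤ) * x j else 0) - x j := by
      simp only [scaledDualGram, of_apply]; split_ifs <;> ring
    simp [mulVec, dotProduct, hi]
  simp only [dotProduct, h, mul_sub, Finset.sum_sub_distrib, ← Finset.sum_mul, ← sq]
  rw [Finset.mul_sum]
  congr 1
  exact Finset.sum_congr rfl fun i _ => by ring

theorem scaledDualGram_pos {n : ℕ} (x : Fin n → ℤ) (hx : x ≠ 0) :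
    0 < x ⬝ᵥ scaledDualGram n *ᵥ x := by
  rw [dotProduct_scaledDualGram_mulVec]
  have hcs := sq_sum_le_card_mul_sum_sq (s := Finset.univ) (f := x)
  have hpos : 0 < ∑ i, x i ^ 2 := by
    obtain ⟨i, hi⟩ := Function.ne_iff.1 hx
    exact Finset.sum_pos' (fun i _ => sq_nonneg _) ⟨i, Finset.mem_univ i, sq_pos_of_ne_zero hi⟩
  simp only [Finset.card_univ, Fintype.card_fin] at hcs
  linarith

theorem scaledDualGram_even {n : ℕ} (hn : Even n) (x : Fin n → ℤ) :
    Even (x ⬝ᵥ scaledDualGram n *ᵥ x) := by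
  rw [dotProduct_scaledDualGram_mulVec]
  have h : Even (∑ i, x i ^ 2 - ∑ i, x i) := by
    rw [← Finset.sum_sub_distrib]
    refine Finset.even_sum _ fun i _ => ?_
    rw [sq, ← mul_sub_one]
    exact Int.even_mul_pred_self _
  have hn' : Even (n : ℤ) := by exact_mod_cast hn
  simp only [parity_simps] at h ⊢
  simp [hn', h]

section Blocks

variable {ι κ : Type*} [Fintype ι] [Fintype κ]

theorem dotProduct_fromBlocks_diag_mulVec (A : Matrix ι ι ℤ) (D : Matrix κ κ ℤ) (x : ι ⊕ κ → ℤ) :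
    x ⬝ᵥ fromBlocks A 0 0 D *ᵥ x =
      (x ∘ Sum.inl) ⬝ᵥ A *ᵥ (x ∘ Sum.inl) + (x ∘ Sum.inr) ⬝ᵥ D *ᵥ (x ∘ Sum.inr) := by
  simp [fromBlocks_mulVec, dotProduct]

theorem fromBlocks_diag_pos {A : Matrix ι ι ℤ} {D : Matrix κ κ ℤ}
    (hA : ∀ x, x ≠ 0 → 0 < x ⬝ᵥ A *ᵥ x) (hD : ∀ x, x ≠ 0 → 0 < x ⬝ᵥ D *ᵥ x)
    (x : ι ⊕ κ → ℤ) (hx : x ≠ 0) : 0 < x ⬝ᵥ fromBlocks A 0 0 D *ᵥ x := by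
  rw [dotProduct_fromBlocks_diag_mulVec]
  by_cases h₁ : x ∘ Sum.inl = 0
  · have h₂ : x ∘ Sum.inr ≠ 0 := fun h₂ => hx <| by
      ext (i | i)
      exacts [congrFun h₁ i, congrFun h₂ i]
    simpa [h₁] using hD _ h₂
  · refine add_pos_of_pos_of_nonneg (hA _ h₁) ?_
    by_cases h₂ : x ∘ Sum.inr = 0
    · simp [h₂]
    · exact (hD _ h₂).le

theorem fromBlocks_diag_even {A : Matrix ι ι ℤ} {D : Matrix κ κ ℤ}
    (hA : ∀ x, Even (x ⬝ᵥ A *ᵥ x)) (hD : ∀ x, Even (x ⬝ᵥ D *ᵥ x)) (x : ι ⊕ κ → ℤ) :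
    Even (x ⬝ᵥ fromBlocks A 0 0 D *ᵥ x) := by
  rw [dotProduct_fromBlocks_diag_mulVec]
  exact (hA _).add (hD _)

end Blocks

section Congruence

variable {ι : Type*} [Fintype ι] {B P G : Matrix ι ι ℤ} {q : ℤ}

theorem mul_dotProduct_of_smul_eq (hB : q • B = Pᵀ * G * P) (x : ι → ℤ) :
    q * (x ⬝ᵥ B *ᵥ x) = (P *ᵥ x) ⬝ᵥ G *ᵥ (P *ᵥ x) := by
  rw [← smul_eq_mul, ← dotProduct_smul, ← smul_mulVec, hB, ← mulVec_mulVec, ← mulVec_mulVec,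
    dotProduct_mulVec, vecMul_transpose]

theorem isSymm_of_smul_eq (hq : q ≠ 0) (hB : q • B = Pᵀ * G * P) (hG : G.IsSymm) :
    B.IsSymm := by
  refine smul_right_injective _ hq ?_
  simp only
  rw [← transpose_smul, hB]
  simp [transpose_mul, hG.eq, Matrix.mul_assoc]

theorem pos_of_smul_eq [DecidableEq ι] (hq : 0 < q) (hB : q • B = Pᵀ * G * P) (hP : P.det ≠ 0)
    (hG : ∀ x, x ≠ 0 → 0 < x ⬝ᵥ G *ᵥ x) (x : ι → ℤ) (hx : x ≠ 0) : 0 < x ⬝ᵥ B *ᵥ x := by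
  refine pos_of_mul_pos_right ?_ hq.le
  rw [mul_dotProduct_of_smul_eq hB]
  exact hG _ fun h => hx (eq_zero_of_mulVec_eq_zero hP h)

theorem even_diag_of_smul_eq [DecidableEq ι] (hq : Odd q) (hB : q • B = Pᵀ * G * P)
    (hG : ∀ x, Even (x ⬝ᵥ G *ᵥ x)) (i : ι) : Even (B i i) := by
  have h := hG (P *ᵥ Pi.single i 1)
  rw [← mul_dotProduct_of_smul_eq hB, Int.even_mul] at h
  simpa using h.resolve_left (Int.not_even_iff_odd.2 hq)

theorem isometry_of_smul_eq (hq : q ≠ 0) (hB : q • B = Pᵀ * G * P) {T U : Matrix ι ι ℤ}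
    (hPT : P * T = U * P) (hU : Uᵀ * G * U = G) : Tᵀ * B * T = B := by
  refine smul_right_injective _ hq ?_
  simp only
  calc q • (Tᵀ * B * T) = Tᵀ * (q • B) * T := by simp
    _ = (P * T)ᵀ * G * (P * T) := by rw [hB]; simp [transpose_mul, Matrix.mul_assoc]
    _ = Pᵀ * (Uᵀ * G * U) * P := by rw [hPT]; simp [transpose_mul, Matrix.mul_assoc]
    _ = q • B := by rw [hU, hB]

end Congruence

/-- Change of basis from a lattice glued from four copies of the dual of `A_n` to those copies;
its glue code is spanned by `(1, 1, 2s, 0)` and `(0, 1, s, -s)`. -/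
def glueBasis (n : ℕ) (s : ℤ) :
    Matrix ((Fin n ⊕ Fin n) ⊕ (Fin n ⊕ Fin n)) ((Fin n ⊕ Fin n) ⊕ (Fin n ⊕ Fin n)) ℤ :=
  fromBlocks (fromBlocks 1 0 1 1) 0 (fromBlocks ((2 * s) • 1) (s • 1) 0 (-s • 1))
    (fromBlocks (1 - cyclicCompanion n) 0 0 (1 - cyclicCompanion n))

/-- The block diagonal sum of four copies of a matrix. -/
def fourfold {n : ℕ} (M : Matrix (Fin n) (Fin n) ℤ) :
    Matrix ((Fin n ⊕ Fin n) ⊕ (Fin n ⊕ Fin n)) ((Fin n ⊕ Fin n) ⊕ (Fin n ⊕ Fin n)) ℤ :=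
  fromBlocks (fromBlocks M 0 0 M) 0 0 (fromBlocks M 0 0 M)

theorem det_glueBasis {n : ℕ} (hn : (n + 1).Prime) (s : ℤ) :
    (glueBasis n s).det = (n + 1) ^ 2 := by
  simp only [glueBasis, det_fromBlocks_zero₁₂, det_one, det_one_sub_cyclicCompanion hn]
  ring

theorem det_fourfold {n : ℕ} (M : Matrix (Fin n) (Fin n) ℤ) :
    (fourfold M).det = M.det ^ 4 := by
  simp only [fourfold, det_fromBlocks_zero₁₂]
  ring

theorem exists_smul_eq_glueBasis {n : ℕ} {s k : ℤ} (hs : 1 + 2 * s ^ 2 = (n + 1) * k) :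
    ∃ B, (n + 1 : ℤ) • B =
      (glueBasis n s)ᵀ * fourfold (scaledDualGram n) * glueBasis n s := by
  obtain ⟨S, hS⟩ := exists_smul_eq_scaledDualGram_mul_one_sub n
  have hSt := congrArg transpose hS
  rw [transpose_mul, (isSymm_scaledDualGram n).eq, transpose_smul] at hSt
  set R := scaledDualGram n
  set D := 1 - cyclicCompanion n with hD
  have hDS : Sᵀ * D = Dᵀ * S := by
    refine smul_right_injective _ (show (n + 1 : ℤ) ≠ 0 by positivity) ?_
    simp only
    rw [← smul_mul_assoc, ← hSt, ← mul_smul_comm, ← hS, Matrix.mul_assoc]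
  refine ⟨fromBlocks (fromBlocks ((2 * k) • R) (k • R) (k • R) (k • R))
    (fromBlocks ((2 * s) • S) 0 (s • S) (-s • S))
    (fromBlocks ((2 * s) • Sᵀ) (s • Sᵀ) 0 (-s • Sᵀ))
    (fromBlocks (Dᵀ * S) 0 0 (Dᵀ * S)), ?_⟩
  simp only [glueBasis, fourfold, fromBlocks_transpose, fromBlocks_multiply, fromBlocks_smul,
    fromBlocks_add, fromBlocks_inj, ← hD, hDS, hS, hSt, transpose_zero, transpose_one,
    transpose_smul, smul_mul_assoc, mul_smul_comm, Matrix.mul_one, Matrix.one_mul,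
    Matrix.mul_zero, Matrix.zero_mul, add_zero, zero_add, smul_zero, true_and, and_true]
  refine ⟨⟨?_, ?_, ?_, ?_⟩, ⟨?_, ?_, ?_⟩, ?_, ?_, ?_⟩ <;> match_scalars
  · linear_combination -2 * hs
  · linear_combination -hs
  · linear_combination -hs
  · linear_combination -hs
  all_goals ring

/-- The isometry in glue coordinates: multiplication by a root of unity composed with the
involution `(x₁, x₂, x₃, x₄) ↦ (x₂, x₁, x₃, -x₄)`. -/
def ambientIsometry (n : ℕ) :
    Matrix ((Fin n ⊕ Fin n) ⊕ (Fin n ⊕ Fin n)) ((Fin n ⊕ Fin n) ⊕ (Fin n ⊕ Fin n)) ℤ :=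
  fromBlocks (fromBlocks 0 (cyclicCompanion n) (cyclicCompanion n) 0) 0 0
    (fromBlocks (cyclicCompanion n) 0 0 (-cyclicCompanion n))

/-- The matrix of `ambientIsometry` in the basis `glueBasis`. -/
def latticeIsometry (n : ℕ) :
    Matrix ((Fin n ⊕ Fin n) ⊕ (Fin n ⊕ Fin n)) ((Fin n ⊕ Fin n) ⊕ (Fin n ⊕ Fin n)) ℤ :=
  fromBlocks (fromBlocks (cyclicCompanion n) (cyclicCompanion n) 0 (-cyclicCompanion n)) 0 0
    (fromBlocks (cyclicCompanion n) 0 0 (-cyclicCompanion n))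

theorem glueBasis_mul_latticeIsometry (n : ℕ) (s : ℤ) :
    glueBasis n s * latticeIsometry n = ambientIsometry n * glueBasis n s := by
  simp only [glueBasis, latticeIsometry, ambientIsometry, fromBlocks_multiply,
    fromBlocks_inj, smul_mul_assoc, mul_smul_comm, Matrix.mul_one, Matrix.one_mul,
    Matrix.mul_zero, Matrix.zero_mul, Matrix.mul_neg, Matrix.neg_mul, Matrix.mul_sub,
    Matrix.sub_mul, add_zero, zero_add, smul_neg, neg_zero, true_and]
  constructorm* _ ∧ _ <;> module

theorem ambientIsometry_isometry (n : ℕ) :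
    (ambientIsometry n)ᵀ * fourfold (scaledDualGram n) * ambientIsometry n =
      fourfold (scaledDualGram n) := by
  simp [ambientIsometry, fourfold, fromBlocks_transpose, fromBlocks_multiply,
    cyclicCompanion_isometry]

theorem charpoly_latticeIsometry {n : ℕ} (hn : (n + 1).Prime) (heven : Even n) :
    (latticeIsometry n).charpoly =
      cyclotomic (n + 1) ℤ ^ 2 * cyclotomic (2 * (n + 1)) ℤ ^ 2 := by
  simp only [latticeIsometry, charpoly_fromBlocks_zero₂₁,
    charpoly_cyclicCompanion hn, charpoly_neg_cyclicCompanion hn heven]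
  ring

theorem isSymm_fourfold_scaledDualGram (n : ℕ) : (fourfold (scaledDualGram n)).IsSymm := by
  simp [fourfold, IsSymm, fromBlocks_transpose, (isSymm_scaledDualGram n).eq]

theorem det_eq_one_of_smul_eq_glueBasis {n : ℕ} (hn : (n + 1).Prime) {s : ℤ}
    {B : Matrix ((Fin n ⊕ Fin n) ⊕ (Fin n ⊕ Fin n)) ((Fin n ⊕ Fin n) ⊕ (Fin n ⊕ Fin n)) ℤ}
    (hB : (n + 1 : ℤ) • B = (glueBasis n s)ᵀ * fourfold (scaledDualGram n) * glueBasis n s) :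
    B.det = 1 := by
  have h1 : 1 ≤ n := by have := hn.two_le; omega
  have hdet := congrArg det hB
  rw [det_smul, det_mul, det_mul, det_transpose, det_glueBasis hn, det_fourfold,
    det_scaledDualGram h1] at hdet
  obtain ⟨m, rfl⟩ := Nat.exists_eq_add_of_le' h1
  simp only [Fintype.card_sum, Fintype.card_fin, Nat.add_sub_cancel] at hdet
  have hq : ((m + 1 : ℕ) + 1 : ℤ) ≠ 0 := by positivity
  refine mul_left_cancel₀ (pow_ne_zero (m + 1 + (m + 1) + (m + 1 + (m + 1))) hq) ?_
  rw [hdet]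
  ring

theorem exists_two_mul_sq_add_one {p : ℕ} (hp : p.Prime) (hp8 : p % 8 = 3) :
    ∃ s k : ℤ, 1 + 2 * s ^ 2 = p * k := by
  have : Fact p.Prime := ⟨hp⟩
  have hp2 : p ≠ 2 := by rintro rfl; omega
  obtain ⟨r, hr⟩ := (ZMod.exists_sq_eq_neg_two_iff hp2).2 (Or.inr hp8)
  have h2 : (2 : ZMod p) ≠ 0 := by
    have := (ZMod.natCast_eq_zero_iff 2 p).not.2
      fun h => hp2 ((Nat.prime_dvd_prime_iff_eq hp Nat.prime_two).1 h)
    exact_mod_cast this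
  obtain ⟨s, hs⟩ := ZMod.intCast_surjective (r / 2)
  have hdvd : (p : ℤ) ∣ 1 + 2 * s ^ 2 := by
    rw [← ZMod.intCast_zmod_eq_zero_iff_dvd]
    push_cast
    rw [hs]
    field_simp
    linear_combination -hr
  exact ⟨s, hdvd⟩

theorem stmt_8 (p : ℕ) (hp : p.Prime) (hp8 : p % 8 = 3) :
    ∃ B T : Matrix (Fin (4 * (p - 1))) (Fin (4 * (p - 1))) ℤ,
      B.IsSymm ∧ (∀ i, Even (B i i)) ∧
      (∀ x : Fin (4 * (p - 1)) → ℤ, x ≠ 0 → 0 < x ⬝ᵥ B.mulVec x) ∧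
      B.det = 1 ∧ Tᵀ * B * T = B ∧
      T.charpoly = (cyclotomic p ℤ) ^ 2 * (cyclotomic (2 * p) ℤ) ^ 2 := by
  obtain ⟨s, k, hs⟩ := exists_two_mul_sq_add_one hp hp8
  obtain ⟨n, rfl⟩ := Nat.exists_eq_add_of_le' hp.one_le
  rw [Nat.add_sub_cancel]
  push_cast at hs
  have heven : Even n := by rw [Nat.even_iff]; omega
  have hodd : Odd (n + 1 : ℤ) := by exact_mod_cast heven.add_one
  have hpos : (0 : ℤ) < n + 1 := by positivity
  obtain ⟨B, hB⟩ := exists_smul_eq_glueBasis hs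
  have hBpos := pos_of_smul_eq hpos hB
    (by rw [det_glueBasis hp]; exact pow_ne_zero 2 hpos.ne')
    (fromBlocks_diag_pos (fromBlocks_diag_pos scaledDualGram_pos scaledDualGram_pos)
      (fromBlocks_diag_pos scaledDualGram_pos scaledDualGram_pos))
  have hBeven := even_diag_of_smul_eq hodd hB
    (fromBlocks_diag_even
      (fromBlocks_diag_even (scaledDualGram_even heven) (scaledDualGram_even heven))
      (fromBlocks_diag_even (scaledDualGram_even heven) (scaledDualGram_even heven)))
  let e : (Fin n ⊕ Fin n) ⊕ (Fin n ⊕ Fin n) ≃ Fin (4 * n) :=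
    Fintype.equivFinOfCardEq (by simp only [Fintype.card_sum, Fintype.card_fin]; ring)
  refine ⟨reindex e e B, reindex e e (latticeIsometry n), ?_, fun i => hBeven _, fun x hx => ?_,
    ?_, ?_, ?_⟩
  · exact (isSymm_of_smul_eq hpos.ne' hB (isSymm_fourfold_scaledDualGram n)).submatrix _
  · have hxe : x ∘ e ≠ 0 := fun h => hx <| by
      ext i
      simpa using congrFun h (e.symm i)
    have h := hBpos _ hxe
    rwa [reindex_apply, submatrix_mulVec_equiv, dotProduct_comp_equiv_symm]
  · rw [det_reindex_self, det_eq_one_of_smul_eq_glueBasis hp hB]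
  · simp only [reindex_apply, transpose_submatrix, submatrix_mul_equiv]
    rw [isometry_of_smul_eq hpos.ne' hB (glueBasis_mul_latticeIsometry n s)
      (ambientIsometry_isometry n)]
  · rw [charpoly_reindex, charpoly_latticeIsometry hp heven]
end

section
/- Let p and q be distinct prime numbers with p ≡ 3 (mod 4) and q ≡ 3 (mod 4), let n, m, t ≥ 1 be integers with m ≠ t, and set f = Φ_{pⁿ·qᵐ}·Φ_{pⁿ·qᵗ} ∈ ℤ[X] and N = deg f. If the Legendre symbol (p/q) equals 1, then there exist matrices B, T ∈ M_N(ℤ) such that: B is symmetric, every diagonal entry of B is even, xᵀ·B·x > 0 for every nonzero x ∈ ℤ^N, det B = 1, Tᵀ·B·T = B, and the characteristic polynomial of T equals f. -/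
open Polynomial Matrix

open scoped ComplexOrder in
/-- A self-dual lattice stable under an isometry `T` with characteristic polynomial `f` is even
unimodular when `f(1) = 1`; this gives its Gram matrix and the matrix of `T`. -/
theorem exists_gram_matrix_of_selfDual_lattice {E ι : Type*} [AddCommGroup E] [Module ℚ E]
    [FiniteDimensional ℚ E] [Fintype ι] (b : LinearMap.BilinForm ℚ E)
    (hsymm : ∀ x y, b x y = b y x) (hpos : ∀ x, x ≠ 0 → 0 < b x x)
    (φ : ι → E →+ ℂ) (hφ : ∀ x y, ((b x y : ℚ) : ℂ) = ∑ i, φ i x * star (φ i y))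
    (T : E →ₗ[ℚ] E) (hT : ∀ x y, b (T x) (T y) = b x y) (f : ℤ[X])
    (hf : T.charpoly = f.map (Int.castRingHom ℚ)) (hf1 : f.eval 1 = 1)
    (L : Submodule ℤ E) [Submodule.IsLattice ℚ L] (hTL : ∀ x ∈ L, T x ∈ L)
    (hint : ∀ x ∈ L, ∀ y ∈ L, ∃ k : ℤ, b x y = k)
    (hdual : ∀ y, (∀ x ∈ L, ∃ k : ℤ, b y x = k) → y ∈ L) :
    ∃ B A : Matrix (Fin f.natDegree) (Fin f.natDegree) ℤ,
      B.IsSymm ∧ (∀ i, Even (B i i)) ∧ (∀ x, x ≠ 0 → 0 < x ⬝ᵥ B.mulVec x) ∧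
      B.det = 1 ∧ Aᵀ * B * A = B ∧ A.charpoly = f := by
  have hinj : Function.Injective (Int.castRingHom ℚ) := (Int.castRingHom ℚ).injective_int
  have hN : Module.finrank ℤ L = f.natDegree := by
    rw [Module.finrank, Submodule.IsLattice.rank' ℚ L, ← Module.finrank, ← T.charpoly_natDegree, hf,
      natDegree_map_eq_of_injective hinj]
  let v : Module.Basis (Fin f.natDegree) ℤ L := Module.finBasisOfFinrankEq ℤ L hN
  let w : Module.Basis (Fin f.natDegree) ℚ E := v.extendOfIsLattice ℚ
  have hw : ∀ i, w i = (v i : E) := fun i => Module.Basis.extendOfIsLattice_apply ℚ v i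
  obtain ⟨B, hB⟩ : ∃ B : Matrix (Fin f.natDegree) (Fin f.natDegree) ℤ,
      ∀ i j, b (v i) (v j) = B i j := by
    choose B hB using fun i j => hint (v i) (v i).2 (v j) (v j).2
    exact ⟨Matrix.of B, hB⟩
  let TL : L →ₗ[ℤ] L := (T.restrictScalars ℤ).restrict hTL
  have hTLv : ∀ x : L, (TL x : E) = T x := fun x => rfl
  have hrepr : ∀ (x : L) (i), w.repr x i = (v.repr x i : ℚ) := by
    intro x i
    have h1 : (x : E) = ∑ j, ((v.repr x j : ℤ) : ℚ) • w j := by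
      conv_lhs => rw [← v.sum_repr x]
      rw [AddSubmonoidClass.coe_finsetSum]
      refine Finset.sum_congr rfl fun j _ => ?_
      rw [hw, Int.cast_smul_eq_zsmul]; rfl
    conv_lhs => rw [h1]
    rw [w.repr_sum_self]
  let A : Matrix (Fin f.natDegree) (Fin f.natDegree) ℤ := LinearMap.toMatrix v v TL
  have hA : A.map (Int.castRingHom ℚ) = LinearMap.toMatrix w w T := by
    ext i j
    simp only [A, Matrix.map_apply, LinearMap.toMatrix_apply, hw, ← hTLv, hrepr]
    rfl
  have hAf : A.charpoly = f := by
    apply Polynomial.map_injective _ hinj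
    rw [← Matrix.charpoly_map, hA, LinearMap.charpoly_toMatrix, hf]
  have hgram : B.map (Int.castRingHom ℚ) = LinearMap.BilinForm.toMatrix w b := by
    ext i j
    simp [LinearMap.BilinForm.toMatrix_apply, hw, hB]
  have hquad : ∀ x y : Fin f.natDegree → ℤ,
      ((x ⬝ᵥ B.mulVec y : ℤ) : ℚ) = b (∑ i, (x i : ℚ) • w i) (∑ i, (y i : ℚ) • w i) := by
    intro x y
    simp only [map_sum, map_smul, LinearMap.sum_apply, LinearMap.smul_apply, hw, hB, dotProduct,
      mulVec, Int.cast_sum, Int.cast_mul, Finset.mul_sum, smul_eq_mul]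
    rw [Finset.sum_comm]
    exact Finset.sum_congr rfl fun i _ => Finset.sum_congr rfl fun j _ => by ring
  refine ⟨B, A, ?_, ?_, ?_, ?_, ?_, hAf⟩
  · ext i j
    have := hsymm (v j) (v i)
    rw [hB, hB] at this
    exact_mod_cast this
  · intro i
    have hCH : aeval TL f = 0 := by
      have : TL.charpoly = f := by rw [← LinearMap.charpoly_toMatrix TL v]; exact hAf
      rw [← this]; exact LinearMap.aeval_self_charpoly TL
    obtain ⟨g, hg⟩ : (X - C 1) ∣ f - C 1 := by
      rw [dvd_iff_isRoot]; simp [hf1]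
    have h1 : v i = TL (-(aeval TL g (v i))) - (-(aeval TL g (v i))) := by
      have h2 := congrArg (fun h => aeval TL h (v i)) hg
      simp only [map_sub, map_mul, hCH, aeval_X, LinearMap.sub_apply, map_one,
        Module.End.mul_apply, Module.End.one_apply, LinearMap.zero_apply] at h2
      rw [map_neg, sub_neg_eq_add, neg_add_eq_sub, ← neg_sub, ← h2]; simp
    set y : L := -(aeval TL g (v i)) with hy
    have h3 : (v i : E) = T y - y := by rw [h1]; rfl
    obtain ⟨k, hk⟩ := hint y y.2 y y.2
    obtain ⟨l, hl⟩ := hint (T y) (hTL y y.2) y y.2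
    have h4 : ((B i i : ℤ) : ℚ) = 2 * k - 2 * l := by
      rw [← hB, h3]
      simp only [map_sub, LinearMap.sub_apply, hT, hk, hl, hsymm y (T y)]
      ring
    refine ⟨k - l, ?_⟩
    have : B i i = 2 * k - 2 * l := by exact_mod_cast h4
    omega
  · intro x hx
    have h := hpos (∑ i, (x i : ℚ) • w i) (by
      intro h0
      apply hx
      funext i
      exact_mod_cast (Fintype.linearIndependent_iff.mp w.linearIndependent _ h0 i))
    rw [← hquad] at h
    exact_mod_cast h
  · have hnd : ∀ y : Fin f.natDegree → ℚ,
        (LinearMap.BilinForm.toMatrix w b).mulVec y = 0 → y = 0 := by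
      intro y hy
      by_contra hne
      have h1 := hpos (∑ i, y i • w i) (by
        intro h0
        exact hne (funext fun i => Fintype.linearIndependent_iff.mp w.linearIndependent _ h0 i))
      have h2 : b (∑ i, y i • w i) (∑ i, y i • w i)
          = y ⬝ᵥ (LinearMap.BilinForm.toMatrix w b).mulVec y := by
        simp only [map_sum, map_smul, LinearMap.sum_apply, LinearMap.smul_apply, dotProduct,
          mulVec, Finset.mul_sum, smul_eq_mul, LinearMap.BilinForm.toMatrix_apply]
        rw [Finset.sum_comm]
        exact Finset.sum_congr rfl fun i _ => Finset.sum_congr rfl fun j _ => by ring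
      rw [h2, hy, dotProduct_zero] at h1
      exact lt_irrefl _ h1
    have hunit : IsUnit (LinearMap.BilinForm.toMatrix w b).det := by
      rw [← Matrix.isUnit_iff_isUnit_det, ← Matrix.mulVec_injective_iff_isUnit]
      intro x y hxy
      rw [← sub_eq_zero]
      apply hnd
      rw [Matrix.mulVec_sub, hxy, sub_self]
    set M := LinearMap.BilinForm.toMatrix w b with hM
    have hd : ∀ i, ∑ j, M⁻¹ i j • w j ∈ L := by
      intro i
      apply hdual
      have h1 : ∀ k, b (∑ j, M⁻¹ i j • w j) (w k) = if i = k then 1 else 0 := by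
        intro k
        have h2 : (M⁻¹ * M) i k = (1 : Matrix _ _ ℚ) i k := by rw [Matrix.nonsing_inv_mul _ hunit]
        rw [Matrix.mul_apply, Matrix.one_apply] at h2
        rw [← h2]
        simp [M, LinearMap.BilinForm.toMatrix_apply]
      intro x hx
      refine ⟨v.repr ⟨x, hx⟩ i, ?_⟩
      generalize ∑ j, M⁻¹ i j • w j = z at h1 ⊢
      conv_lhs => rw [← w.sum_repr x]
      simp only [map_sum, map_smul, h1, smul_eq_mul, mul_ite, mul_one, mul_zero]
      rw [Finset.sum_ite_eq Finset.univ i, if_pos (Finset.mem_univ i)]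
      exact hrepr ⟨x, hx⟩ i
    have hCM : (Matrix.of fun i j => v.repr ⟨_, hd i⟩ j).map (Int.castRingHom ℚ) = M⁻¹ := by
      ext i j
      simp only [Matrix.map_apply, Matrix.of_apply]
      have := hrepr ⟨_, hd i⟩ j
      rw [w.repr_sum_self] at this
      exact this.symm
    have hBC : (Matrix.of fun i j => v.repr ⟨_, hd i⟩ j) * B = 1 := by
      apply Matrix.map_injective hinj
      beta_reduce
      rw [Matrix.map_mul, hCM, hgram, Matrix.nonsing_inv_mul _ hunit]
      simp
    have hBu : IsUnit B.det := by
      have := congrArg Matrix.det hBC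
      rw [Matrix.det_mul, Matrix.det_one] at this
      exact IsUnit.of_mul_eq_one_right _ this
    have hBn : 0 ≤ B.det := by
      let W : Matrix (Fin f.natDegree) ι ℂ := Matrix.of fun i k => φ k (w i)
      have h1 : B.map (Int.castRingHom ℂ) = W * Wᴴ := by
        ext i j
        have h2 := hφ (w i) (w j)
        rw [hw, hw, hB, ← hw, ← hw] at h2
        simpa [Matrix.mul_apply, W] using h2
      have h3 := (Matrix.posSemidef_self_mul_conjTranspose W).det_nonneg
      rw [← h1, ← RingHom.mapMatrix_apply, ← RingHom.map_det] at h3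
      simpa using h3
    rcases Int.isUnit_iff.mp hBu with h | h
    · exact h
    · omega
  · apply Matrix.map_injective hinj
    beta_reduce
    rw [Matrix.map_mul, Matrix.map_mul, Matrix.transpose_map, hA, hgram]
    rw [← LinearMap.BilinForm.toMatrix_comp]
    congr 1
    ext x y
    exact hT x y

/-- The integers, as a subring of `ℚ`. -/
def integerSubring : Subring ℚ := (Int.castRingHom ℚ).range

theorem mem_integerSubring {x : ℚ} : x ∈ integerSubring ↔ ∃ k : ℤ, x = k :=
  ⟨fun ⟨k, hk⟩ => ⟨k, hk.symm⟩, fun ⟨k, hk⟩ => ⟨k, hk.symm⟩⟩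

section SelfDual

variable {E : Type*} [CommRing E]

/-- The Hermitian form `tr (x * conj y)` takes integral values on `L`. -/
def IsIntegralOn (conj : E →+* E) (tr : E →+ ℚ) {S : Subring E} (L : Submodule S E) : Prop :=
  ∀ x ∈ L, ∀ y ∈ L, tr (x * conj y) ∈ integerSubring

variable {conj : E →+* E} {tr : E →+ ℚ} {S : Subring E}

theorem exists_maximal_isIntegralOn {L₀ : Submodule S E} (h₀ : IsIntegralOn conj tr L₀) :
    ∃ L, L₀ ≤ L ∧ Maximal (IsIntegralOn conj tr) L := by
  refine zorn_le_nonempty₀ {L | IsIntegralOn conj tr L} ?_ L₀ h₀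
  intro c hc hchain L hL
  refine ⟨sSup c, ?_, fun z hz => le_sSup hz⟩
  intro x hx y hy
  rw [Submodule.mem_sSup_of_directed ⟨L, hL⟩ hchain.directedOn] at hx hy
  obtain ⟨A, hA, hxA⟩ := hx
  obtain ⟨B, hB, hyB⟩ := hy
  rcases hchain.total hA hB with h | h
  · exact hc hB x (h hxA) y hyB
  · exact hc hA x hxA y (h hyB)

theorem isIntegralOn_span (hS : ∀ s ∈ S, conj s ∈ S) {A : Set E}
    (h : ∀ x ∈ A, ∀ y ∈ A, ∀ s ∈ S, tr (s * x * conj y) ∈ integerSubring) :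
    IsIntegralOn conj tr (Submodule.span S A) := by
  have key : ∀ x ∈ Submodule.span S A, ∀ y ∈ A, ∀ s ∈ S,
      tr (s * x * conj y) ∈ integerSubring := by
    intro x hx y hy
    induction hx using Submodule.span_induction with
    | mem x hx => exact h x hx y hy
    | zero => intro s _; simp [zero_mem]
    | add a b _ _ ha hb =>
      intro s hs
      rw [mul_add, add_mul, map_add]
      exact add_mem (ha s hs) (hb s hs)
    | smul r a _ ha =>
      intro s hs
      have := ha (s * r) (mul_mem hs r.2)
      rwa [show s * r • a * conj y = s * r * a * conj y by rw [Subring.smul_def, smul_eq_mul]; ring]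
  intro x hx y hy
  suffices ∀ s ∈ S, tr (s * x * conj y) ∈ integerSubring by simpa using this 1 (one_mem _)
  induction hy using Submodule.span_induction with
  | mem y hy => exact key x hx y hy
  | zero => intro s _; simp [zero_mem]
  | add a b _ _ ha hb =>
    intro s hs
    rw [map_add, mul_add, map_add]
    exact add_mem (ha s hs) (hb s hs)
  | smul r a _ ha =>
    intro s hs
    have := ha (s * conj r) (mul_mem hs (hS _ r.2))
    rwa [show s * x * conj (r • a) = s * conj r * x * conj a by
      rw [Subring.smul_def, smul_eq_mul, map_mul]; ring]

theorem Maximal.sqrt_sub_mul_mem (conj_conj : ∀ x, conj (conj x) = x)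
    (tr_conj : ∀ x, tr (conj x) = tr x) (hS : ∀ s ∈ S, conj s ∈ S)
    {L : Submodule S E} (hL : Maximal (IsIntegralOn conj tr) L) {p q : ℕ} {H : E} (hHS : H ∈ S)
    (hH : conj H = -H) (hH2 : H ^ 2 = -(q : E)) {s : ℤ} (hs : (p : ℤ) ∣ s ^ 2 + q)
    {y : E} (hy : ∀ x ∈ L, tr (y * conj x) ∈ integerSubring) (hpy : (p : E) * y ∈ L) :
    (H - s) * y ∈ L := by
  have smul_mem : ∀ r ∈ S, ∀ x ∈ L, r * x ∈ L := fun r hr x hx => L.smul_mem ⟨r, hr⟩ hx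
  have hsS : H - s ∈ S := sub_mem hHS (intCast_mem S s)
  obtain ⟨k, hk⟩ := hs
  have hk' : (s : E) ^ 2 + q = p * k := by exact_mod_cast congrArg (Int.cast : ℤ → E) hk
  have hle : L ≤ L ⊔ Submodule.span S {(H - s) * y} := le_sup_left
  have hmem : (H - s) * y ∈ L ⊔ Submodule.span S {(H - s) * y} :=
    Submodule.mem_sup_right (Submodule.mem_span_singleton_self _)
  have hcross : ∀ r ∈ S, ∀ x ∈ L, tr (r * ((H - s) * y) * conj x) ∈ integerSubring := by
    intro r hr x hx
    have := hy (conj r * (conj (H - s) * x))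
      (smul_mem _ (hS r hr) _ (smul_mem _ (hS _ hsS) _ hx))
    rwa [map_mul conj, map_mul conj, conj_conj, conj_conj,
      show y * (r * ((H - s) * conj x)) = r * ((H - s) * y) * conj x by ring] at this
  refine hL.2 (y := L ⊔ Submodule.span S {(H - s) * y}) ?_ hle hmem
  intro a ha b hb
  obtain ⟨l, hl, c, hc, rfl⟩ := Submodule.mem_sup.mp ha
  obtain ⟨l', hl', c', hc', rfl⟩ := Submodule.mem_sup.mp hb
  obtain ⟨r, rfl⟩ := Submodule.mem_span_singleton.mp hc
  obtain ⟨r', rfl⟩ := Submodule.mem_span_singleton.mp hc'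
  simp only [Subring.smul_def, smul_eq_mul]
  rw [map_add, add_mul, mul_add, mul_add, map_add, map_add, map_add]
  refine add_mem (add_mem (hL.1 _ hl _ hl') ?_) (add_mem (hcross _ r.2 _ hl') ?_)
  · rw [← tr_conj, map_mul, conj_conj, mul_comm]
    exact hcross _ r'.2 _ hl
  · have h1 := hy _ (smul_mem _ (mul_mem (mul_mem (intCast_mem S k) (hS r r.2)) r'.2) _ hpy)
    convert h1 using 2
    simp only [map_mul, map_sub, map_intCast, map_natCast, hH, conj_conj]
    linear_combination ((r : E) * conj r' * y * conj y) * hk' -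
      ((r : E) * conj r' * y * conj y) * hH2

theorem exists_selfDual (conj_conj : ∀ x, conj (conj x) = x)
    (tr_conj : ∀ x, tr (conj x) = tr x) (hS : ∀ s ∈ S, conj s ∈ S)
    {L₀ : Submodule S E} (h₀ : IsIntegralOn conj tr L₀)
    {p q n : ℕ} (hp : p.Prime) (hp2 : p ≠ 2) {H : E} (hHS : H ∈ S)
    (hH : conj H = -H) (hH2 : H ^ 2 = -(q : E)) {s : ℤ} (hs : (p : ℤ) ∣ s ^ 2 + q)
    (hps : ¬ (p : ℤ) ∣ s)
    (hdual : ∀ y, (∀ x ∈ L₀, tr (y * conj x) ∈ integerSubring) → (p : E) ^ n * y ∈ L₀) :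
    ∃ L, L₀ ≤ L ∧ IsIntegralOn conj tr L ∧
      ∀ y, (∀ x ∈ L, tr (y * conj x) ∈ integerSubring) → y ∈ L := by
  obtain ⟨L, hle, hL⟩ := exists_maximal_isIntegralOn h₀
  refine ⟨L, hle, hL.1, ?_⟩
  have smul_mem : ∀ r ∈ S, ∀ x ∈ L, r * x ∈ L := fun r hr x hx => L.smul_mem ⟨r, hr⟩ hx
  have step : ∀ y, (∀ x ∈ L, tr (y * conj x) ∈ integerSubring) → (p : E) * y ∈ L → y ∈ L := by
    intro y hy hpy
    have h1 := hL.sqrt_sub_mul_mem conj_conj tr_conj hS hHS hH hH2 hs hy hpy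
    have h2 := hL.sqrt_sub_mul_mem conj_conj tr_conj hS (neg_mem hHS) (by rw [map_neg, hH])
      (by rw [neg_sq, hH2]) hs hy hpy
    have h3 : ((2 * s : ℤ) : E) * y ∈ L := by
      have := neg_mem (add_mem h1 h2)
      convert this using 1
      push_cast; ring
    have hcop : IsCoprime (p : ℤ) (2 * s) := by
      rw [Prime.coprime_iff_not_dvd (Nat.prime_iff_prime_int.mp hp),
        (Nat.prime_iff_prime_int.mp hp).dvd_mul, not_or]
      refine ⟨fun h => hp2 ?_, hps⟩
      exact (Nat.prime_dvd_prime_iff_eq hp Nat.prime_two).mp (by exact_mod_cast h)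
    obtain ⟨a, b, hab⟩ := hcop
    have hab' : (a : E) * p + b * ((2 * s : ℤ) : E) = 1 := by
      exact_mod_cast congrArg (Int.cast : ℤ → E) hab
    have := add_mem (smul_mem _ (intCast_mem S a) _ hpy) (smul_mem _ (intCast_mem S b) _ h3)
    convert this using 1
    linear_combination -y * hab'
  intro y hy
  have hpow : ∀ k : ℕ, (p : E) ^ k * y ∈ L → y ∈ L := by
    intro k
    induction k with
    | zero => simp
    | succ k ih =>
      intro h
      apply ih
      apply step
      · intro x hx
        have := hy ((p : E) ^ k * x) (smul_mem _ (pow_mem (natCast_mem S p) k) _ hx)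
        rw [map_mul conj, map_pow, map_natCast] at this
        rwa [show (p : E) ^ k * y * conj x = y * ((p : E) ^ k * conj x) by ring]
      · rwa [← mul_assoc, ← pow_succ']
  exact hpow n (hle (hdual y fun x hx => hy x (hle hx)))

end SelfDual

theorem aeval_mem_subalgebra {K : Type*} [CommRing K] {O : Subalgebra ℤ K} {ω : K} (hω : ω ∈ O)
    (P : ℤ[X]) : aeval ω P ∈ O := by
  rw [← aeval_subalgebra_coe P O ⟨ω, hω⟩]
  exact SetLike.coe_mem _

/-- The ring `O` generated by a root of unity `ζ` of order `N = p ^ n * q ^ m` in a number field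
`K`, with the arithmetic of its trace form at `p` and `q`: `ξ` is the `p`-part of `ζ`, `π`
generates the radical of `q`, and `e * O` is the dual of `π * e * O` up to `p ^ n`. -/
structure GlueData (p q n N : ℕ) (G : ℤ[X]) (τ : ℤ[X] → ℤ) (K : Type*) [Field K]
    [NumberField K] where
  /-- the order generated by `ζ` -/
  O : Subalgebra ℤ K
  fg : (Subalgebra.toSubmodule O).FG
  exists_int_mul_mem : ∀ x : K, ∃ k : ℤ, k ≠ 0 ∧ (k : K) * x ∈ O
  /-- complex conjugation -/
  conj : K →+* K
  embedding_conj : ∀ (φ : K →+* ℂ) (x : K), φ (conj x) = star (φ x)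
  conj_mem : ∀ x ∈ O, conj x ∈ O
  /-- a root of unity of order `N` -/
  ζ : K
  /-- the `p`-part of `ζ` -/
  ξ : K
  /-- the uniformizer at `q` -/
  π : K
  /-- a generator of the dual lattice -/
  e : K
  /-- a square root of `-q` -/
  H : K
  /-- the numerator of the trace of `e * conj e` -/
  c : ℤ
  ξ_mem : ξ ∈ O
  π_mem : π ∈ O
  π_ne : π ≠ 0
  e_ne : e ≠ 0
  ζ_mul_conj : ζ * conj ζ = 1
  charpoly_ζ : (LinearMap.mulLeft ℚ ζ).charpoly = (cyclotomic N ℤ).map (Int.castRingHom ℚ)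
  conj_ξ : conj ξ = ξ ^ (p ^ n - 1)
  conj_π : ∃ ν ∈ O, conj π = π * ν
  ζ_eq : ∃ w ∈ O, ζ = ξ + π * w
  exists_residue : ∀ x ∈ O, ∃ P : ℤ[X], ∃ w ∈ O, x = aeval ξ P + π * w
  H_eq : ∃ w ∈ O, H = π * w
  H_sq : H ^ 2 = -(q : K)
  conj_H : conj H = -H
  aeval_G_sq : (aeval ξ G) ^ 2 = -(p : K)
  conj_aeval_G : conj (aeval ξ G) = -aeval ξ G
  trace_mem : ∀ x ∈ O, Algebra.trace ℚ K (e * conj e * π * x) ∈ integerSubring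
  mem_of_trace_mem : ∀ y, (∀ x ∈ O, Algebra.trace ℚ K (y * x) ∈ integerSubring) →
    ∃ w ∈ O, (p : K) ^ n * y = e * conj e * π * w
  c_not_dvd : ¬ (q : ℤ) ∣ c
  trace_eq : ∀ P : ℤ[X], Algebra.trace ℚ K (e * conj e * aeval ξ P) = c * τ P / q

namespace GlueData

section Single

variable {p q n N : ℕ} {G : ℤ[X]} {τ : ℤ[X] → ℤ} {K : Type*} [Field K] [NumberField K]
  (D : GlueData p q n N G τ K)

theorem conj_conj (x : K) : D.conj (D.conj x) = x := by
  obtain ⟨φ⟩ : Nonempty (K →+* ℂ) := inferInstance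
  apply φ.injective
  rw [D.embedding_conj, D.embedding_conj, star_star]

theorem trace_mul_conj (x y : K) : ((Algebra.trace ℚ K (x * D.conj y) : ℚ) : ℂ) =
    ∑ φ : K →+* ℂ, φ x * star (φ y) := by
  have h := trace_eq_sum_embeddings ℂ (K := ℚ) (x := x * D.conj y)
  rw [eq_ratCast] at h
  rw [h, ← (RingHom.equivRatAlgHom (R := K) (S := ℂ)).sum_comp]
  refine Finset.sum_congr rfl fun φ _ => ?_
  simp [RingHom.equivRatAlgHom, D.embedding_conj]

theorem trace_conj (x : K) : Algebra.trace ℚ K (D.conj x) = Algebra.trace ℚ K x := by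
  have h1 := D.trace_mul_conj 1 x
  have h2 := D.trace_mul_conj x 1
  simp only [map_one, one_mul, mul_one, star_one] at h1 h2
  have h3 : star ((Algebra.trace ℚ K (D.conj x) : ℚ) : ℂ) = ((Algebra.trace ℚ K x : ℚ) : ℂ) := by
    rw [h1, h2, star_sum]; simp
  have h4 : star ((Algebra.trace ℚ K (D.conj x) : ℚ) : ℂ) =
      ((Algebra.trace ℚ K (D.conj x) : ℚ) : ℂ) := by
    rw [Complex.star_def, Complex.conj_eq_iff_real]
    exact ⟨((Algebra.trace ℚ K (D.conj x) : ℚ) : ℝ), by simp⟩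
  rw [h4] at h3
  exact_mod_cast h3

theorem trace_mul_conj_pos {x : K} (hx : x ≠ 0) : 0 < Algebra.trace ℚ K (x * D.conj x) := by
  have h : ((Algebra.trace ℚ K (x * D.conj x) : ℚ) : ℂ) =
      ((∑ φ : K →+* ℂ, Complex.normSq (φ x) : ℝ) : ℂ) := by
    rw [D.trace_mul_conj, Complex.ofReal_sum]
    exact Finset.sum_congr rfl fun φ _ => Complex.mul_conj _
  have h' : ((Algebra.trace ℚ K (x * D.conj x) : ℚ) : ℝ) = ∑ φ : K →+* ℂ, Complex.normSq (φ x) := by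
    exact_mod_cast h
  have : (0 : ℝ) < ((Algebra.trace ℚ K (x * D.conj x) : ℚ) : ℝ) := by
    rw [h']
    refine Finset.sum_pos (fun φ _ => Complex.normSq_pos.mpr ?_) Finset.univ_nonempty
    exact (map_ne_zero φ).mpr hx
  exact_mod_cast this

theorem trace_mul_conj_nonneg (x : K) : 0 ≤ Algebra.trace ℚ K (x * D.conj x) := by
  rcases eq_or_ne x 0 with rfl | hx
  · simp
  · exact (D.trace_mul_conj_pos hx).le

/-- `x ∈ O` reduces to `P(ξ)` modulo `π`. -/
def ReducesTo (x : K) (P : ℤ[X]) : Prop := ∃ w ∈ D.O, x = aeval D.ξ P + D.π * w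

theorem aeval_mem (P : ℤ[X]) : aeval D.ξ P ∈ D.O :=
  aeval_mem_subalgebra D.ξ_mem P

variable {D}

theorem ReducesTo.mem {x : K} {P : ℤ[X]} (h : D.ReducesTo x P) : x ∈ D.O := by
  obtain ⟨w, hw, rfl⟩ := h
  exact add_mem (D.aeval_mem P) (mul_mem D.π_mem hw)

theorem ReducesTo.add {x y : K} {P Q : ℤ[X]} (hx : D.ReducesTo x P) (hy : D.ReducesTo y Q) :
    D.ReducesTo (x + y) (P + Q) := by
  obtain ⟨w, hw, rfl⟩ := hx
  obtain ⟨v, hv, rfl⟩ := hy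
  exact ⟨w + v, add_mem hw hv, by rw [map_add]; ring⟩

theorem ReducesTo.neg {x : K} {P : ℤ[X]} (hx : D.ReducesTo x P) : D.ReducesTo (-x) (-P) := by
  obtain ⟨w, hw, rfl⟩ := hx
  exact ⟨-w, neg_mem hw, by rw [map_neg]; ring⟩

theorem ReducesTo.mul {x y : K} {P Q : ℤ[X]} (hx : D.ReducesTo x P) (hy : D.ReducesTo y Q) :
    D.ReducesTo (x * y) (P * Q) := by
  have hy' := hy.mem
  obtain ⟨w, hw, rfl⟩ := hx
  obtain ⟨v, hv, rfl⟩ := hy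
  exact ⟨aeval D.ξ P * v + w * (aeval D.ξ Q + D.π * v),
    add_mem (mul_mem (D.aeval_mem P) hv) (mul_mem hw hy'), by rw [map_mul]; ring⟩

theorem ReducesTo.conj {x : K} {P : ℤ[X]} (hx : D.ReducesTo x P) :
    D.ReducesTo (D.conj x) (P.comp (X ^ (p ^ n - 1))) := by
  obtain ⟨w, hw, rfl⟩ := hx
  obtain ⟨ν, hν, h⟩ := D.conj_π
  refine ⟨ν * D.conj w, mul_mem hν (D.conj_mem w hw), ?_⟩
  have h1 : D.conj (aeval D.ξ P) = aeval (D.conj D.ξ) P := by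
    rw [aeval_def, hom_eval₂, aeval_def]
    congr 1
    exact RingHom.ext_int _ _
  rw [map_add, map_mul, h, h1, aeval_comp, map_pow, aeval_X, D.conj_ξ]
  ring

theorem reducesTo_aeval (P : ℤ[X]) : D.ReducesTo (aeval D.ξ P) P := ⟨0, zero_mem _, by simp⟩

variable (D)

theorem trace_mul_mem {x : K} (hx : x ∈ D.O) :
    Algebra.trace ℚ K (D.e * D.conj D.e * (D.π * x)) ∈ integerSubring := by
  rw [← mul_assoc]; exact D.trace_mem x hx

theorem q_eq : ∃ w ∈ D.O, (q : K) = D.π * w := by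
  obtain ⟨w, hw, h⟩ := D.H_eq
  refine ⟨-(w * D.H), neg_mem (mul_mem hw (h ▸ mul_mem D.π_mem hw)), ?_⟩
  rw [← neg_neg (q : K), ← D.H_sq]
  linear_combination (-D.H) * h

/-- An element pairing integrally with `π * e * O` lies in `e * O` up to `p ^ n`. -/
theorem exists_mul_e {y : K}
    (hy : ∀ x ∈ D.O, Algebra.trace ℚ K (x * y * D.conj (D.π * D.e)) ∈ integerSubring) :
    ∃ w ∈ D.O, (p : K) ^ n * y = w * D.e := by
  obtain ⟨w, hw, h⟩ := D.mem_of_trace_mem (y * D.conj (D.π * D.e)) fun x hx => by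
    rw [show y * D.conj (D.π * D.e) * x = x * y * D.conj (D.π * D.e) by ring]; exact hy x hx
  obtain ⟨ν, hν, h2⟩ := D.conj_π
  have hν' : D.π = D.conj D.π * D.conj ν := by rw [← map_mul, ← h2, D.conj_conj]
  have hce : D.conj D.e ≠ 0 := (map_ne_zero D.conj).mpr D.e_ne
  have hcπ : D.conj D.π ≠ 0 := (map_ne_zero D.conj).mpr D.π_ne
  refine ⟨D.conj ν * w, mul_mem (D.conj_mem ν hν) hw, ?_⟩
  apply mul_right_cancel₀ (mul_ne_zero hcπ hce)
  rw [map_mul] at h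
  linear_combination h + (D.e * D.conj D.e * w) * hν'

end Single

section Pair

variable {p q n N₁ N₂ : ℕ} {G : ℤ[X]} {τ : ℤ[X] → ℤ} {K₁ K₂ : Type*} [Field K₁] [NumberField K₁]
  [Field K₂] [NumberField K₂] (D₁ : GlueData p q n N₁ G τ K₁) (D₂ : GlueData p q n N₂ G τ K₂)

/-- Complex conjugation on the product. -/
def conjProd : K₁ × K₂ →+* K₁ × K₂ := RingHom.prodMap D₁.conj D₂.conj

theorem conjProd_apply (x : K₁ × K₂) : conjProd D₁ D₂ x = (D₁.conj x.1, D₂.conj x.2) := rfl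

/-- The trace of the product algebra. -/
noncomputable def traceProd (K₁ K₂ : Type*) [Field K₁] [NumberField K₁] [Field K₂]
    [NumberField K₂] :
    K₁ × K₂ →ₗ[ℚ] ℚ :=
  (Algebra.trace ℚ K₁).coprod (Algebra.trace ℚ K₂)

/-- Pairs with the same reduction modulo `π₁` and `π₂`. -/
def glueSubring : Subring (K₁ × K₂) where
  carrier := {x | ∃ P, D₁.ReducesTo x.1 P ∧ D₂.ReducesTo x.2 P}
  mul_mem' := fun ⟨P, h₁, h₂⟩ ⟨Q, g₁, g₂⟩ => ⟨P * Q, h₁.mul g₁, h₂.mul g₂⟩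
  add_mem' := fun ⟨P, h₁, h₂⟩ ⟨Q, g₁, g₂⟩ => ⟨P + Q, h₁.add g₁, h₂.add g₂⟩
  neg_mem' := fun ⟨P, h₁, h₂⟩ => ⟨-P, h₁.neg, h₂.neg⟩
  one_mem' := ⟨1, ⟨0, zero_mem _, by simp⟩, ⟨0, zero_mem _, by simp⟩⟩
  zero_mem' := ⟨0, ⟨0, zero_mem _, by simp⟩, ⟨0, zero_mem _, by simp⟩⟩

/-- The glue vector attached to `a + b √-p`. -/
noncomputable def glueVector (a b : ℤ) : K₁ × K₂ := (D₁.e, (a + b * aeval D₂.ξ G) * D₂.e)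

/-- The lattice generated by `π₁ e₁`, `π₂ e₂` and the glue vector. -/
noncomputable def glueLattice (a b : ℤ) : Submodule (glueSubring D₁ D₂) (K₁ × K₂) :=
  Submodule.span _ {(D₁.π * D₁.e, 0), (0, D₂.π * D₂.e), glueVector D₁ D₂ a b}

theorem conj_mem_glueSubring {s : K₁ × K₂} (hs : s ∈ glueSubring D₁ D₂) :
    conjProd D₁ D₂ s ∈ glueSubring D₁ D₂ := by
  obtain ⟨P, h₁, h₂⟩ := hs
  exact ⟨_, h₁.conj, h₂.conj⟩

theorem conjProd_conjProd (x : K₁ × K₂) : conjProd D₁ D₂ (conjProd D₁ D₂ x) = x :=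
  Prod.ext (D₁.conj_conj _) (D₂.conj_conj _)

theorem traceProd_conjProd (x : K₁ × K₂) :
    traceProd K₁ K₂ (conjProd D₁ D₂ x) = traceProd K₁ K₂ x := by
  simp [traceProd, conjProd_apply, D₁.trace_conj, D₂.trace_conj]

theorem norm_glue (a b : ℤ) : (a + b * aeval D₂.ξ G) * D₂.conj (a + b * aeval D₂.ξ G) =
    ((a ^ 2 + p * b ^ 2 : ℤ) : K₂) := by
  rw [map_add, map_mul, map_intCast, map_intCast, D₂.conj_aeval_G]
  push_cast
  linear_combination (-b ^ 2 : K₂) * D₂.aeval_G_sq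

variable {D₁ D₂}

theorem isIntegralOn_glueLattice [Fact q.Prime] {a b : ℤ}
    (hab : (q : ℤ) ∣ D₁.c + (a ^ 2 + p * b ^ 2) * D₂.c) :
    IsIntegralOn (conjProd D₁ D₂) (traceProd K₁ K₂).toAddMonoidHom (glueLattice D₁ D₂ a b) := by
  have hq : (q : ℚ) ≠ 0 := Nat.cast_ne_zero.mpr (Fact.out : q.Prime).ne_zero
  have hu : (a + b * aeval D₂.ξ G : K₂) ∈ D₂.O :=
    add_mem (intCast_mem _ a) (mul_mem (intCast_mem _ b) (D₂.aeval_mem G))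
  obtain ⟨ν₁, hν₁, hπ₁⟩ := D₁.conj_π
  obtain ⟨ν₂, hν₂, hπ₂⟩ := D₂.conj_π
  have hcu := D₂.conj_mem _ hu
  refine isIntegralOn_span (fun s => conj_mem_glueSubring D₁ D₂) ?_
  rintro x hx y hy s ⟨P, hs₁, hs₂⟩
  have m₁ := hs₁.mem
  have m₂ := hs₂.mem
  change traceProd K₁ K₂ _ ∈ _
  rcases hx with rfl | rfl | rfl <;> rcases hy with rfl | rfl | rfl <;>
    simp only [traceProd, conjProd_apply, glueVector, LinearMap.coprod_apply, Prod.fst_mul,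
      Prod.snd_mul,
      map_zero, mul_zero, zero_mul, add_zero, zero_add,
      zero_mem]
  · convert D₁.trace_mul_mem (mul_mem (mul_mem m₁ D₁.π_mem) hν₁) using 2
    rw [map_mul, hπ₁]; ring
  · convert D₁.trace_mul_mem m₁ using 2
    ring
  · convert D₂.trace_mul_mem (mul_mem (mul_mem m₂ D₂.π_mem) hν₂) using 2
    rw [map_mul, hπ₂]; ring
  · convert D₂.trace_mul_mem (mul_mem m₂ hcu) using 2
    rw [map_mul]; ring
  · convert D₁.trace_mul_mem (mul_mem m₁ hν₁) using 2
    rw [map_mul, hπ₁]; ring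
  · convert D₂.trace_mul_mem (mul_mem (mul_mem m₂ hu) hν₂) using 2
    rw [map_mul, hπ₂]; ring
  · obtain ⟨w₁, hw₁, e₁⟩ := hs₁
    obtain ⟨w₂, hw₂, e₂⟩ := hs₂
    obtain ⟨k, hk⟩ := hab
    have hk' : (D₁.c : ℚ) + (a ^ 2 + p * b ^ 2) * D₂.c = q * k := by exact_mod_cast hk
    have t₁ : Algebra.trace ℚ K₁ (s.1 * D₁.e * D₁.conj D₁.e) =
        D₁.c * τ P / q + Algebra.trace ℚ K₁ (D₁.e * D₁.conj D₁.e * (D₁.π * w₁)) := by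
      rw [← D₁.trace_eq, ← map_add, e₁]
      congr 1
      ring
    have t₂ : Algebra.trace ℚ K₂ (s.2 * ((a + b * aeval D₂.ξ G) * D₂.e) *
        D₂.conj ((a + b * aeval D₂.ξ G) * D₂.e)) =
        (a ^ 2 + p * b ^ 2 : ℤ) * (D₂.c * τ P / q) +
          (a ^ 2 + p * b ^ 2 : ℤ) * Algebra.trace ℚ K₂ (D₂.e * D₂.conj D₂.e * (D₂.π * w₂)) := by
      have hk (j : ℤ) (z : K₂) : (j : ℚ) * Algebra.trace ℚ K₂ z = Algebra.trace ℚ K₂ (j * z) := by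
        rw [← zsmul_eq_mul, ← map_zsmul, zsmul_eq_mul]
      rw [← D₂.trace_eq, ← mul_add, ← map_add, hk, ← norm_glue D₂ a b, e₂]
      congr 1
      rw [map_mul]
      ring
    rw [t₁, t₂]
    have : (D₁.c * τ P / q : ℚ) + Algebra.trace ℚ K₁ (D₁.e * D₁.conj D₁.e * (D₁.π * w₁)) +
        ((a ^ 2 + p * b ^ 2 : ℤ) * (D₂.c * τ P / q) +
          (a ^ 2 + p * b ^ 2 : ℤ) * Algebra.trace ℚ K₂ (D₂.e * D₂.conj D₂.e * (D₂.π * w₂))) =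
        (k * τ P : ℤ) + Algebra.trace ℚ K₁ (D₁.e * D₁.conj D₁.e * (D₁.π * w₁)) +
          (a ^ 2 + p * b ^ 2 : ℤ) * Algebra.trace ℚ K₂ (D₂.e * D₂.conj D₂.e * (D₂.π * w₂)) := by
      push_cast
      field_simp
      linear_combination (τ P : ℚ) * hk'
    rw [this]
    exact add_mem (add_mem (intCast_mem _ _) (D₁.trace_mul_mem hw₁))
      (mul_mem (intCast_mem _ _) (D₂.trace_mul_mem hw₂))

theorem inl_mem_glueLattice {a b : ℤ} {x : K₁} (hx : x ∈ D₁.O) :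
    (x * (D₁.π * D₁.e), 0) ∈ glueLattice D₁ D₂ a b := by
  obtain ⟨P, hP⟩ := D₁.exists_residue x hx
  have := (glueLattice D₁ D₂ a b).smul_mem
    (⟨(x, aeval D₂.ξ P), P, hP, reducesTo_aeval P⟩ : glueSubring D₁ D₂)
    (Submodule.subset_span (Set.mem_insert (D₁.π * D₁.e, 0) _))
  simpa [Subring.smul_def] using this

theorem inr_mem_glueLattice {a b : ℤ} {x : K₂} (hx : x ∈ D₂.O) :
    (0, x * (D₂.π * D₂.e)) ∈ glueLattice D₁ D₂ a b := by
  obtain ⟨P, hP⟩ := D₂.exists_residue x hx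
  have := (glueLattice D₁ D₂ a b).smul_mem
    (⟨(aeval D₁.ξ P, x), P, reducesTo_aeval P, hP⟩ : glueSubring D₁ D₂)
    (Submodule.subset_span (Set.mem_insert_of_mem _ (Set.mem_insert (0, D₂.π * D₂.e) _)))
  simpa [Subring.smul_def] using this

theorem smul_glueVector_mem {a b : ℤ} {s : K₁ × K₂} (hs : s ∈ glueSubring D₁ D₂) :
    s * glueVector D₁ D₂ a b ∈ glueLattice D₁ D₂ a b :=
  (glueLattice D₁ D₂ a b).smul_mem ⟨s, hs⟩ (Submodule.subset_span (by simp))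

/-- Vectors in the dual of the glue lattice are, up to `p ^ n`, in `e₁ O₁ × e₂ O₂`. -/
theorem exists_of_pairing_mem {a b : ℤ} {y : K₁ × K₂}
    (hy : ∀ x ∈ glueLattice D₁ D₂ a b, traceProd K₁ K₂ (y * conjProd D₁ D₂ x) ∈ integerSubring) :
    ∃ x₁ ∈ D₁.O, ∃ x₂ ∈ D₂.O, (p : K₁ × K₂) ^ n * y = (x₁ * D₁.e, x₂ * D₂.e) := by
  obtain ⟨x₁, hx₁, h₁⟩ := D₁.exists_mul_e (y := y.1) fun x hx => by
    have := hy _ (inl_mem_glueLattice (D₁.conj_mem x hx))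
    simp only [traceProd, conjProd_apply, LinearMap.coprod_apply, Prod.fst_mul, Prod.snd_mul,
      map_zero, mul_zero, add_zero] at this
    rw [map_mul D₁.conj, D₁.conj_conj] at this
    convert this using 2
    ring
  obtain ⟨x₂, hx₂, h₂⟩ := D₂.exists_mul_e (y := y.2) fun x hx => by
    have := hy _ (inr_mem_glueLattice (D₂.conj_mem x hx))
    simp only [traceProd, conjProd_apply, LinearMap.coprod_apply, Prod.fst_mul, Prod.snd_mul,
      map_zero, mul_zero, zero_add] at this
    rw [map_mul D₂.conj, D₂.conj_conj] at this
    convert this using 2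
    ring
  exact ⟨x₁, hx₁, x₂, hx₂, Prod.ext h₁ h₂⟩

theorem mem_glueLattice_of_pairing_mem (hp : p.Prime) [Fact q.Prime] (hpq : p ≠ q) {a b : ℤ}
    (hab : (q : ℤ) ∣ D₁.c + (a ^ 2 + p * b ^ 2) * D₂.c) {y : K₁ × K₂}
    (hy : ∀ x ∈ glueLattice D₁ D₂ a b, traceProd K₁ K₂ (y * conjProd D₁ D₂ x) ∈ integerSubring) :
    (p : K₁ × K₂) ^ n * y ∈ glueLattice D₁ D₂ a b := by
  obtain ⟨x₁, hx₁, x₂, hx₂, h⟩ := exists_of_pairing_mem hy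
  obtain ⟨P, w₁, hw₁, hP⟩ := D₁.exists_residue x₁ hx₁
  set u : K₂ := a + b * aeval D₂.ξ G with hu
  have huO : u ∈ D₂.O := add_mem (intCast_mem _ a) (mul_mem (intCast_mem _ b) (D₂.aeval_mem G))
  set x₃ : K₂ := x₂ - aeval D₂.ξ P * u with hx₃
  have hx₃O : x₃ ∈ D₂.O := sub_mem hx₂ (mul_mem (D₂.aeval_mem P) huO)
  have hg : ((aeval D₁.ξ P, aeval D₂.ξ P) : K₁ × K₂) * glueVector D₁ D₂ a b ∈
      glueLattice D₁ D₂ a b := smul_glueVector_mem ⟨P, reducesTo_aeval P, reducesTo_aeval P⟩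
  have hl := inl_mem_glueLattice (D₂ := D₂) (a := a) (b := b) hw₁
  have hdecomp : (p : K₁ × K₂) ^ n * y =
      (aeval D₁.ξ P, aeval D₂.ξ P) * glueVector D₁ D₂ a b + (w₁ * (D₁.π * D₁.e), 0) +
        (0, x₃ * D₂.e) := by
    rw [h, glueVector, ← hu, hP, hx₃]
    ext
    · simp; ring
    · simp; ring
  rw [hdecomp]
  refine add_mem (add_mem hg hl) ?_
  have hint := isIntegralOn_glueLattice (D₁ := D₁) (D₂ := D₂) hab
  have hx₃dual : ∀ x ∈ glueLattice D₁ D₂ a b,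
      traceProd K₁ K₂ ((0, x₃ * D₂.e) * conjProd D₁ D₂ x) ∈ integerSubring := by
    intro x hx
    have e1 : ((0, x₃ * D₂.e) : K₁ × K₂) * conjProd D₁ D₂ x = (p ^ n : ℤ) • (y * conjProd D₁ D₂ x) -
        ((aeval D₁.ξ P, aeval D₂.ξ P) * glueVector D₁ D₂ a b + (w₁ * (D₁.π * D₁.e), 0)) *
          conjProd D₁ D₂ x := by
      rw [zsmul_eq_mul]
      push_cast
      rw [← mul_assoc, hdecomp]; ring
    rw [e1, map_sub, map_zsmul]
    exact sub_mem (zsmul_mem (hy x hx) _) (hint _ (add_mem hg hl) _ hx)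
  obtain ⟨w, hw, hwe⟩ := D₂.mem_of_trace_mem (x₃ * D₂.e * D₂.conj (u * D₂.e)) fun z hz => by
    obtain ⟨Q, hQ⟩ := D₂.exists_residue _ (D₂.conj_mem z hz)
    have := hx₃dual _ (smul_glueVector_mem (s := (aeval D₁.ξ Q, D₂.conj z))
      ⟨Q, reducesTo_aeval Q, hQ⟩)
    simp only [traceProd, conjProd_apply, glueVector, LinearMap.coprod_apply, Prod.fst_mul,
      Prod.snd_mul,
      map_zero, zero_mul, zero_add, ← hu] at this
    rw [map_mul D₂.conj, D₂.conj_conj] at this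
    convert this using 2
    ring
  have hce : D₂.e * D₂.conj D₂.e ≠ 0 :=
    mul_ne_zero D₂.e_ne ((map_ne_zero D₂.conj).mpr D₂.e_ne)
  have hnorm := norm_glue D₂ a b
  rw [← hu] at hnorm
  have h4 : ((p ^ n * (a ^ 2 + p * b ^ 2) : ℤ) : K₂) * x₃ = D₂.π * (w * u) := by
    apply mul_left_cancel₀ hce
    rw [map_mul] at hwe
    rw [Int.cast_mul, ← hnorm]
    push_cast
    linear_combination u * hwe
  have hqP : Prime (q : ℤ) := Nat.prime_iff_prime_int.mp Fact.out
  have hcop : IsCoprime (q : ℤ) (p ^ n * (a ^ 2 + p * b ^ 2)) := by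
    rw [Prime.coprime_iff_not_dvd hqP, hqP.dvd_mul, not_or]
    constructor
    · intro hd
      have := hqP.dvd_of_dvd_pow hd
      exact hpq ((Nat.prime_dvd_prime_iff_eq Fact.out hp).mp (by exact_mod_cast this)).symm
    · intro hd
      exact D₁.c_not_dvd ((dvd_add_left (hd.mul_right _)).mp hab)
  obtain ⟨i, j, hij⟩ := hcop
  obtain ⟨v, hv, hqv⟩ := D₂.q_eq
  have hij' : (i : K₂) * q + j * ((p ^ n * (a ^ 2 + p * b ^ 2) : ℤ) : K₂) = 1 := by
    exact_mod_cast congrArg (Int.cast : ℤ → K₂) hij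
  have h5 : x₃ * D₂.e = (i * v * x₃ + j * (w * u)) * (D₂.π * D₂.e) := by
    linear_combination (-x₃ * D₂.e) * hij' + (i * x₃ * D₂.e) * hqv + (j * D₂.e) * h4
  rw [h5]
  exact inr_mem_glueLattice (add_mem (mul_mem (mul_mem (intCast_mem _ i) hv) hx₃O)
    (mul_mem (intCast_mem _ j) (mul_mem hw huO)))

end Pair

section Lattice

variable {p q n N₁ N₂ : ℕ} {G : ℤ[X]} {τ : ℤ[X] → ℤ} {K₁ K₂ : Type*} [Field K₁] [NumberField K₁]
  [Field K₂] [NumberField K₂] (D₁ : GlueData p q n N₁ G τ K₁) (D₂ : GlueData p q n N₂ G τ K₂)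

/-- The trace form of the product algebra. -/
noncomputable def form : LinearMap.BilinForm ℚ (K₁ × K₂) :=
  LinearMap.mk₂ ℚ (fun x y => traceProd K₁ K₂ (x * conjProd D₁ D₂ y))
    (fun x y z => by rw [add_mul, map_add])
    (fun r x y => by rw [smul_mul_assoc, map_smul])
    (fun x y z => by rw [map_add (conjProd D₁ D₂), mul_add, map_add])
    (fun r x y => by rw [map_rat_smul (conjProd D₁ D₂) r y, mul_smul_comm, map_smul])

theorem form_apply (x y : K₁ × K₂) :
    form D₁ D₂ x y = traceProd K₁ K₂ (x * conjProd D₁ D₂ y) := rfl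

theorem form_eq_add (x y : K₁ × K₂) : form D₁ D₂ x y =
    Algebra.trace ℚ K₁ (x.1 * D₁.conj y.1) + Algebra.trace ℚ K₂ (x.2 * D₂.conj y.2) := rfl

theorem form_symm (x y : K₁ × K₂) : form D₁ D₂ x y = form D₁ D₂ y x := by
  rw [form_apply, ← traceProd_conjProd D₁ D₂, map_mul (conjProd D₁ D₂), conjProd_conjProd, mul_comm,
    form_apply]

theorem form_pos {x : K₁ × K₂} (hx : x ≠ 0) : 0 < form D₁ D₂ x x := by
  rw [form_eq_add]
  by_cases h : x.1 = 0
  · exact add_pos_of_nonneg_of_pos (D₁.trace_mul_conj_nonneg _)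
      (D₂.trace_mul_conj_pos fun h' => hx (Prod.ext h h'))
  · exact add_pos_of_pos_of_nonneg (D₁.trace_mul_conj_pos h) (D₂.trace_mul_conj_nonneg _)

/-- The complex embeddings of the product algebra. -/
def embedding : (K₁ →+* ℂ) ⊕ (K₂ →+* ℂ) → K₁ × K₂ →+ ℂ :=
  Sum.elim (fun φ => φ.toAddMonoidHom.comp (AddMonoidHom.fst K₁ K₂))
    (fun φ => φ.toAddMonoidHom.comp (AddMonoidHom.snd K₁ K₂))

theorem form_eq_sum_embedding (x y : K₁ × K₂) :
    ((form D₁ D₂ x y : ℚ) : ℂ) = ∑ i, embedding i x * star (embedding i y) := by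
  rw [form_eq_add, Rat.cast_add, D₁.trace_mul_conj, D₂.trace_mul_conj, Fintype.sum_sum_type]
  rfl

theorem form_mul_mul (x y : K₁ × K₂) :
    form D₁ D₂ ((D₁.ζ, D₂.ζ) * x) ((D₁.ζ, D₂.ζ) * y) = form D₁ D₂ x y := by
  have h : ((D₁.ζ, D₂.ζ) : K₁ × K₂) * conjProd D₁ D₂ (D₁.ζ, D₂.ζ) = 1 :=
    Prod.ext D₁.ζ_mul_conj D₂.ζ_mul_conj
  rw [form_apply, form_apply, map_mul (conjProd D₁ D₂)]
  congr 1
  linear_combination (x * conjProd D₁ D₂ y) * h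

theorem charpoly_mulLeft :
    (LinearMap.mulLeft ℚ ((D₁.ζ, D₂.ζ) : K₁ × K₂)).charpoly =
      (cyclotomic N₁ ℤ * cyclotomic N₂ ℤ).map (Int.castRingHom ℚ) := by
  have h : LinearMap.mulLeft ℚ ((D₁.ζ, D₂.ζ) : K₁ × K₂) =
      (LinearMap.mulLeft ℚ D₁.ζ).prodMap (LinearMap.mulLeft ℚ D₂.ζ) := rfl
  rw [h, LinearMap.charpoly_prodMap, D₁.charpoly_ζ, D₂.charpoly_ζ, Polynomial.map_mul]

theorem ζ_mem_glueSubring : (D₁.ζ, D₂.ζ) ∈ glueSubring D₁ D₂ := by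
  refine ⟨X, ?_, ?_⟩
  · obtain ⟨w, hw, h⟩ := D₁.ζ_eq
    exact ⟨w, hw, by rw [aeval_X, ← h]⟩
  · obtain ⟨w, hw, h⟩ := D₂.ζ_eq
    exact ⟨w, hw, by rw [aeval_X, ← h]⟩

theorem H_mem_glueSubring : (D₁.H, D₂.H) ∈ glueSubring D₁ D₂ := by
  refine ⟨0, ?_, ?_⟩
  · obtain ⟨w, hw, h⟩ := D₁.H_eq
    exact ⟨w, hw, by simpa using h⟩
  · obtain ⟨w, hw, h⟩ := D₂.H_eq
    exact ⟨w, hw, by simpa using h⟩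

/-- The norm form `a² + p b²` represents `-c₁ / c₂` modulo `q`. -/
theorem exists_norm_dvd (hp : p.Prime) [Fact q.Prime] (hpq : p ≠ q) (hq2 : q ≠ 2) :
    ∃ a b : ℤ, (q : ℤ) ∣ D₁.c + (a ^ 2 + p * b ^ 2) * D₂.c := by
  have hc : (D₂.c : ZMod q) ≠ 0 := fun h =>
    D₂.c_not_dvd ((ZMod.intCast_zmod_eq_zero_iff_dvd _ _).mp h)
  have hpz : (p : ZMod q) ≠ 0 := fun h => hpq
    ((Nat.prime_dvd_prime_iff_eq Fact.out hp).mp ((ZMod.natCast_eq_zero_iff _ _).mp h)).symm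
  obtain ⟨a, b, hab⟩ := FiniteField.exists_root_sum_quadratic (R := ZMod q)
    (f := X ^ 2 + C (D₁.c / D₂.c : ZMod q)) (g := C (p : ZMod q) * X ^ 2)
    (by compute_degree!) (by compute_degree!)
    (by rw [ZMod.card]; exact (Fact.out : q.Prime).eq_two_or_odd.resolve_left hq2)
  refine ⟨a.val, b.val, (ZMod.intCast_zmod_eq_zero_iff_dvd _ _).mp ?_⟩
  simp only [eval_add, eval_mul, eval_pow, eval_X, eval_C] at hab
  push_cast
  rw [ZMod.natCast_zmod_val, ZMod.natCast_zmod_val]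
  field_simp at hab
  linear_combination hab

variable {D₁ D₂}

theorem isLattice_of_glueLattice_le [Fact p.Prime] {a b : ℤ} {L : Submodule ℤ (K₁ × K₂)}
    (hle : ∀ x ∈ glueLattice D₁ D₂ a b, x ∈ L)
    (hint : ∀ x ∈ L, ∀ y ∈ L, form D₁ D₂ x y ∈ integerSubring) : Submodule.IsLattice ℚ L where
  fg := by
    let M : Submodule ℤ (K₁ × K₂) :=
      (Subalgebra.toSubmodule D₁.O).prod (Subalgebra.toSubmodule D₂.O)
    have hM : M.FG := D₁.fg.prod D₂.fg
    let f : K₁ × K₂ →ₗ[ℤ] K₁ × K₂ :=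
      LinearMap.mulLeft ℤ (((p : K₁) ^ n)⁻¹ * D₁.e, ((p : K₂) ^ n)⁻¹ * D₂.e)
    have hp : p ≠ 0 := (Fact.out : p.Prime).ne_zero
    have hL : L ≤ M.map f := by
      intro y hy
      obtain ⟨x₁, hx₁, x₂, hx₂, h⟩ := exists_of_pairing_mem (D₁ := D₁) (D₂ := D₂) (a := a) (b := b)
        (y := y) fun x hx => hint y hy x (hle x hx)
      have hp₁ : (p : K₁) ^ n ≠ 0 := pow_ne_zero _ (Nat.cast_ne_zero.mpr hp)
      have hp₂ : (p : K₂) ^ n ≠ 0 := pow_ne_zero _ (Nat.cast_ne_zero.mpr hp)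
      refine ⟨(x₁, x₂), ⟨hx₁, hx₂⟩, Prod.ext ?_ ?_⟩
      · have h1 : (p : K₁) ^ n * y.1 = x₁ * D₁.e := congrArg Prod.fst h
        change ((p : K₁) ^ n)⁻¹ * D₁.e * x₁ = y.1
        field_simp
        linear_combination -h1
      · have h1 : (p : K₂) ^ n * y.2 = x₂ * D₂.e := congrArg Prod.snd h
        change ((p : K₂) ^ n)⁻¹ * D₂.e * x₂ = y.2
        field_simp
        linear_combination -h1
    exact (hM.map f).of_le hL
  span_eq_top := by
    rw [eq_top_iff]
    have key : ∀ (k : ℤ) (x : K₁ × K₂), k ≠ 0 → (k : K₁ × K₂) * x ∈ L →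
        x ∈ Submodule.span ℚ (L : Set (K₁ × K₂)) := by
      intro k x hk hx
      have h : x = (k : ℚ)⁻¹ • ((k : K₁ × K₂) * x) := by
        rw [← zsmul_eq_mul, ← Int.cast_smul_eq_zsmul ℚ, smul_smul,
          inv_mul_cancel₀ (Int.cast_ne_zero.mpr hk), one_smul]
      rw [h]
      exact Submodule.smul_mem _ _ (Submodule.subset_span hx)
    rintro ⟨x₁, x₂⟩ -
    obtain ⟨k₁, hk₁, h₁⟩ := D₁.exists_int_mul_mem (x₁ / (D₁.π * D₁.e))
    obtain ⟨k₂, hk₂, h₂⟩ := D₂.exists_int_mul_mem (x₂ / (D₂.π * D₂.e))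
    have e₁ := mul_ne_zero D₁.π_ne D₁.e_ne
    have e₂ := mul_ne_zero D₂.π_ne D₂.e_ne
    have hx : ((x₁, x₂) : K₁ × K₂) = (x₁, 0) + (0, x₂) := by simp
    rw [hx]
    refine add_mem (key k₁ _ hk₁ ?_) (key k₂ _ hk₂ ?_)
    · convert hle _ (inl_mem_glueLattice h₁) using 1
      refine Prod.ext ?_ ?_
      · rw [mul_assoc, div_mul_cancel₀ _ e₁]; rfl
      · exact mul_zero _
    · convert hle _ (inr_mem_glueLattice h₂) using 1
      refine Prod.ext ?_ ?_
      · exact mul_zero _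
      · rw [mul_assoc, div_mul_cancel₀ _ e₂]; rfl

/-- Gluing two copies of the data produces an even unimodular lattice with an isometry. -/
theorem exists_gram_matrix (D₁ : GlueData p q n N₁ G τ K₁) (D₂ : GlueData p q n N₂ G τ K₂)
    [Fact p.Prime] [Fact q.Prime] (hpq : p ≠ q) (hp2 : p ≠ 2) (hq2 : q ≠ 2) {s : ℤ}
    (hs : (p : ℤ) ∣ s ^ 2 + q) (h1 : (cyclotomic N₁ ℤ * cyclotomic N₂ ℤ).eval 1 = 1) :
    ∃ B A : Matrix (Fin (cyclotomic N₁ ℤ * cyclotomic N₂ ℤ).natDegree)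
        (Fin (cyclotomic N₁ ℤ * cyclotomic N₂ ℤ).natDegree) ℤ,
      B.IsSymm ∧ (∀ i, Even (B i i)) ∧ (∀ x, x ≠ 0 → 0 < x ⬝ᵥ B.mulVec x) ∧
      B.det = 1 ∧ Aᵀ * B * A = B ∧ A.charpoly = cyclotomic N₁ ℤ * cyclotomic N₂ ℤ := by
  have hp : p.Prime := Fact.out
  have hps : ¬ (p : ℤ) ∣ s := fun h => hpq <| by
    have h' : (p : ℤ) ∣ q := (dvd_add_right (dvd_pow h two_ne_zero)).mp hs
    exact (Nat.prime_dvd_prime_iff_eq hp Fact.out).mp (by exact_mod_cast h')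
  obtain ⟨a, b, hab⟩ := exists_norm_dvd D₁ D₂ hp hpq hq2
  obtain ⟨L, hle, hint, hdual⟩ := exists_selfDual (conjProd_conjProd D₁ D₂)
    (tr := (traceProd K₁ K₂).toAddMonoidHom) (traceProd_conjProd D₁ D₂)
    (fun s hs => conj_mem_glueSubring D₁ D₂ hs) (isIntegralOn_glueLattice hab) hp hp2
    (H_mem_glueSubring D₁ D₂) (Prod.ext D₁.conj_H D₂.conj_H) (Prod.ext D₁.H_sq D₂.H_sq) hs hps
    fun y hy => mem_glueLattice_of_pairing_mem hp hpq hab hy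
  let L' : Submodule ℤ (K₁ × K₂) := L.toAddSubgroup.toIntSubmodule
  have : Submodule.IsLattice ℚ L' := isLattice_of_glueLattice_le (fun x hx => hle hx) hint
  exact exists_gram_matrix_of_selfDual_lattice (form D₁ D₂) (form_symm D₁ D₂)
    (fun x => form_pos D₁ D₂) embedding (form_eq_sum_embedding D₁ D₂)
    (LinearMap.mulLeft ℚ (D₁.ζ, D₂.ζ)) (form_mul_mul D₁ D₂) _ (charpoly_mulLeft D₁ D₂) h1 L'
    (fun x hx => L.smul_mem ⟨_, ζ_mem_glueSubring D₁ D₂⟩ hx)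
    (fun x hx y hy => mem_integerSubring.mp (hint x hx y hy))
    (fun y hy => hdual y fun x hx => mem_integerSubring.mpr (hy x hx))

end Lattice

end GlueData

section Units

variable {K : Type*} [Field K] {O : Subalgebra ℤ K}

/-- The nonzero elements of `K` that are units of the subring `O`. -/
def unitsIn (O : Subalgebra ℤ K) : Submonoid K where
  carrier := {x | x ≠ 0 ∧ x ∈ O ∧ x⁻¹ ∈ O}
  mul_mem' := fun ⟨h₁, h₂, h₃⟩ ⟨g₁, g₂, g₃⟩ =>
    ⟨mul_ne_zero h₁ g₁, mul_mem h₂ g₂, by rw [mul_inv]; exact mul_mem h₃ g₃⟩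
  one_mem' := ⟨one_ne_zero, one_mem O, by rw [inv_one]; exact one_mem O⟩

theorem ne_zero_of_mem_unitsIn {x : K} (h : x ∈ unitsIn O) : x ≠ 0 := h.1

theorem mem_of_mem_unitsIn {x : K} (h : x ∈ unitsIn O) : x ∈ O := h.2.1

theorem inv_mem_of_mem_unitsIn {x : K} (h : x ∈ unitsIn O) : x⁻¹ ∈ O := h.2.2

theorem inv_mem_unitsIn {x : K} (h : x ∈ unitsIn O) : x⁻¹ ∈ unitsIn O :=
  ⟨inv_ne_zero h.1, h.2.2, by rw [inv_inv]; exact h.2.1⟩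

theorem neg_mem_unitsIn {x : K} (h : x ∈ unitsIn O) : -x ∈ unitsIn O :=
  ⟨neg_ne_zero.mpr h.1, neg_mem h.2.1, by rw [inv_neg]; exact neg_mem h.2.2⟩

theorem mem_unitsIn_of_pow_eq_one {x : K} (hx : x ∈ O) {k : ℕ} (hk : k ≠ 0) (h : x ^ k = 1) :
    x ∈ unitsIn O := by
  obtain ⟨j, rfl⟩ := Nat.exists_eq_succ_of_ne_zero hk
  refine ⟨fun h0 => by simp [h0] at h, hx, ?_⟩
  rw [inv_eq_of_mul_eq_one_right (b := x ^ j) (by rw [← pow_succ']; exact h)]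
  exact pow_mem hx j

theorem exists_aeval_eq_eval_one_add {ω : K} (hω : ω ∈ O) (f : ℤ[X]) :
    ∃ w ∈ O, aeval ω f = f.eval 1 + (1 - ω) * w := by
  obtain ⟨g, hg⟩ := X_sub_C_dvd_sub_C_eval (a := (1 : ℤ)) (p := f)
  refine ⟨-aeval ω g, neg_mem (aeval_mem_subalgebra hω g), ?_⟩
  have := congrArg (aeval ω) hg
  rw [map_sub, map_mul, map_sub, aeval_X, aeval_C, aeval_C, map_one, algebraMap_int_eq,
    eq_intCast] at this
  linear_combination this

/-- If `ω` is a primitive root of unity of composite order, `1 - ω` is a unit. -/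
theorem one_sub_mem_unitsIn [CharZero K] {ω : K} (hω : ω ∈ O) {k : ℕ} (hk : IsPrimitiveRoot ω k)
    (hk0 : 0 < k) (h1 : (cyclotomic k ℤ).eval 1 = 1) : 1 - ω ∈ unitsIn O := by
  obtain ⟨w, hw, h⟩ := exists_aeval_eq_eval_one_add hω (cyclotomic k ℤ)
  have h0 : aeval ω (cyclotomic k ℤ) = 0 := by
    rw [cyclotomic_eq_minpoly hk hk0]; exact minpoly.aeval ℤ ω
  rw [h0, h1, Int.cast_one] at h
  have h2 : (1 - ω) * -w = 1 := by linear_combination h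
  refine ⟨left_ne_zero_of_mul_eq_one h2, sub_mem (one_mem O) hω, ?_⟩
  rw [inv_eq_of_mul_eq_one_right h2]
  exact neg_mem hw

theorem exists_prime_eq_one_sub_mul [CharZero K] {ω : K} (hω : ω ∈ O) {r : ℕ} [Fact r.Prime]
    (hr : IsPrimitiveRoot ω r) : ∃ w ∈ O, (r : K) = (1 - ω) * w := by
  obtain ⟨w, hw, h⟩ := exists_aeval_eq_eval_one_add hω (cyclotomic r ℤ)
  have h0 : aeval ω (cyclotomic r ℤ) = 0 := by
    rw [cyclotomic_eq_minpoly hr (Fact.out : r.Prime).pos]; exact minpoly.aeval ℤ ω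
  rw [h0, eval_one_cyclotomic_prime] at h
  exact ⟨-w, neg_mem hw, by push_cast at h; linear_combination -h⟩

theorem exists_one_sub_pow_eq {ω : K} (hω : ω ∈ O) (a : ℕ) :
    ∃ w ∈ O, 1 - ω ^ a = (1 - ω) * w := by
  obtain ⟨w, hw, h⟩ := exists_aeval_eq_eval_one_add hω (1 - X ^ a : ℤ[X])
  exact ⟨w, hw, by simpa using h⟩

/-- `1 - ω` and `1 - ω ^ a` are associated when `a` is prime to the order of `ω`. -/
theorem exists_one_sub_pow_eq_unit {ω : K} (hω : ω ∈ O) {k a : ℕ} (hk : 1 < k)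
    (h : IsPrimitiveRoot ω k) (ha : a.Coprime k) :
    ∃ w ∈ unitsIn O, 1 - ω ^ a = (1 - ω) * w := by
  obtain ⟨w, hw, h1⟩ := exists_one_sub_pow_eq hω a
  obtain ⟨b, -, hb⟩ := Nat.exists_mul_mod_eq_one_of_coprime ha hk
  have hb' : (ω ^ a) ^ b = ω := by
    rw [← pow_mul, ← Nat.mod_add_div (a * b) k, hb, pow_add, pow_mul, h.pow_eq_one, one_pow,
      pow_one,
      mul_one]
  obtain ⟨v, hv, h2⟩ := exists_one_sub_pow_eq (pow_mem hω a) b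
  rw [hb', h1] at h2
  have hne : 1 - ω ≠ 0 := sub_ne_zero.mpr (h.ne_one hk).symm
  have h3 : w * v = 1 := by
    apply mul_left_cancel₀ hne
    linear_combination -h2
  exact ⟨w, ⟨left_ne_zero_of_mul_eq_one h3, hw, by rwa [inv_eq_of_mul_eq_one_right h3]⟩, h1⟩

/-- `1 - η ^ (q ^ j)` is a unit times `(1 - η) ^ (q ^ j)`. -/
theorem exists_one_sub_pow_prime_pow_eq [CharZero K] {η : K} (hη : η ∈ O) {q j : ℕ}
    (hq : q.Prime) (h : IsPrimitiveRoot η (q ^ (j + 1))) :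
    ∃ w ∈ unitsIn O, 1 - η ^ (q ^ j) = (1 - η) ^ (q ^ j) * w := by
  have hQ : 0 < q ^ j := pow_pos hq.pos j
  have hω : IsPrimitiveRoot (η ^ q) (q ^ j) :=
    h.pow (pow_pos hq.pos _) (pow_succ' q j)
  have hfac : 1 - η ^ (q ^ j) = ∏ k ∈ Finset.range (q ^ j), (1 - η ^ (1 + q * k)) := by
    have h1 := congrArg (eval 1) (X_pow_sub_C_eq_prod hω hQ (rfl : η ^ (q ^ j) = _))
    simp only [eval_sub, eval_pow, eval_X, eval_C, one_pow, eval_prod] at h1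
    rw [h1]
    refine Finset.prod_congr rfl fun k _ => ?_
    rw [pow_add, pow_one, pow_mul, mul_comm]
  have hunit (k : ℕ) : ∃ w ∈ unitsIn O, 1 - η ^ (1 + q * k) = (1 - η) * w := by
    refine exists_one_sub_pow_eq_unit hη (Nat.one_lt_pow (Nat.succ_ne_zero j) hq.one_lt) h ?_
    exact Nat.Coprime.pow_right _ (by simp)
  choose w hw hw' using hunit
  refine ⟨∏ k ∈ Finset.range (q ^ j), w k, prod_mem fun k _ => hw k, ?_⟩
  rw [hfac, Finset.prod_congr rfl fun k _ => hw' k, Finset.prod_mul_distrib, Finset.prod_const,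
    Finset.card_range]

end Units

section CyclotomicPolynomial

theorem expand_prime_pow_cyclotomic {p k : ℕ} (hp : p.Prime) (hk : p ∣ k) (j : ℕ) :
    expand ℤ (p ^ j) (cyclotomic k ℤ) = cyclotomic (k * p ^ j) ℤ := by
  induction j with
  | zero => simp
  | succ j ih =>
    rw [pow_succ', ← expand_expand, ih,
      cyclotomic_expand_eq_cyclotomic hp (dvd_mul_of_dvd_left hk _), mul_assoc, ← pow_succ,
      pow_succ']

theorem cyclotomic_prime_mul_prime {p q : ℕ} (hp : p.Prime) (hq : q.Prime) (hpq : p ≠ q) :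
    cyclotomic (p * q) ℤ * ((X ^ p - 1) * (X ^ q - 1)) = (X ^ (p * q) - 1) * (X - 1) := by
  have : Fact p.Prime := ⟨hp⟩
  have h1 := cyclotomic_expand_eq_cyclotomic_mul hq
    (fun h => hpq ((Nat.prime_dvd_prime_iff_eq hq hp).mp h).symm) ℤ
  have h2 : cyclotomic p ℤ * (X - 1) = X ^ p - 1 := cyclotomic_prime_mul_X_sub_one ℤ p
  have h3 := congrArg (expand ℤ q) h2
  simp only [map_mul, map_sub, map_pow, expand_X, map_one, ← pow_mul] at h3
  rw [mul_comm q p] at h3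
  rw [← h3, h1, ← h2]
  ring

theorem cyclotomic_prime_pow_mul_prime_pow {p q : ℕ} (hp : p.Prime) (hq : q.Prime) (hpq : p ≠ q)
    (i j : ℕ) :
    cyclotomic (p ^ (i + 1) * q ^ (j + 1)) ℤ *
      ((X ^ (p ^ (i + 1) * q ^ j) - 1) * (X ^ (p ^ i * q ^ (j + 1)) - 1)) =
      (X ^ (p ^ (i + 1) * q ^ (j + 1)) - 1) * (X ^ (p ^ i * q ^ j) - 1) := by
  have h := congrArg (expand ℤ (q ^ j)) (congrArg (expand ℤ (p ^ i))
    (cyclotomic_prime_mul_prime hp hq hpq))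
  simp only [map_mul, map_sub, map_pow, expand_X, map_one, ← pow_mul] at h
  rw [expand_prime_pow_cyclotomic hp (dvd_mul_right p q),
    expand_prime_pow_cyclotomic hq (dvd_mul_of_dvd_left (dvd_mul_left q p) _)] at h
  convert h using 3 <;> ring_nf

theorem eval_one_cyclotomic_prime_pow_mul_prime_pow {p q : ℕ} (hp : p.Prime) (hq : q.Prime)
    (hpq : p ≠ q) (i j : ℕ) : (cyclotomic (p ^ (i + 1) * q ^ (j + 1)) ℤ).eval 1 = 1 := by
  refine eval_one_cyclotomic_not_prime_pow fun {r} hr k hk => hpq ?_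
  have h1 : p ∣ r ^ k := hk ▸ dvd_mul_of_dvd_left (dvd_pow_self p (Nat.succ_ne_zero i)) _
  have h2 : q ∣ r ^ k := hk ▸ dvd_mul_of_dvd_right (dvd_pow_self q (Nat.succ_ne_zero j)) _
  rw [(Nat.prime_dvd_prime_iff_eq hp hr).mp (hp.dvd_of_dvd_pow h1),
    (Nat.prime_dvd_prime_iff_eq hq hr).mp (hq.dvd_of_dvd_pow h2)]

theorem derivative_cyclotomic_mul {K : Type*} [Field K] [CharZero K] {p q : ℕ} (hp : p.Prime)
    (hq : q.Prime) (hpq : p ≠ q) {i j : ℕ} {ζ : K}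
    (hζ : IsPrimitiveRoot ζ (p ^ (i + 1) * q ^ (j + 1))) :
    aeval ζ (derivative (cyclotomic (p ^ (i + 1) * q ^ (j + 1)) ℤ)) *
      ((1 - ζ ^ (p ^ (i + 1) * q ^ j)) * (1 - ζ ^ (p ^ i * q ^ (j + 1)))) * ζ =
      (p ^ (i + 1) * q ^ (j + 1) : ℕ) * (ζ ^ (p ^ i * q ^ j) - 1) := by
  set N := p ^ (i + 1) * q ^ (j + 1) with hN
  have hN0 : 0 < N := Nat.mul_pos (pow_pos hp.pos _) (pow_pos hq.pos _)
  have h := congrArg (fun f => aeval ζ (derivative f))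
    (cyclotomic_prime_pow_mul_prime_pow hp hq hpq i j)
  have h0 : aeval ζ (cyclotomic N ℤ) = 0 := by
    rw [cyclotomic_eq_minpoly hζ hN0]; exact minpoly.aeval ℤ ζ
  have h1 : ζ ^ (N - 1) * ζ = 1 := by rw [← pow_succ, Nat.sub_add_cancel hN0, hζ.pow_eq_one]
  simp only [← hN, derivative_mul, map_add, map_mul, map_sub, map_pow, aeval_X, map_one, h0,
    zero_mul,
    add_zero, hζ.pow_eq_one, sub_self] at h
  simp only [derivative_X_pow, derivative_one, map_mul, map_natCast,
    map_pow, aeval_X] at h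
  simp at h
  linear_combination ζ * h + (N : K) * (ζ ^ (p ^ i * q ^ j) - 1) * h1

end CyclotomicPolynomial

section GaussPolynomial

/-- The polynomial whose value at `ω` is the quadratic Gauss sum of `ω ^ k`. -/
noncomputable def gaussPolynomial (r k : ℕ) [Fact r.Prime] : ℤ[X] :=
  ∑ a : ZMod r, C (quadraticChar (ZMod r) a) * X ^ (k * a.val)

variable {r k : ℕ} [Fact r.Prime]

theorem ringChar_zmod_ne_two (hr : r % 4 = 3) : ringChar (ZMod r) ≠ 2 := by
  rw [ZMod.ringChar_zmod_n]
  rintro rfl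
  simp at hr

theorem eval_one_gaussPolynomial (hr : r % 4 = 3) : (gaussPolynomial r k).eval 1 = 0 := by
  rw [gaussPolynomial, eval_finsetSum, ← quadraticChar_sum_zero (ringChar_zmod_ne_two hr)]
  exact Finset.sum_congr rfl fun a _ => by simp

theorem aeval_gaussPolynomial_sq {K : Type*} [Field K] [CharZero K] (hr : r % 4 = 3) {ω : K}
    (hω : IsPrimitiveRoot (ω ^ k) r) : (aeval ω (gaussPolynomial r k)) ^ 2 = -(r : K) := by
  let χ : MulChar (ZMod r) K := (quadraticChar (ZMod r)).ringHomComp (Int.castRingHom K)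
  have hχ1 : χ ≠ 1 := (MulChar.ringHomComp_ne_one_iff (RingHom.injective_int _)).mpr
    (quadraticChar_ne_one (ringChar_zmod_ne_two hr))
  have hχ2 : χ.IsQuadratic := (quadraticChar_isQuadratic _).comp _
  have hg : aeval ω (gaussPolynomial r k) = gaussSum χ (AddChar.zmodChar r hω.pow_eq_one) := by
    rw [gaussPolynomial, gaussSum, map_sum]
    refine Finset.sum_congr rfl fun a _ => ?_
    rw [map_mul, aeval_C, map_pow, aeval_X, AddChar.zmodChar_apply, pow_mul]
    rfl
  have hneg : quadraticChar (ZMod r) (-1) = -1 := by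
    rw [quadraticChar_neg_one (ringChar_zmod_ne_two hr), ZMod.card, ZMod.χ₄_nat_three_mod_four hr]
  rw [hg, gaussSum_sq hχ1 hχ2 (AddChar.zmodChar_primitive_of_primitive_root r hω), ZMod.card]
  have : χ (-1) = -1 := by
    change ((quadraticChar (ZMod r) (-1) : ℤ) : K) = -1
    rw [hneg]; simp
  rw [this]; ring

end GaussPolynomial

section Conjugation

variable {K : Type*} [Field K] [NumberField K] {conj : K →+* K}

theorem conj_eq_neg_of_sq_eq_neg (hconj : ∀ (φ : K →+* ℂ) (x : K), φ (conj x) = star (φ x))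
    {x : K} {r : ℕ} (hr : 0 < r) (hx : x ^ 2 = -(r : K)) : conj x = -x := by
  have h : conj x ^ 2 = x ^ 2 := by rw [← map_pow, hx, map_neg, map_natCast]
  refine (sq_eq_sq_iff_eq_or_eq_neg.mp h).resolve_left fun h1 => ?_
  obtain ⟨φ⟩ : Nonempty (K →+* ℂ) := inferInstance
  have h2 : star (φ x) = φ x := by rw [← hconj, h1]
  obtain ⟨a, ha⟩ := Complex.conj_eq_iff_real.mp h2
  have h3 : φ x ^ 2 = -(r : ℂ) := by rw [← map_pow, hx, map_neg, map_natCast]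
  rw [ha] at h3
  have h4 : a ^ 2 = -(r : ℝ) := by exact_mod_cast h3
  have : (0 : ℝ) < r := Nat.cast_pos.mpr hr
  nlinarith [sq_nonneg a]

theorem mul_conj_of_pow_eq_one (hconj : ∀ (φ : K →+* ℂ) (x : K), φ (conj x) = star (φ x))
    {x : K} {k : ℕ} (hk : k ≠ 0) (hx : x ^ k = 1) : x * conj x = 1 := by
  obtain ⟨φ⟩ : Nonempty (K →+* ℂ) := inferInstance
  apply φ.injective
  have h : ‖φ x‖ = 1 := Complex.norm_eq_one_of_pow_eq_one (by rw [← map_pow, hx, map_one]) hk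
  rw [map_mul, hconj, map_one, Complex.star_def, Complex.mul_conj, Complex.normSq_eq_norm_sq, h]
  simp

theorem conj_eq_pow_of_pow_eq_one (hconj : ∀ (φ : K →+* ℂ) (x : K), φ (conj x) = star (φ x))
    {x : K} {k : ℕ} (hk : k ≠ 0) (hx : x ^ k = 1) : conj x = x ^ (k - 1) := by
  have h1 := mul_conj_of_pow_eq_one hconj hk hx
  apply mul_left_cancel₀ (left_ne_zero_of_mul_eq_one h1)
  rw [h1, ← pow_succ', Nat.sub_add_cancel (Nat.pos_of_ne_zero hk), hx]

end Conjugation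

section Trace

open scoped IntermediateField

/-- The trace from `ℚ(ζ)` to `ℚ` of `P(ζ)`, for a root of unity `ζ` of order `k`. -/
noncomputable def cyclotomicTrace (k : ℕ) (P : ℤ[X]) : ℚ :=
  Algebra.trace ℚ (AdjoinRoot (cyclotomic k ℚ)) (aeval (AdjoinRoot.root (cyclotomic k ℚ)) P)

theorem trace_adjoin_eq_cyclotomicTrace {K : Type*} [Field K] [CharZero K] {k : ℕ} (hk : 0 < k)
    {ξ : K} (hξ : IsPrimitiveRoot ξ k) (P : ℤ[X]) :
    Algebra.trace ℚ ℚ⟮ξ⟯ (aeval (IntermediateField.AdjoinSimple.gen ℚ ξ) P) =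
      cyclotomicTrace k P := by
  have hint : IsIntegral ℚ ξ := (hξ.isIntegral hk).tower_top
  rw [cyclotomicTrace, cyclotomic_eq_minpoly_rat hξ hk,
    ← Algebra.trace_eq_of_algEquiv (IntermediateField.adjoinRootEquivAdjoin ℚ hint)]
  congr 1
  rw [← IntermediateField.adjoinRootEquivAdjoin_apply_root ℚ hint]
  exact Polynomial.aeval_algHom_apply
    ((IntermediateField.adjoinRootEquivAdjoin ℚ hint).toAlgHom.restrictScalars ℤ) _ P

theorem cyclotomicTrace_mem_integerSubring {k : ℕ} (hk : 0 < k) (P : ℤ[X]) :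
    cyclotomicTrace k P ∈ integerSubring := by
  have hξ := Complex.isPrimitiveRoot_exp k hk.ne'
  have hfin := IntermediateField.adjoin.finiteDimensional (hξ.isIntegral hk).tower_top (K := ℚ)
  rw [← trace_adjoin_eq_cyclotomicTrace hk hξ]
  have h1 : IsIntegral ℤ (IntermediateField.AdjoinSimple.gen ℚ
      (Complex.exp (2 * Real.pi * Complex.I / k))) :=
    (isIntegral_algebraMap_iff (B := ℂ) (FaithfulSMul.algebraMap_injective _ _)).mp
      (hξ.isIntegral hk)
  have h2 := aeval_mem_subalgebra (O := integralClosure ℤ _) h1 P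
  obtain ⟨z, hz⟩ := IsIntegrallyClosed.isIntegral_iff.mp (Algebra.isIntegral_trace (L := ℚ) h2)
  exact mem_integerSubring.mpr ⟨z, by rw [← hz]; simp⟩

/-- The trace is a nonzero integer times a surjective map. -/
theorem exists_cyclotomicTrace_eq_mul {k : ℕ} (hk : 0 < k) :
    ∃ (g : ℤ) (τ : ℤ[X] → ℤ), g ≠ 0 ∧ (∀ P, cyclotomicTrace k P = g * τ P) ∧ ∃ P, τ P = 1 := by
  choose T hT using fun P => mem_integerSubring.mp (cyclotomicTrace_mem_integerSubring hk P)
  have hadd : ∀ P Q, T (P + Q) = T P + T Q := fun P Q => by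
    have : ((T (P + Q) : ℤ) : ℚ) = T P + T Q := by
      rw [← hT, ← hT, ← hT, cyclotomicTrace, map_add, map_add]; rfl
    exact_mod_cast this
  let T' : ℤ[X] →+ ℤ := AddMonoidHom.mk' T hadd
  obtain ⟨g, hg⟩ := (IsPrincipalIdealRing.principal (LinearMap.range T'.toIntLinearMap)).principal
  have hmem (P : ℤ[X]) : ∃ z : ℤ, T P = g * z := by
    have h : T P ∈ LinearMap.range T'.toIntLinearMap := ⟨P, rfl⟩
    rw [hg] at h
    obtain ⟨z, hz⟩ := Submodule.mem_span_singleton.mp h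
    exact ⟨z, by rw [← hz, smul_eq_mul, mul_comm]⟩
  choose τ hτ using hmem
  have hg0 : g ≠ 0 := by
    rintro rfl
    have h1 : T 1 = 0 := by rw [hτ, zero_mul]
    have h2 := hT 1
    rw [h1, cyclotomicTrace, map_one, ← map_one (algebraMap ℚ _), Algebra.trace_algebraMap,
      (AdjoinRoot.powerBasis (cyclotomic_ne_zero k ℚ)).finrank, AdjoinRoot.powerBasis_dim,
      natDegree_cyclotomic, nsmul_one] at h2
    exact (Nat.totient_pos.mpr hk).ne' (by exact_mod_cast h2)
  obtain ⟨P, hP⟩ : g ∈ LinearMap.range T'.toIntLinearMap := by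
    rw [hg]; exact Submodule.mem_span_singleton_self g
  refine ⟨g, τ, hg0, fun P => by rw [hT, hτ]; push_cast; rfl, P, ?_⟩
  have : g * τ P = g * 1 := by rw [← hτ, mul_one]; exact hP
  exact mul_left_cancel₀ hg0 this

end Trace

section CyclotomicField

open scoped IntermediateField

theorem isPrimitiveRoot_mul {K : Type*} [CommRing K] {a b : ℕ} (hab : a.Coprime b) {ξ η : K}
    (hξ : IsPrimitiveRoot ξ a) (hη : IsPrimitiveRoot η b) : IsPrimitiveRoot (ξ * η) (a * b) := by
  rw [hξ.eq_orderOf, hη.eq_orderOf] at hab ⊢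
  rw [← (Commute.all ξ η).orderOf_mul_eq_mul_orderOf_of_coprime hab]
  exact IsPrimitiveRoot.orderOf _

variable {K : Type*} [Field K] [NumberField K]

theorem finrank_adjoin_primitiveRoot {k : ℕ} (hk : 0 < k) {ξ : K} (hξ : IsPrimitiveRoot ξ k) :
    Module.finrank ℚ ℚ⟮ξ⟯ = k.totient := by
  rw [IntermediateField.adjoin.finrank (hξ.isIntegral hk).tower_top,
    ← cyclotomic_eq_minpoly_rat hξ hk, natDegree_cyclotomic]

/-- The trace is multiplicative on the product of cyclotomic fields of coprime orders. -/
theorem trace_mul_aeval {a b : ℕ} (ha : 0 < a) (hb : 0 < b) (hab : a.Coprime b)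
    [IsCyclotomicExtension {a * b} ℚ K] {ξ η : K} (hξ : IsPrimitiveRoot ξ a)
    (hη : IsPrimitiveRoot η b) (hξη : IsPrimitiveRoot (ξ * η) (a * b)) (x : ℚ⟮η⟯) (P : ℤ[X]) :
    Algebra.trace ℚ K (x * aeval ξ P) = Algebra.trace ℚ ℚ⟮η⟯ x * cyclotomicTrace a P := by
  have : NeZero (a * b) := ⟨(Nat.mul_pos ha hb).ne'⟩
  have htop : ℚ⟮η⟯ ⊔ ℚ⟮ξ⟯ = ⊤ := by
    rw [eq_top_iff]
    intro z _
    have hz : z ∈ Algebra.adjoin ℚ {ξ * η} := by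
      rw [IsCyclotomicExtension.adjoin_primitive_root_eq_top hξη]; trivial
    have hle : Algebra.adjoin ℚ {ξ * η} ≤ (ℚ⟮η⟯ ⊔ ℚ⟮ξ⟯).toSubalgebra := by
      rw [Algebra.adjoin_le_iff, Set.singleton_subset_iff]
      exact mul_mem ((le_sup_right : ℚ⟮ξ⟯ ≤ ℚ⟮η⟯ ⊔ ℚ⟮ξ⟯)
        (IntermediateField.mem_adjoin_simple_self ℚ ξ))
        ((le_sup_left : ℚ⟮η⟯ ≤ ℚ⟮η⟯ ⊔ ℚ⟮ξ⟯) (IntermediateField.mem_adjoin_simple_self ℚ η))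
    exact hle hz
  have hdisj : ℚ⟮η⟯.LinearDisjoint ℚ⟮ξ⟯ := by
    apply IntermediateField.LinearDisjoint.of_finrank_sup
    rw [htop, IntermediateField.finrank_top', finrank_adjoin_primitiveRoot ha hξ,
      finrank_adjoin_primitiveRoot hb hη, IsCyclotomicExtension.finrank K
      (cyclotomic.irreducible_rat (Nat.mul_pos ha hb)), Nat.totient_mul hab, mul_comm]
  have hy : aeval ξ P = algebraMap ℚ⟮ξ⟯ K (aeval (IntermediateField.AdjoinSimple.gen ℚ ξ) P) := by
    rw [← Polynomial.aeval_algebraMap_apply]; rfl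
  rw [hy, ← Algebra.trace_trace (S := ℚ⟮η⟯),
    show (x : K) = algebraMap ℚ⟮η⟯ K x from rfl, ← Algebra.smul_def, map_smul,
    hdisj.trace_algebraMap htop, smul_eq_mul, mul_comm x, ← Algebra.smul_def, map_smul,
    smul_eq_mul, mul_comm]
  exact congrArg _ (trace_adjoin_eq_cyclotomicTrace ha hξ P)

/-- The dual of `ℤ[ζ]` for the trace form is generated by the inverse of the
derivative of the cyclotomic polynomial at `ζ`. -/
theorem trace_mem_iff_derivative_mul_mem {k : ℕ} (hk : 0 < k)
    [IsCyclotomicExtension {k} ℚ K] {ζ : K}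
    (hζ : IsPrimitiveRoot ζ k) (y : K) :
    (∀ x ∈ Algebra.adjoin ℤ {ζ}, Algebra.trace ℚ K (y * x) ∈ integerSubring) ↔
      aeval ζ (derivative (cyclotomic k ℤ)) * y ∈ Algebra.adjoin ℤ {ζ} := by
  have : NeZero k := ⟨hk.ne'⟩
  have h := traceForm_dualSubmodule_adjoin ℤ ℚ
    (IsCyclotomicExtension.adjoin_primitive_root_eq_top hζ) (hζ.isIntegral hk)
  have hδ : aeval ζ (derivative (minpoly ℚ ζ)) = aeval ζ (derivative (cyclotomic k ℤ)) := by
    rw [← cyclotomic_eq_minpoly_rat hζ hk, ← map_cyclotomic_int k ℚ, derivative_map,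
      ← algebraMap_int_eq, aeval_map_algebraMap]
  have hδ0 : aeval ζ (derivative (minpoly ℚ ζ)) ≠ 0 :=
    (Algebra.IsSeparable.isSeparable ℚ ζ).aeval_derivative_ne_zero (minpoly.aeval ℚ ζ)
  have h' := SetLike.ext_iff.mp h y
  rw [LinearMap.BilinForm.mem_dualSubmodule] at h'
  have h1 : (∀ x ∈ Algebra.adjoin ℤ {ζ}, Algebra.trace ℚ K (y * x) ∈ integerSubring) ↔
      ∀ x ∈ Subalgebra.toSubmodule (Algebra.adjoin ℤ {ζ}),
        Algebra.traceForm ℚ K y x ∈ (1 : Submodule ℤ ℚ) := by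
    refine forall₂_congr fun x _ => ?_
    rw [Algebra.traceForm_apply, Submodule.mem_one]
    rfl
  rw [h1, h', ← hδ]
  constructor
  · rintro ⟨z, hz, hzy⟩
    have hzy' : (aeval ζ (derivative (minpoly ℚ ζ)))⁻¹ * z = y := hzy
    rw [← hzy', mul_inv_cancel_left₀ hδ0]
    exact hz
  · intro hy
    exact ⟨_, hy, inv_mul_cancel_left₀ hδ0 y⟩

theorem exists_int_mul_mem_adjoin {k : ℕ} (hk : 0 < k) [IsCyclotomicExtension {k} ℚ K] {ζ : K}
    (hζ : IsPrimitiveRoot ζ k) (x : K) :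
    ∃ d : ℤ, d ≠ 0 ∧ (d : K) * x ∈ Algebra.adjoin ℤ {ζ} := by
  have : NeZero k := ⟨hk.ne'⟩
  have := IsCyclotomicExtension.Rat.isIntegralClosure_adjoin_singleton hζ
  have hx : IsAlgebraic ℤ x :=
    (IsFractionRing.isAlgebraic_iff ℤ ℚ K).mpr (IsAlgebraic.of_finite ℚ x)
  obtain ⟨d, hd, h⟩ := hx.exists_integral_multiple
  obtain ⟨z, hz⟩ := (IsIntegralClosure.isIntegral_iff (A := Algebra.adjoin ℤ {ζ})).mp h
  refine ⟨d, hd, ?_⟩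
  rw [← zsmul_eq_mul, ← hz]
  exact z.2

theorem charpoly_mulLeft_primitiveRoot {k : ℕ} (hk : 0 < k) [IsCyclotomicExtension {k} ℚ K] {ζ : K}
    (hζ : IsPrimitiveRoot ζ k) :
    (LinearMap.mulLeft ℚ ζ).charpoly = (cyclotomic k ℤ).map (Int.castRingHom ℚ) := by
  have : NeZero k := ⟨hk.ne'⟩
  have h := charpoly_leftMulMatrix (hζ.powerBasis ℚ)
  rw [IsPrimitiveRoot.powerBasis_gen, ← cyclotomic_eq_minpoly_rat hζ hk] at h
  rw [map_cyclotomic_int, ← h, Algebra.leftMulMatrix_apply, ← LinearMap.charpoly_toMatrix _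
    (hζ.powerBasis ℚ).basis]
  rfl

end CyclotomicField

section Construction

theorem one_sub_notMem_unitsIn {K : Type*} [Field K] [CharZero K] {O : Subalgebra ℤ K}
    (hO : ∀ x ∈ O, IsIntegral ℤ x) {q j : ℕ} (hq : q.Prime) {η : K} (hηO : η ∈ O)
    (hη : IsPrimitiveRoot η (q ^ (j + 1))) : 1 - η ∉ unitsIn O := by
  intro hu
  obtain ⟨w, hw, h⟩ := exists_one_sub_pow_prime_pow_eq hηO hq hη
  have hω : IsPrimitiveRoot (η ^ (q ^ j)) q := hη.pow (pow_pos hq.pos _) (pow_succ q j)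
  have hu1 : 1 - η ^ (q ^ j) ∈ unitsIn O := by
    rw [h]; exact mul_mem (pow_mem hu _) hw
  obtain ⟨k, rfl⟩ := Nat.exists_eq_add_of_lt hq.one_lt
  have hω' : IsPrimitiveRoot (η ^ ((1 + k + 1) ^ j)) (k + 1 + 1) := by convert hω using 1; ring
  have hprod := hω'.prod_one_sub_pow_eq_order
  have hqu : ((1 + k + 1 : ℕ) : K) ∈ unitsIn O := by
    have : ((1 + k + 1 : ℕ) : K) = ((k + 1 : ℕ) : K) + 1 := by push_cast; ring
    rw [this, ← hprod]
    refine prod_mem fun a ha => ?_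
    obtain ⟨v, hv, h'⟩ := exists_one_sub_pow_eq_unit (pow_mem hηO _) hq.one_lt hω (a := a + 1)
      ((Nat.coprime_of_lt_prime (Nat.succ_ne_zero a)
        (by have := Finset.mem_range.mp ha; omega) hq).symm)
    rw [h']
    exact mul_mem hu1 hv
  have hint := hO _ (inv_mem_of_mem_unitsIn hqu)
  have hint' : IsIntegral ℤ (((1 + k + 1 : ℕ) : ℚ)⁻¹) := by
    rw [← isIntegral_algebraMap_iff (algebraMap ℚ K).injective]
    simpa using hint
  obtain ⟨z, hz⟩ := IsIntegrallyClosed.isIntegral_iff.mp hint'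
  have hz' : (z : ℚ) * (1 + k + 1 : ℕ) = 1 := by
    rw [← eq_intCast (algebraMap ℤ ℚ), hz, inv_mul_cancel₀ (Nat.cast_ne_zero.mpr hq.ne_zero)]
  have hz'' : z * (1 + k + 1 : ℕ) = 1 := by exact_mod_cast hz'
  have := Int.isUnit_iff.mp (IsUnit.of_mul_eq_one_right _ hz'')
  omega

/-- The different of `ℤ[ζ]` is, up to a unit, `N / ((1 - ζ_p) (1 - η) ^ (q ^ j))`. -/
theorem exists_derivative_mul_eq {K : Type*} [Field K] [CharZero K] {O : Subalgebra ℤ K}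
    {p q i j : ℕ} [Fact p.Prime] [Fact q.Prime] (hpq : p ≠ q) {ξ η : K} (hξO : ξ ∈ O) (hηO : η ∈ O)
    (hξ : IsPrimitiveRoot ξ (p ^ (i + 1))) (hη : IsPrimitiveRoot η (q ^ (j + 1))) :
    ∃ l ∈ O, ∃ ε ∈ unitsIn O, l ≠ 0 ∧ (∃ w ∈ O, (p : K) = l * w) ∧
      aeval (ξ * η) (derivative (cyclotomic (p ^ (i + 1) * q ^ (j + 1)) ℤ)) * l *
        (1 - η) ^ (q ^ j) * ε = (p : K) ^ (i + 1) * (q : K) ^ (j + 1) := by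
  have hp : p.Prime := Fact.out
  have hq : q.Prime := Fact.out
  have hcop : p.Coprime q := (Nat.coprime_primes hp hq).mpr hpq
  have hζ := isPrimitiveRoot_mul (Nat.Coprime.pow (i + 1) (j + 1) hcop) hξ hη
  have hN : 0 < p ^ (i + 1) * q ^ (j + 1) := Nat.mul_pos (pow_pos hp.pos _) (pow_pos hq.pos _)
  have hζO : ξ * η ∈ O := mul_mem hξO hηO
  have hδ := derivative_cyclotomic_mul hp hq hpq hζ
  have hωp : IsPrimitiveRoot ((ξ * η) ^ (p ^ i * q ^ (j + 1))) p := hζ.pow hN (by ring)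
  have hωpq : IsPrimitiveRoot ((ξ * η) ^ (p ^ i * q ^ j)) (p * q) := hζ.pow hN (by ring)
  have hωq : IsPrimitiveRoot (η ^ (q ^ j)) q := hη.pow (pow_pos hq.pos _) (pow_succ q j)
  have hexp : (ξ * η) ^ (p ^ (i + 1) * q ^ j) = (η ^ (q ^ j)) ^ (p ^ (i + 1)) := by
    rw [mul_pow, pow_mul ξ, hξ.pow_eq_one, one_pow, one_mul, mul_comm, pow_mul]
  obtain ⟨u₁, hu₁, h₁⟩ := exists_one_sub_pow_eq_unit (pow_mem hηO (q ^ j)) hq.one_lt hωq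
    (Nat.Coprime.pow_left (i + 1) hcop)
  obtain ⟨u₂, hu₂, h₂⟩ := exists_one_sub_pow_prime_pow_eq hηO hq hη
  have hu₃ : 1 - (ξ * η) ^ (p ^ i * q ^ j) ∈ unitsIn O :=
    one_sub_mem_unitsIn (pow_mem hζO _) hωpq (Nat.mul_pos hp.pos hq.pos)
      (by simpa using eval_one_cyclotomic_prime_pow_mul_prime_pow hp hq hpq 0 0)
  have hζu : ξ * η ∈ unitsIn O := mem_unitsIn_of_pow_eq_one hζO hN.ne' hζ.pow_eq_one
  refine ⟨_, sub_mem (one_mem O) (pow_mem hζO (p ^ i * q ^ (j + 1))), _,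
    mul_mem (mul_mem (mul_mem hu₁ hu₂) hζu) (neg_mem_unitsIn (inv_mem_unitsIn hu₃)),
    sub_ne_zero.mpr (hωp.ne_one hp.one_lt).symm,
    exists_prime_eq_one_sub_mul (pow_mem hζO _) hωp, ?_⟩
  have hne := ne_zero_of_mem_unitsIn hu₃
  rw [hexp, h₁, h₂] at hδ
  push_cast at hδ
  field_simp
  linear_combination -hδ

end Construction

section CyclotomicGlueData

open scoped IntermediateField

theorem map_mem_adjoin_singleton {K : Type*} [CommRing K] {σ : K →+* K} {ζ x : K}
    (hσ : σ ζ ∈ Algebra.adjoin ℤ {ζ}) (hx : x ∈ Algebra.adjoin ℤ {ζ}) :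
    σ x ∈ Algebra.adjoin ℤ {ζ} := by
  have hle : Algebra.adjoin ℤ {ζ} ≤ (Algebra.adjoin ℤ {ζ}).comap σ.toIntAlgHom :=
    Algebra.adjoin_le (Set.singleton_subset_iff.mpr hσ)
  exact hle hx

theorem exists_aeval_add_mul_of_mem_adjoin {K : Type*} [CommRing K] {O : Subalgebra ℤ K}
    {ξ π w x : K} (hξ : ξ ∈ O) (hπ : π ∈ O) (hw : w ∈ O)
    (hx : x ∈ Algebra.adjoin ℤ {ξ + π * w}) :
    ∃ P : ℤ[X], ∃ v ∈ O, x = aeval ξ P + π * v := by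
  rw [Algebra.adjoin_singleton_eq_range_aeval] at hx
  obtain ⟨P, rfl⟩ := hx
  let a : O := ⟨ξ, hξ⟩
  let b : O := ⟨ξ + π * w, add_mem hξ (mul_mem hπ hw)⟩
  obtain ⟨c, hc⟩ := Polynomial.sub_dvd_eval_sub b a (P.map (algebraMap ℤ O))
  refine ⟨P, w * c, mul_mem hw c.2, ?_⟩
  rw [eval_map_algebraMap, eval_map_algebraMap] at hc
  have h := congrArg (algebraMap O K) hc
  rw [map_sub, ← aeval_algebraMap_apply, ← aeval_algebraMap_apply, map_mul, map_sub] at h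
  change aeval (ξ + π * w) P - aeval ξ P = (ξ + π * w - ξ) * c at h
  change aeval (ξ + π * w) P = _
  linear_combination h

theorem isIntegral_of_mem_adjoin_singleton {K : Type*} [CommRing K] {ζ x : K} (hζ : IsIntegral ℤ ζ)
    (hx : x ∈ Algebra.adjoin ℤ {ζ}) : IsIntegral ℤ x :=
  (Algebra.adjoin_le (Set.singleton_subset_iff.mpr hζ) :
    Algebra.adjoin ℤ {ζ} ≤ integralClosure ℤ K) hx

/-- The ring of integers of the field of `p ^ (i + 1) * q ^ (j + 1)`-th roots of unity carries the
data needed for the construction. -/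
theorem nonempty_glueData {p q i j : ℕ} [Fact p.Prime] [Fact q.Prime] (hpq : p ≠ q)
    (hp4 : p % 4 = 3) (hq4 : q % 4 = 3) {g : ℤ} {τ : ℤ[X] → ℤ}
    (hτ : ∀ P, cyclotomicTrace (p ^ (i + 1)) P = g * τ P) {P₀ : ℤ[X]} (hP₀ : τ P₀ = 1)
    (K : Type*) [Field K] [NumberField K]
    [IsCyclotomicExtension {p ^ (i + 1) * q ^ (j + 1)} ℚ K] :
    Nonempty (GlueData p q (i + 1) (p ^ (i + 1) * q ^ (j + 1))
      (gaussPolynomial p (p ^ i)) τ K) := by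
  have hp : p.Prime := Fact.out
  have hq : q.Prime := Fact.out
  have hq0 : (q : K) ≠ 0 := Nat.cast_ne_zero.mpr hq.ne_zero
  have hpn : 0 < p ^ (i + 1) := pow_pos hp.pos _
  have hqm : 0 < q ^ (j + 1) := pow_pos hq.pos _
  have hN : 0 < p ^ (i + 1) * q ^ (j + 1) := Nat.mul_pos hpn hqm
  have : NeZero (p ^ (i + 1) * q ^ (j + 1)) := ⟨hN.ne'⟩
  have hcop : (p ^ (i + 1)).Coprime (q ^ (j + 1)) :=
    Nat.Coprime.pow _ _ ((Nat.coprime_primes hp hq).mpr hpq)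
  have hN2 : 2 < p ^ (i + 1) * q ^ (j + 1) := by
    have h1 := Nat.le_self_pow (Nat.succ_ne_zero i) p
    have h2 : 3 ≤ p := by omega
    exact lt_of_lt_of_le (h2.trans h1) (Nat.le_mul_of_pos_right _ hqm)
  have : NumberField.IsCMField K := IsCyclotomicExtension.Rat.isCMField K
    (S := {p ^ (i + 1) * q ^ (j + 1)}) ⟨_, rfl, hN2⟩
  let conj : K →+* K := (NumberField.IsCMField.complexConj K : K →+* K)
  have hconj : ∀ (φ : K →+* ℂ) (x : K), φ (conj x) = star (φ x) := fun φ x =>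
    NumberField.IsCMField.complexEmbedding_complexConj K φ x
  obtain ⟨ζ₀, hζ₀⟩ := IsCyclotomicExtension.exists_isPrimitiveRoot ℚ K
    (Set.mem_singleton (p ^ (i + 1) * q ^ (j + 1))) hN.ne'
  obtain ⟨ξ, hξ⟩ : ∃ ξ : K, IsPrimitiveRoot ξ (p ^ (i + 1)) := ⟨_, hζ₀.pow hN (mul_comm _ _)⟩
  obtain ⟨η, hη⟩ : ∃ η : K, IsPrimitiveRoot η (q ^ (j + 1)) := ⟨_, hζ₀.pow hN rfl⟩
  have hζ := isPrimitiveRoot_mul hcop hξ hη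
  set O := Algebra.adjoin ℤ {ξ * η} with hO
  have hζO : ξ * η ∈ O := Algebra.self_mem_adjoin_singleton ℤ _
  have hξO : ξ ∈ O := by
    obtain ⟨a, -, ha⟩ := hζ.eq_pow_of_pow_eq_one (ξ := ξ) (by rw [pow_mul, hξ.pow_eq_one, one_pow])
    rw [← ha]; exact pow_mem hζO a
  have hηO : η ∈ O := by
    obtain ⟨a, -, ha⟩ := hζ.eq_pow_of_pow_eq_one (ξ := η)
      (by rw [mul_comm, pow_mul, hη.pow_eq_one, one_pow])
    rw [← ha]; exact pow_mem hζO a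
  have hOint : ∀ x ∈ O, IsIntegral ℤ x := fun x hx =>
    isIntegral_of_mem_adjoin_singleton (hζ.isIntegral hN) hx
  set π := 1 - η with hπdef
  have hπO : π ∈ O := sub_mem (one_mem O) hηO
  have hπ0 : π ≠ 0 := sub_ne_zero.mpr
    (hη.ne_one (Nat.one_lt_pow (Nat.succ_ne_zero j) hq.one_lt)).symm
  have hηu : η ∈ unitsIn O := mem_unitsIn_of_pow_eq_one hηO hqm.ne' hη.pow_eq_one
  have hconjη : conj η = η ^ (q ^ (j + 1) - 1) :=
    conj_eq_pow_of_pow_eq_one hconj hqm.ne' hη.pow_eq_one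
  obtain ⟨ν, hν, hνdef⟩ : ∃ ν ∈ unitsIn O, ν = -η ^ (q ^ (j + 1) - 1) :=
    ⟨_, neg_mem_unitsIn (pow_mem hηu _), rfl⟩
  have hconjπ : conj π = π * ν := by
    have h := mul_conj_of_pow_eq_one hconj hqm.ne' hη.pow_eq_one
    rw [hconjη] at h
    rw [hπdef, map_sub, map_one, hconjη, hνdef]
    linear_combination -h
  have hωq : IsPrimitiveRoot (η ^ (q ^ j)) q := hη.pow hqm (pow_succ q j)
  have hωp : IsPrimitiveRoot (ξ ^ (p ^ i)) p := hξ.pow hpn (pow_succ p i)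
  set H := aeval η (gaussPolynomial q (q ^ j)) with hHdef
  have hHsq : H ^ 2 = -(q : K) := aeval_gaussPolynomial_sq hq4 hωq
  have hconjH : conj H = -H := conj_eq_neg_of_sq_eq_neg hconj hq.pos hHsq
  have hH0 : H ≠ 0 := fun h => hq0 (by rw [h] at hHsq; linear_combination hHsq)
  have hGsq := aeval_gaussPolynomial_sq hp4 hωp
  have hHπ : ∃ w ∈ O, H = π * w := by
    obtain ⟨w, hw, h⟩ := exists_aeval_eq_eval_one_add hηO (gaussPolynomial q (q ^ j))
    rw [eval_one_gaussPolynomial hq4, Int.cast_zero, zero_add] at h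
    exact ⟨w, hw, h⟩
  have hqπ : ∃ w ∈ O, (q : K) = π * w := by
    obtain ⟨w, hw, h⟩ := hHπ
    refine ⟨-(w * H), neg_mem (mul_mem hw (h ▸ mul_mem hπO hw)), ?_⟩
    linear_combination hHsq - H * h
  obtain ⟨h, hh⟩ : ∃ h, q ^ j = 2 * h + 1 :=
    (show Odd q from Nat.odd_iff.mpr (by omega)).pow
  set e := π ^ h / H ^ (j + 1) with hedef
  have he0 : e ≠ 0 := div_ne_zero (pow_ne_zero _ hπ0) (pow_ne_zero _ hH0)
  have hconje : conj e = (π * ν) ^ h / (-H) ^ (j + 1) := by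
    rw [hedef, map_div₀, map_pow, map_pow, hconjπ, hconjH]
  have heπ : e * conj e * π * (q : K) ^ (j + 1) = π ^ (q ^ j) * ν ^ h := by
    have h1 : H ^ (j + 1) * (-H) ^ (j + 1) = (q : K) ^ (j + 1) := by
      rw [← mul_pow]; congr 1; linear_combination -hHsq
    have h2 : (-H) ^ (j + 1) ≠ 0 := pow_ne_zero _ (neg_ne_zero.mpr hH0)
    rw [hconje, hedef, ← h1, hh]
    field_simp
    ring_nf
  obtain ⟨l, hl, ε, hε, hl0, ⟨w, hw, hpl⟩, hδ⟩ :=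
    exists_derivative_mul_eq (i := i) (j := j) hpq hξO hηO hξ hη
  set δ := aeval (ξ * η) (derivative (cyclotomic (p ^ (i + 1) * q ^ (j + 1)) ℤ))
  have hε0 := ne_zero_of_mem_unitsIn hε
  have hν0 := ne_zero_of_mem_unitsIn hν
  have hδe : δ * (e * conj e * π) * ε * l = (p : K) ^ (i + 1) * ν ^ h := by
    apply mul_right_cancel₀ (pow_ne_zero (j + 1) hq0)
    linear_combination δ * ε * l * heπ + ν ^ h * hδ
  have htrace_mem : ∀ x ∈ O, Algebra.trace ℚ K (e * conj e * π * x) ∈ integerSubring := by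
    refine (trace_mem_iff_derivative_mul_mem hN hζ _).mpr ?_
    have : δ * (e * conj e * π) = (p : K) ^ i * w * ν ^ h * ε⁻¹ := by
      rw [eq_mul_inv_iff_mul_eq₀ hε0]
      apply mul_right_cancel₀ hl0
      rw [hδe, pow_succ]
      linear_combination (p : K) ^ i * ν ^ h * hpl
    rw [this]
    exact mul_mem (mul_mem (mul_mem (pow_mem (natCast_mem O p) i) hw)
      (pow_mem (mem_of_mem_unitsIn hν) h)) (inv_mem_of_mem_unitsIn hε)
  have hmem_trace : ∀ y, (∀ x ∈ O, Algebra.trace ℚ K (y * x) ∈ integerSubring) →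
      ∃ w ∈ O, (p : K) ^ (i + 1) * y = e * conj e * π * w := by
    intro y hy
    have hy' := (trace_mem_iff_derivative_mul_mem hN hζ y).mp hy
    refine ⟨l * ε * (δ * y) * (ν ^ h)⁻¹, mul_mem (mul_mem (mul_mem hl (mem_of_mem_unitsIn hε)) hy')
      (inv_mem_of_mem_unitsIn (pow_mem hν h)), ?_⟩
    have hνh : ν ^ h ≠ 0 := pow_ne_zero h hν0
    rw [← mul_assoc, eq_mul_inv_iff_mul_eq₀ hνh]
    linear_combination -y * hδe
  have hres : ∀ x ∈ O, ∃ P : ℤ[X], ∃ w ∈ O, x = aeval ξ P + π * w := fun x hx =>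
    exists_aeval_add_mul_of_mem_adjoin (w := -ξ) hξO hπO (neg_mem hξO)
      (by rw [hπdef, show ξ + (1 - η) * -ξ = ξ * η by ring]; exact hx)
  have hee : e * conj e ∈ ℚ⟮η⟯ := by
    have h1 : η ∈ ℚ⟮η⟯ := IntermediateField.mem_adjoin_simple_self ℚ η
    have h2 : π ∈ ℚ⟮η⟯ := sub_mem (one_mem _) h1
    have h3 : H ∈ ℚ⟮η⟯ :=
      aeval_mem_subalgebra (O := (ℚ⟮η⟯).toSubalgebra.restrictScalars ℤ) h1 _
    have h4 : ν ∈ ℚ⟮η⟯ := by rw [hνdef]; exact neg_mem (pow_mem h1 _)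
    rw [hconje, hedef]
    exact mul_mem (div_mem (pow_mem h2 _) (pow_mem h3 _))
      (div_mem (pow_mem (mul_mem h2 h4) _) (pow_mem (neg_mem h3) _))
  have htr (P : ℤ[X]) : Algebra.trace ℚ K (e * conj e * aeval ξ P) =
      Algebra.trace ℚ ℚ⟮η⟯ ⟨_, hee⟩ * g * τ P := by
    rw [mul_assoc (Algebra.trace ℚ ℚ⟮η⟯ _), ← hτ]
    exact trace_mul_aeval hpn hqm hcop hξ hη hζ ⟨_, hee⟩ P
  obtain ⟨c, hc⟩ : ∃ c : ℤ, q * (Algebra.trace ℚ ℚ⟮η⟯ ⟨_, hee⟩ * g) = c := by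
    obtain ⟨w, hw, hqw⟩ := hqπ
    obtain ⟨c, hc⟩ := mem_integerSubring.mp
      (htrace_mem _ (mul_mem hw (aeval_mem_subalgebra hξO P₀)))
    refine ⟨c, ?_⟩
    have h1 := htr P₀
    rw [hP₀, Int.cast_one, mul_one] at h1
    rw [← hc, ← h1, ← nsmul_eq_mul, ← map_nsmul, nsmul_eq_mul, hqw]
    congr 1; ring
  have hq0' : (q : ℚ) ≠ 0 := Nat.cast_ne_zero.mpr hq.ne_zero
  have htr' (P : ℤ[X]) : Algebra.trace ℚ K (e * conj e * aeval ξ P) = c * τ P / q := by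
    rw [htr, ← hc]; field_simp
  refine ⟨{
    O := O, conj := conj, ζ := ξ * η, ξ := ξ, π := π, e := e, H := H, c := c
    fg := (hζ.isIntegral hN).fg_adjoin_singleton
    exists_int_mul_mem := exists_int_mul_mem_adjoin hN hζ
    embedding_conj := hconj
    conj_mem := fun x hx => map_mem_adjoin_singleton
      (by rw [conj_eq_pow_of_pow_eq_one hconj hN.ne' hζ.pow_eq_one]; exact pow_mem hζO _) hx
    ξ_mem := hξO, π_mem := hπO, π_ne := hπ0, e_ne := he0
    ζ_mul_conj := mul_conj_of_pow_eq_one hconj hN.ne' hζ.pow_eq_one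
    charpoly_ζ := charpoly_mulLeft_primitiveRoot hN hζ
    conj_ξ := conj_eq_pow_of_pow_eq_one hconj hpn.ne' hξ.pow_eq_one
    conj_π := ⟨ν, mem_of_mem_unitsIn hν, hconjπ⟩
    ζ_eq := ⟨-ξ, neg_mem hξO, by rw [hπdef]; ring⟩
    exists_residue := hres
    H_eq := hHπ, H_sq := hHsq, conj_H := hconjH, aeval_G_sq := hGsq
    conj_aeval_G := conj_eq_neg_of_sq_eq_neg hconj hp.pos hGsq
    trace_mem := htrace_mem
    mem_of_trace_mem := hmem_trace
    c_not_dvd := ?_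
    trace_eq := htr' }⟩
  rintro ⟨d, rfl⟩
  obtain ⟨v, hv, hpv⟩ := hmem_trace (e * conj e) fun x hx => by
    obtain ⟨P, w, hw, rfl⟩ := hres x hx
    rw [mul_add, map_add, ← mul_assoc]
    refine add_mem (mem_integerSubring.mpr ⟨d * τ P, ?_⟩) (htrace_mem w hw)
    rw [htr']
    push_cast
    field_simp
  obtain ⟨w, hw, hqw⟩ := hqπ
  have hconje0 : conj e ≠ 0 := (map_ne_zero conj).mpr he0
  have hpv' : (p : K) ^ (i + 1) = π * v := by
    apply mul_right_cancel₀ (mul_ne_zero he0 hconje0)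
    rw [hpv]; ring
  have hbez : IsCoprime ((p ^ (i + 1) : ℕ) : ℤ) (q : ℤ) :=
    Nat.isCoprime_iff_coprime.mpr (((Nat.coprime_primes hp hq).mpr hpq).pow_left _)
  obtain ⟨a, b, hab⟩ := hbez
  have hab' : (a : K) * (p : K) ^ (i + 1) + b * q = 1 := by
    exact_mod_cast congrArg (Int.cast : ℤ → K) hab
  have hunit : π * (a * v + b * w) = 1 := by
    rw [← hab', hpv', hqw]; ring
  refine one_sub_notMem_unitsIn hOint hq hηO hη ⟨hπ0, hπO, ?_⟩
  rw [inv_eq_of_mul_eq_one_right hunit]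
  exact add_mem (mul_mem (intCast_mem O a) hv) (mul_mem (intCast_mem O b) hw)

end CyclotomicGlueData

theorem exists_dvd_sq_add_of_legendreSym {p q : ℕ} [Fact p.Prime] [Fact q.Prime]
    (hp4 : p % 4 = 3) (hq4 : q % 4 = 3) (h : legendreSym q p = 1) :
    ∃ s : ℤ, (p : ℤ) ∣ s ^ 2 + q := by
  have h1 : legendreSym p q = -1 := by
    rw [legendreSym.quadratic_reciprocity_three_mod_four hq4 hp4, h]
  have h2 : legendreSym p (-q) = 1 := by
    rw [← neg_one_mul, legendreSym.mul, legendreSym.at_neg_one (by rintro rfl; simp at hp4),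
      ZMod.χ₄_nat_three_mod_four hp4, h1]
    norm_num
  have h0 : ((-q : ℤ) : ZMod p) ≠ 0 := fun h0 => by
    rw [(legendreSym.eq_zero_iff p _).mpr h0] at h2
    exact zero_ne_one h2
  obtain ⟨x, hx⟩ := (legendreSym.eq_one_iff p h0).mp h2
  obtain ⟨s, rfl⟩ := ZMod.intCast_surjective x
  refine ⟨s, (ZMod.intCast_zmod_eq_zero_iff_dvd _ p).mp ?_⟩
  push_cast at hx ⊢
  linear_combination -hx

/-- `CyclotomicField k ℚ` is cyclotomic for its structure of algebra over `ℚ` as a field of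
characteristic zero. -/
theorem isCyclotomicExtension_cyclotomicField_rat (k : ℕ) :
    @IsCyclotomicExtension {k} ℚ (CyclotomicField k ℚ) _ _ DivisionRing.toRatAlgebra := by
  have h : @IsCyclotomicExtension {k} ℚ (CyclotomicField k ℚ) _ _
    (CyclotomicField.algebra k ℚ) := inferInstance
  convert h using 1
  exact Subsingleton.elim _ _

theorem stmt_10 (p q : ℕ) (hp : p.Prime) [Fact q.Prime] (hpq : p ≠ q)
    (hp4 : p % 4 = 3) (hq4 : q % 4 = 3)
    (n m t : ℕ) (hn : 1 ≤ n) (hm : 1 ≤ m) (ht : 1 ≤ t) (hmt : m ≠ t)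
    (hleg : legendreSym q p = 1) :
    ∃ B T : Matrix (Fin ((cyclotomic (p ^ n * q ^ m) ℤ * cyclotomic (p ^ n * q ^ t) ℤ).natDegree))
        (Fin ((cyclotomic (p ^ n * q ^ m) ℤ * cyclotomic (p ^ n * q ^ t) ℤ).natDegree)) ℤ,
      B.IsSymm ∧ (∀ i, Even (B i i)) ∧
      (∀ x, x ≠ 0 → 0 < x ⬝ᵥ B.mulVec x) ∧
      B.det = 1 ∧ Tᵀ * B * T = B ∧
      T.charpoly = cyclotomic (p ^ n * q ^ m) ℤ * cyclotomic (p ^ n * q ^ t) ℤ := by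
  have : Fact p.Prime := ⟨hp⟩
  have hq : q.Prime := Fact.out
  obtain ⟨i, rfl⟩ := Nat.exists_eq_add_of_le' hn
  obtain ⟨j, rfl⟩ := Nat.exists_eq_add_of_le' hm
  obtain ⟨k, rfl⟩ := Nat.exists_eq_add_of_le' ht
  obtain ⟨g, τ, -, hτ, P₀, hP₀⟩ := exists_cyclotomicTrace_eq_mul (pow_pos hp.pos (i + 1))
  have hcyc := isCyclotomicExtension_cyclotomicField_rat
  obtain ⟨D₁⟩ := nonempty_glueData (j := j) hpq hp4 hq4 hτ hP₀
    (CyclotomicField (p ^ (i + 1) * q ^ (j + 1)) ℚ)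
  obtain ⟨D₂⟩ := nonempty_glueData (j := k) hpq hp4 hq4 hτ hP₀
    (CyclotomicField (p ^ (i + 1) * q ^ (k + 1)) ℚ)
  obtain ⟨s, hs⟩ := exists_dvd_sq_add_of_legendreSym hp4 hq4 hleg
  exact D₁.exists_gram_matrix D₂ hpq (by omega) (by omega) hs (by
    rw [eval_mul, eval_one_cyclotomic_prime_pow_mul_prime_pow hp hq hpq,
      eval_one_cyclotomic_prime_pow_mul_prime_pow hp hq hpq, one_mul])
end
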